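/- arXiv:1109.3646 — 2 statements merged into one kernel-verified Lean document; each statement's English description precedes it below -/
import Mathlib

section
/- If X is K-reduced, then X_pr is Zariski dense in X; and if X is almost K-reduced, then X_apr is Zariski dense in X. -/
/-!
Common framework: a "compact Lie group / complex reductive group acting on a
finite-dimensional module" is modelled as a subgroup of invertible `n × n`
matrices over `𝕜 = ℝ` or `ℂ` acting on `Fin n → 𝕜` by `Matrix.mulVec`.
Polynomial functions on the module are `MvPolynomial (Fin n) 𝕜`.
-/

set_option synthInstance.maxHeartbeats 1000000
set_option maxHeartbeats 1000000

noncomputable section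

open MvPolynomial

namespace ZPaper

variable (𝕜 : Type) [RCLike 𝕜] (n : ℕ)

/-- The zero set of a family of polynomials. -/
def zeroSet (S : Set (MvPolynomial (Fin n) 𝕜)) : Set (Fin n → 𝕜) :=
  {v | ∀ p ∈ S, eval v p = 0}

/-- A subset of `𝕜ⁿ` is algebraic if it is the zero set of a family of polynomials. -/
def IsAlgebraicSet (X : Set (Fin n → 𝕜)) : Prop :=
  ∃ S : Set (MvPolynomial (Fin n) 𝕜), X = zeroSet 𝕜 n S

/-- The vanishing ideal `I(X)` of a subset `X ⊆ 𝕜ⁿ`. -/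
def vanishingIdeal (X : Set (Fin n → 𝕜)) : Ideal (MvPolynomial (Fin n) 𝕜) where
  carrier := {p | ∀ x ∈ X, eval x p = 0}
  zero_mem' := by intro x _; simp
  add_mem' := by intro a b ha hb x hx; simp [ha x hx, hb x hx]
  smul_mem' := by intro c p hp x hx; simp [smul_eq_mul, hp x hx]

/-- The Zariski closure of a subset of `𝕜ⁿ`. -/
def zclosure (A : Set (Fin n → 𝕜)) : Set (Fin n → 𝕜) :=
  zeroSet 𝕜 n (vanishingIdeal 𝕜 n A : Set (MvPolynomial (Fin n) 𝕜))

/-- `A` is Zariski dense in `X`: every polynomial vanishing on `A` vanishes on `X`. -/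
def ZDenseIn (A X : Set (Fin n → 𝕜)) : Prop :=
  ∀ p : MvPolynomial (Fin n) 𝕜, (∀ a ∈ A, eval a p = 0) → ∀ x ∈ X, eval x p = 0

/-- A set of matrices is a subgroup of `GL_n(𝕜)`. -/
def IsMatSubgroup (G : Set (Matrix (Fin n) (Fin n) 𝕜)) : Prop :=
  (1 : Matrix (Fin n) (Fin n) 𝕜) ∈ G ∧ (∀ a ∈ G, ∀ b ∈ G, a * b ∈ G) ∧
    ∀ a ∈ G, IsUnit a ∧ a⁻¹ ∈ G

/-- `X` is a `G`-stable subset of `𝕜ⁿ`. -/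
def Stabilizes (G : Set (Matrix (Fin n) (Fin n) 𝕜)) (X : Set (Fin n → 𝕜)) : Prop :=
  ∀ g ∈ G, ∀ x ∈ X, Matrix.mulVec g x ∈ X

/-- A polynomial is `G`-invariant. -/
def Invariant (G : Set (Matrix (Fin n) (Fin n) 𝕜)) (p : MvPolynomial (Fin n) 𝕜) : Prop :=
  ∀ g ∈ G, ∀ v : Fin n → 𝕜, eval (Matrix.mulVec g v) p = eval v p

/-- `I_G(X)`: the ideal generated by the `G`-invariant polynomials vanishing on `X`,
i.e. by `I(X)^G = I(X) ∩ 𝕜[V]^G`. -/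
def invariantIdeal (G : Set (Matrix (Fin n) (Fin n) 𝕜)) (X : Set (Fin n → 𝕜)) :
    Ideal (MvPolynomial (Fin n) 𝕜) :=
  Ideal.span {p | Invariant 𝕜 n G p ∧ ∀ x ∈ X, eval x p = 0}

/-- `X` is `G`-reduced: `I_G(X) = I(X)`. -/
def IsGReduced (G : Set (Matrix (Fin n) (Fin n) 𝕜)) (X : Set (Fin n → 𝕜)) : Prop :=
  invariantIdeal 𝕜 n G X = vanishingIdeal 𝕜 n X

/-- `X` is almost `G`-reduced: `√I_G(X) = I(X)`. -/
def IsAlmostGReduced (G : Set (Matrix (Fin n) (Fin n) 𝕜)) (X : Set (Fin n → 𝕜)) : Prop :=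
  (invariantIdeal 𝕜 n G X).radical = vanishingIdeal 𝕜 n X

/-- The orbit `G·v`. -/
def orbit (G : Set (Matrix (Fin n) (Fin n) 𝕜)) (v : Fin n → 𝕜) : Set (Fin n → 𝕜) :=
  (fun g => Matrix.mulVec g v) '' G

/-- The isotropy group `G_v`. -/
def isotropy (G : Set (Matrix (Fin n) (Fin n) 𝕜)) (v : Fin n → 𝕜) :
    Set (Matrix (Fin n) (Fin n) 𝕜) :=
  {g ∈ G | Matrix.mulVec g v = v}

/-- Matrix exponential. -/
def mexp (A : Matrix (Fin n) (Fin n) 𝕜) : Matrix (Fin n) (Fin n) 𝕜 :=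
  ∑' k : ℕ, ((k.factorial : 𝕜)⁻¹) • A ^ k

/-- The Lie algebra of a matrix group: matrices whose one-parameter subgroup lies in `G`. -/
def lieAlgebra (G : Set (Matrix (Fin n) (Fin n) 𝕜)) : Set (Matrix (Fin n) (Fin n) 𝕜) :=
  {A | ∀ t : 𝕜, mexp 𝕜 n (t • A) ∈ G}

/-- The tangent space `T_v(G·v)` to the orbit, i.e. `𝔤·v`. -/
def orbitTangent (G : Set (Matrix (Fin n) (Fin n) 𝕜)) (v : Fin n → 𝕜) :
    Submodule 𝕜 (Fin n → 𝕜) :=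
  Submodule.span 𝕜 ((fun A => Matrix.mulVec A v) '' lieAlgebra 𝕜 n G)

/-- `N` is a `G_v`-stable complement to `T_v(G·v)` in `𝕜ⁿ` (a slice at `v`). -/
def IsSliceComplement (G : Set (Matrix (Fin n) (Fin n) 𝕜)) (v : Fin n → 𝕜)
    (N : Submodule 𝕜 (Fin n → 𝕜)) : Prop :=
  IsCompl (orbitTangent 𝕜 n G v) N ∧
    ∀ g ∈ isotropy 𝕜 n G v, ∀ x ∈ N, Matrix.mulVec g x ∈ N

/-- The image of `H` in `GL(N)` is trivial. -/
def ActsTriviallyOn (H : Set (Matrix (Fin n) (Fin n) 𝕜))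
    (N : Submodule 𝕜 (Fin n → 𝕜)) : Prop :=
  ∀ g ∈ H, ∀ x ∈ N, Matrix.mulVec g x = x

/-- The image of `H` in `GL(N)` is finite. -/
def HasFiniteImageOn (H : Set (Matrix (Fin n) (Fin n) 𝕜))
    (N : Submodule 𝕜 (Fin n → 𝕜)) : Prop :=
  Set.Finite ((fun g => fun x : N => Matrix.mulVec g (x : Fin n → 𝕜)) '' H)

/-- The orbit `G·v` is (Zariski) closed. -/
def HasClosedOrbit (G : Set (Matrix (Fin n) (Fin n) 𝕜)) (v : Fin n → 𝕜) : Prop :=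
  zclosure 𝕜 n (orbit 𝕜 n G v) ⊆ orbit 𝕜 n G v

/-- `v` lies on a principal orbit: `G·v` is closed and the isotropy group acts trivially on
some (hence any) slice at `v`. -/
def IsPrincipalPt (G : Set (Matrix (Fin n) (Fin n) 𝕜)) (v : Fin n → 𝕜) : Prop :=
  HasClosedOrbit 𝕜 n G v ∧
    ∃ N, IsSliceComplement 𝕜 n G v N ∧ ActsTriviallyOn 𝕜 n (isotropy 𝕜 n G v) N

/-- `v` lies on an almost principal orbit. -/
def IsAlmostPrincipalPt (G : Set (Matrix (Fin n) (Fin n) 𝕜)) (v : Fin n → 𝕜) : Prop :=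
  HasClosedOrbit 𝕜 n G v ∧
    ∃ N, IsSliceComplement 𝕜 n G v N ∧ HasFiniteImageOn 𝕜 n (isotropy 𝕜 n G v) N

/-- The set of principal points `V_pr`. -/
def prPoints (G : Set (Matrix (Fin n) (Fin n) 𝕜)) : Set (Fin n → 𝕜) :=
  {v | IsPrincipalPt 𝕜 n G v}

/-- The set of almost principal points `V_apr`. -/
def aprPoints (G : Set (Matrix (Fin n) (Fin n) 𝕜)) : Set (Fin n → 𝕜) :=
  {v | IsAlmostPrincipalPt 𝕜 n G v}

/-- `π⁻¹(π(Y))`: all points that the invariants cannot separate from `Y`. -/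
def saturation (G : Set (Matrix (Fin n) (Fin n) 𝕜)) (Y : Set (Fin n → 𝕜)) :
    Set (Fin n → 𝕜) :=
  {v | ∃ y ∈ Y, ∀ p, Invariant 𝕜 n G p → eval v p = eval y p}

/-- `Y` is `G`-saturated: `Y = π⁻¹(π(Y))`. -/
def IsSaturated (G : Set (Matrix (Fin n) (Fin n) 𝕜)) (Y : Set (Fin n → 𝕜)) : Prop :=
  Y = saturation 𝕜 n G Y

/-- The fiber `π⁻¹(π(v))` of the quotient morphism. -/
def piFiber (G : Set (Matrix (Fin n) (Fin n) 𝕜)) (v : Fin n → 𝕜) : Set (Fin n → 𝕜) :=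
  {u | ∀ p, Invariant 𝕜 n G p → eval u p = eval v p}

/-- The invariant ring `𝕜[V]^G` as a subalgebra of `𝕜[V]`. -/
def invariantSubalgebra (G : Set (Matrix (Fin n) (Fin n) 𝕜)) :
    Subalgebra 𝕜 (MvPolynomial (Fin n) 𝕜) where
  carrier := {p | Invariant 𝕜 n G p}
  mul_mem' := by intro a b ha hb g hg v; simp [ha g hg v, hb g hg v]
  one_mem' := by intro g hg v; simp
  add_mem' := by intro a b ha hb g hg v; simp [ha g hg v, hb g hg v]
  zero_mem' := by intro g hg v; simp
  algebraMap_mem' := by intro r g hg v; simp [MvPolynomial.algebraMap_eq]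

/-- The representation is cofree: `𝕜[V]` is a free module over `𝕜[V]^G`. -/
def IsCofree (G : Set (Matrix (Fin n) (Fin n) 𝕜)) : Prop :=
  Module.Free ↥(invariantSubalgebra 𝕜 n G) (MvPolynomial (Fin n) 𝕜)

/-- The vanishing ideal of `π(Y)` in `𝕜[V//G] = 𝕜[V]^G`. -/
def quotVanishingIdeal (G : Set (Matrix (Fin n) (Fin n) 𝕜)) (Y : Set (Fin n → 𝕜)) :
    Ideal ↥(invariantSubalgebra 𝕜 n G) where
  carrier := {p | ∀ y ∈ Y, eval y (p : MvPolynomial (Fin n) 𝕜) = 0}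
  zero_mem' := by intro y hy; simp
  add_mem' := by intro a b ha hb y hy; simp [ha y hy, hb y hy]
  smul_mem' := by intro c p hp y hy; simp [smul_eq_mul, hp y hy]

/-- The module is stable: there is a nonempty Zariski-open set of points with closed orbit. -/
def IsStableModule (G : Set (Matrix (Fin n) (Fin n) 𝕜)) : Prop :=
  ∃ U : Set (Fin n → 𝕜), U.Nonempty ∧ IsAlgebraicSet 𝕜 n Uᶜ ∧
    ∀ v ∈ U, HasClosedOrbit 𝕜 n G v

/-- `G` is Zariski closed in `GL_n(𝕜)`. -/
def IsZClosedInGL (G : Set (Matrix (Fin n) (Fin n) 𝕜)) : Prop :=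
  ∃ P : Set (MvPolynomial (Fin n × Fin n) 𝕜),
    G = {g | IsUnit g ∧ ∀ p ∈ P, eval (fun ij => g ij.1 ij.2) p = 0}

/-- `G` is a (linearly) reductive algebraic group: a Zariski closed subgroup of `GL_n`
containing a Zariski-dense compact subgroup (the unitarian trick characterization). -/
def IsReductiveGroup (G : Set (Matrix (Fin n) (Fin n) 𝕜)) : Prop :=
  IsMatSubgroup 𝕜 n G ∧ IsZClosedInGL 𝕜 n G ∧
    ∃ K : Set (Matrix (Fin n) (Fin n) 𝕜), K ⊆ G ∧ IsCompact K ∧ IsMatSubgroup 𝕜 n K ∧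
      ∀ p : MvPolynomial (Fin n × Fin n) 𝕜,
        (∀ k ∈ K, eval (fun ij => k ij.1 ij.2) p = 0) →
          ∀ g ∈ G, eval (fun ij => g ij.1 ij.2) p = 0

/-- The isotropy groups of `v` and `w` are conjugate in `G`. -/
def ConjIsotropy (G : Set (Matrix (Fin n) (Fin n) 𝕜)) (v w : Fin n → 𝕜) : Prop :=
  ∃ g ∈ G, isotropy 𝕜 n G w = (fun h => g * h * g⁻¹) '' isotropy 𝕜 n G v

/-- The (Luna) stratum of `V` determined by a point `v` with closed orbit: the inverse image
under `π` of the set of closed orbits with isotropy group conjugate to `G_v`. -/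
def stratumOf (G : Set (Matrix (Fin n) (Fin n) 𝕜)) (v : Fin n → 𝕜) : Set (Fin n → 𝕜) :=
  {u | ∃ w, HasClosedOrbit 𝕜 n G w ∧ w ∈ zclosure 𝕜 n (orbit 𝕜 n G u) ∧
    ConjIsotropy 𝕜 n G v w}

/-- Dimension of (the Zariski closure of) a subset of `𝕜ⁿ`, as the Krull dimension of its
coordinate ring. -/
def adim (X : Set (Fin n → 𝕜)) : WithBot ℕ∞ :=
  ringKrullDim (MvPolynomial (Fin n) 𝕜 ⧸ vanishingIdeal 𝕜 n X)

/-- A nonempty algebraic set with prime vanishing ideal, i.e. an irreducible algebraic set. -/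
def IsIrredAlg (Z : Set (Fin n → 𝕜)) : Prop :=
  IsAlgebraicSet 𝕜 n Z ∧ Z.Nonempty ∧ (vanishingIdeal 𝕜 n Z).IsPrime

/-- `Z` is an irreducible component of `Y`. -/
def IsIrredComponentOf (Y Z : Set (Fin n → 𝕜)) : Prop :=
  IsIrredAlg 𝕜 n Z ∧ Z ⊆ Y ∧
    ∀ Z', IsIrredAlg 𝕜 n Z' → Z ⊆ Z' → Z' ⊆ Y → Z' = Z

/-- The rank at `v` of the differential of `f = (f_1, …, f_d) : V → 𝕜^d`. -/
def jacRank {d : ℕ} (f : Fin d → MvPolynomial (Fin n) 𝕜) (v : Fin n → 𝕜) : ℕ :=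
  (Matrix.of fun (i : Fin d) (j : Fin n) => eval v (pderiv j (f i))).rank

/-- A polynomial is `H`-invariant as a function on the submodule `N`. -/
def InvariantOn (H : Set (Matrix (Fin n) (Fin n) 𝕜)) (N : Submodule 𝕜 (Fin n → 𝕜))
    (p : MvPolynomial (Fin n) 𝕜) : Prop :=
  ∀ g ∈ H, ∀ x ∈ N, eval (Matrix.mulVec g x) p = eval x p

/-- The null cone of the `H`-module `N`: points of `N` which the `H`-invariant functions on `N`
cannot separate from `0`. -/
def sliceNullCone (H : Set (Matrix (Fin n) (Fin n) 𝕜)) (N : Submodule 𝕜 (Fin n → 𝕜)) :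
    Set (Fin n → 𝕜) :=
  {x | x ∈ N ∧ ∀ p, InvariantOn 𝕜 n H N p → eval x p = eval (0 : Fin n → 𝕜) p}

/-- The `H`-module `N` is coreduced: the vanishing ideal of its null cone in `𝕜[N]` is
generated by `H`-invariant functions.  (Stated in `𝕜[V]`: the vanishing ideal of the null
cone equals the ideal generated by the invariant functions vanishing on it together with the
vanishing ideal of `N`.) -/
def CoreducedOn (H : Set (Matrix (Fin n) (Fin n) 𝕜)) (N : Submodule 𝕜 (Fin n → 𝕜)) : Prop :=
  vanishingIdeal 𝕜 n (sliceNullCone 𝕜 n H N) =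
    Ideal.span ({p | InvariantOn 𝕜 n H N p ∧ ∀ x ∈ sliceNullCone 𝕜 n H N, eval x p = 0} ∪
      {p | ∀ x ∈ (N : Set (Fin n → 𝕜)), eval x p = 0})

/-- Complexification of a real vector. -/
def cVec (w : Fin n → ℝ) : Fin n → ℂ := fun i => (w i : ℂ)

/-- The complexification `G = K_ℂ` of a compact matrix group `K ⊆ GL_n(ℝ)`: the Zariski
closure of `K` in the complex matrices. -/
def complexifiedGroup (K : Set (Matrix (Fin n) (Fin n) ℝ)) :
    Set (Matrix (Fin n) (Fin n) ℂ) :=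
  {g | ∀ p : MvPolynomial (Fin n × Fin n) ℂ,
    (∀ k ∈ K, eval (fun ij => (k ij.1 ij.2 : ℂ)) p = 0) →
      eval (fun ij => g ij.1 ij.2) p = 0}

/-- The complexification `Y = X_ℂ ⊆ ℂⁿ` of `X ⊆ ℝⁿ`: the Zariski closure of `X` in `ℂⁿ`. -/
def complexification (X : Set (Fin n → ℝ)) : Set (Fin n → ℂ) :=
  zclosure ℂ n (cVec n '' X)

section Gradient

variable {n : ℕ}

/-- The gradient of a polynomial at a point. -/
def grad (q : MvPolynomial (Fin n) ℝ) (x : Fin n → ℝ) : Fin n → ℝ :=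
  fun i => eval x (pderiv i q)

theorem hasDerivAt_eval_comp {c : ℝ → Fin n → ℝ} {c' : Fin n → ℝ} {t : ℝ}
    (hc : HasDerivAt c c' t) (q : MvPolynomial (Fin n) ℝ) :
    HasDerivAt (fun s => eval (c s) q) (grad q (c t) ⬝ᵥ c') t := by
  rw [hasDerivAt_pi] at hc
  induction q using MvPolynomial.induction_on with
  | C a => simpa [grad, dotProduct] using hasDerivAt_const t a
  | add p q hp hq =>
    have h := hp.fun_add hq
    refine (h.congr_deriv ?_).congr_of_eventuallyEq (.of_forall fun s => by simp)
    simp [grad, dotProduct, add_mul, Finset.sum_add_distrib]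
  | mul_X p i hp =>
    have h := hp.fun_mul (hc i)
    refine (h.congr_deriv ?_).congr_of_eventuallyEq (.of_forall fun s => by simp)
    symm
    simp only [grad, dotProduct, Derivation.leibniz, pderiv_X, smul_eq_mul, map_add, map_mul,
      eval_X, add_mul, Finset.sum_add_distrib, Finset.sum_mul]
    rw [add_comm]
    congr 1
    · exact Finset.sum_congr rfl fun j _ => by ring
    · rw [Finset.sum_eq_single i]
      · simp
      · intro j _ hj
        simp [hj.symm]
      · simp

theorem hasDerivAt_mulVec {c : ℝ → Matrix (Fin n) (Fin n) ℝ} {c' : Matrix (Fin n) (Fin n) ℝ}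
    {t : ℝ} (hc : ∀ i j, HasDerivAt (fun s => c s i j) (c' i j) t) (u : Fin n → ℝ) :
    HasDerivAt (fun s => (c s).mulVec u) (c'.mulVec u) t := by
  rw [hasDerivAt_pi]
  intro i
  simp only [Matrix.mulVec, dotProduct]
  exact HasDerivAt.fun_sum fun j _ => (hc i j).mul_const _

theorem hasDerivAt_line (x u : Fin n → ℝ) : HasDerivAt (fun t : ℝ => x + t • u) u 0 := by
  simpa using ((hasDerivAt_id (0 : ℝ)).smul_const u).const_add x

theorem grad_dotProduct_mulVec_of_isotropy {K : Set (Matrix (Fin n) (Fin n) ℝ)}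
    {q : MvPolynomial (Fin n) ℝ} (hq : Invariant ℝ n K q) {x : Fin n → ℝ}
    {g : Matrix (Fin n) (Fin n) ℝ} (hg : g ∈ isotropy ℝ n K x) (u : Fin n → ℝ) :
    grad q x ⬝ᵥ g.mulVec u = grad q x ⬝ᵥ u := by
  have h1 := hasDerivAt_eval_comp (hasDerivAt_line x u) q
  have h2 := hasDerivAt_eval_comp (hasDerivAt_line x (g.mulVec u)) q
  have h3 : (fun t : ℝ => eval (x + t • g.mulVec u) q) = fun t : ℝ => eval (x + t • u) q := by
    funext t
    rw [← hq g hg.1 (x + t • u), Matrix.mulVec_add, Matrix.mulVec_smul, hg.2]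
  rw [h3] at h2
  simpa using h2.unique h1

theorem grad_mul (p q : MvPolynomial (Fin n) ℝ) (x : Fin n → ℝ) :
    grad (p * q) x = eval x p • grad q x + eval x q • grad p x := by
  ext i
  simp [grad, Derivation.leibniz]

theorem grad_add (p q : MvPolynomial (Fin n) ℝ) (x : Fin n → ℝ) :
    grad (p + q) x = grad p x + grad q x := by
  ext i
  simp [grad]

/-- If every generator of an ideal vanishes at `x` together with its derivative along `u`, then
so does every element of the ideal. -/
theorem grad_dotProduct_eq_zero_of_mem_span {S : Set (MvPolynomial (Fin n) ℝ)}
    {x u : Fin n → ℝ} (h0 : ∀ q ∈ S, eval x q = 0) (h1 : ∀ q ∈ S, grad q x ⬝ᵥ u = 0)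
    {q : MvPolynomial (Fin n) ℝ} (hq : q ∈ Ideal.span S) :
    eval x q = 0 ∧ grad q x ⬝ᵥ u = 0 := by
  induction hq using Submodule.span_induction with
  | mem q hq => exact ⟨h0 q hq, h1 q hq⟩
  | zero => simp [grad, dotProduct]
  | add p q _ _ hp hq => simp [grad_add, add_dotProduct, hp, hq]
  | smul a q _ hq => simp [grad_mul, smul_dotProduct, hq]

end Gradient

section Average

variable {n : ℕ}

/-- A compact matrix group carries a positive right-invariant functional on its continuous
functions. -/
theorem exists_invariant_mean {K : Set (Matrix (Fin n) (Fin n) ℝ)} (hK : IsMatSubgroup ℝ n K)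
    (hc : IsCompact K) :
    ∃ E : C(K, ℝ) →ₗ[ℝ] ℝ, E 1 = 1 ∧ (∀ f : C(K, ℝ), (∀ k, 0 ≤ f k) → 0 ≤ E f) ∧
      (∀ f : C(K, ℝ), (∀ k, 0 < f k) → 0 < E f) ∧
      ∀ f f' : C(K, ℝ), ∀ h : K,
        (∀ k k' : K, (k' : Matrix (Fin n) (Fin n) ℝ) = k.1 * h.1 → f' k = f k') →
        E f' = E f := by
  have hdet : ∀ k : K, IsUnit (k : Matrix (Fin n) (Fin n) ℝ).det := fun k =>
    (Matrix.isUnit_iff_isUnit_det _).1 (hK.2.2 k k.2).1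
  let _ : Group K :=
    { mul := fun a b => ⟨a.1 * b.1, hK.2.1 _ a.2 _ b.2⟩
      one := ⟨1, hK.1⟩
      inv := fun a => ⟨a.1⁻¹, (hK.2.2 _ a.2).2⟩
      mul_assoc := fun a b c => Subtype.ext (mul_assoc a.1 b.1 c.1)
      one_mul := fun a => Subtype.ext (one_mul a.1)
      mul_one := fun a => Subtype.ext (mul_one a.1)
      inv_mul_cancel := fun a => Subtype.ext (Matrix.nonsing_inv_mul a.1 (hdet a)) }
  have : IsTopologicalGroup K :=
    { continuous_mul := by
        refine Continuous.subtype_mk ?_ _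
        exact (continuous_subtype_val.comp continuous_fst).matrix_mul
          (continuous_subtype_val.comp continuous_snd)
      continuous_inv := by
        refine Continuous.subtype_mk ?_ _
        simp only [Matrix.inv_def, Ring.inverse_eq_inv']
        exact (continuous_subtype_val.matrix_det.inv₀ fun k => (hdet k).ne_zero).smul
          continuous_subtype_val.matrix_adjugate }
  have : CompactSpace K := isCompact_iff_compactSpace.1 hc
  let _ : MeasurableSpace K := borel K
  have : BorelSpace K := ⟨rfl⟩
  let μ : MeasureTheory.Measure K := MeasureTheory.Measure.haarMeasure ⊤
  have : MeasureTheory.IsProbabilityMeasure μ :=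
    ⟨MeasureTheory.Measure.haarMeasure_self (K₀ := (⊤ : TopologicalSpace.PositiveCompacts K))⟩
  have hintegrable : ∀ f : C(K, ℝ), MeasureTheory.Integrable (fun k => f k⁻¹) μ := fun f =>
    (f.continuous.comp continuous_inv).integrable_of_hasCompactSupport
      (HasCompactSupport.of_compactSpace _)
  refine ⟨⟨⟨fun f => ∫ k, f k⁻¹ ∂μ, ?_⟩, ?_⟩, ?_, ?_, ?_, ?_⟩
  · intro f g
    exact MeasureTheory.integral_add (hintegrable f) (hintegrable g)
  · intro r f
    exact MeasureTheory.integral_const_mul r _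
  · simp
  · intro f hf
    exact MeasureTheory.integral_nonneg fun k => hf _
  · intro f hf
    exact (f.continuous.comp continuous_inv).integral_pos_of_hasCompactSupport_nonneg_nonzero
      (HasCompactSupport.of_compactSpace _) (fun k => (hf _).le) (x := 1) (hf _).ne'
  · intro f f' h hff
    have h1 : ∀ k : K, f' k⁻¹ = f (h⁻¹ * k)⁻¹ := fun k => hff _ _ (by
      rw [mul_inv_rev, inv_inv]
      rfl)
    simp only [LinearMap.coe_mk, AddHom.coe_mk, h1]
    exact MeasureTheory.integral_mul_left_eq_self (fun k => f k⁻¹) h⁻¹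

/-- Averaging a polynomial over a compact group against a continuous weight gives a polynomial. -/
theorem exists_average {K : Set (Matrix (Fin n) (Fin n) ℝ)} (E : C(K, ℝ) →ₗ[ℝ] ℝ)
    (p : MvPolynomial (Fin n) ℝ) (φ : C(K, ℝ)) :
    ∃ q : MvPolynomial (Fin n) ℝ, ∀ v : Fin n → ℝ, ∀ f : C(K, ℝ),
      (∀ k : K, f k = φ k * eval (k.1.mulVec v) p) → eval v q = E f := by
  induction p using MvPolynomial.induction_on generalizing φ with
  | C a =>
    refine ⟨C (a * E φ), fun v f hf => ?_⟩
    have : f = a • φ := by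
      ext k
      simp [hf, mul_comm]
    simp [this]
  | add p p' hp hp' =>
    obtain ⟨q, hq⟩ := hp φ
    obtain ⟨q', hq'⟩ := hp' φ
    refine ⟨q + q', fun v f hf => ?_⟩
    have hcont : ∀ r : MvPolynomial (Fin n) ℝ,
        Continuous fun k : K => φ k * eval (k.1.mulVec v) r := fun r =>
      φ.continuous.mul (r.continuous_eval.comp
        (continuous_subtype_val.matrix_mulVec continuous_const))
    have : f = ⟨_, hcont p⟩ + ⟨_, hcont p'⟩ := by
      ext k
      simp [hf, mul_add]
    rw [map_add, hq v ⟨_, hcont p⟩ fun _ => rfl, hq' v ⟨_, hcont p'⟩ fun _ => rfl, this, map_add]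
  | mul_X p i hp =>
    have hent : ∀ j, Continuous fun k : K => φ k * k.1 i j := fun j =>
      φ.continuous.mul (continuous_subtype_val.matrix_elem i j)
    choose q hq using fun j => hp ⟨_, hent j⟩
    refine ⟨∑ j, X j * q j, fun v f hf => ?_⟩
    have hcont : ∀ j, Continuous fun k : K => φ k * k.1 i j * eval (k.1.mulVec v) p := fun j =>
      (hent j).mul (p.continuous_eval.comp
        (continuous_subtype_val.matrix_mulVec continuous_const))
    have : f = ∑ j, v j • (⟨_, hcont j⟩ : C(K, ℝ)) := by
      ext k
      rw [hf, ContinuousMap.sum_apply]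
      simp only [map_mul, eval_X, Matrix.mulVec, dotProduct, Finset.mul_sum,
        ContinuousMap.smul_apply, ContinuousMap.coe_mk, smul_eq_mul]
      exact Finset.sum_congr rfl fun j _ => by ring
    rw [this, map_sum, map_sum]
    refine Finset.sum_congr rfl fun j _ => ?_
    rw [map_mul, eval_X, map_smul, smul_eq_mul, hq j v ⟨_, hcont j⟩ fun _ => rfl]

/-- Invariant polynomials separate the orbits of a compact group. -/
theorem mem_orbit_of_invariants_eq {K : Set (Matrix (Fin n) (Fin n) ℝ)}
    (hK : IsMatSubgroup ℝ n K) (hc : IsCompact K) {v w : Fin n → ℝ}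
    (h : ∀ q, Invariant ℝ n K q → eval w q = eval v q) : w ∈ orbit ℝ n K v := by
  by_contra hw
  obtain ⟨E, hE1, hE0, -, hEinv⟩ := exists_invariant_mean hK hc
  have hcomp : ∀ u : Fin n → ℝ, IsCompact (orbit ℝ n K u) := fun u =>
    hc.image (continuous_id.matrix_mulVec continuous_const)
  have hdisj : Disjoint (orbit ℝ n K v) (orbit ℝ n K w) := by
    rw [Set.disjoint_left]
    rintro _ ⟨g, hg, rfl⟩ ⟨k, hk, hgk⟩
    refine hw ⟨k⁻¹ * g, hK.2.1 _ (hK.2.2 k hk).2 _ hg, ?_⟩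
    have hdet := (Matrix.isUnit_iff_isUnit_det _).1 (hK.2.2 k hk).1
    change (k⁻¹ * g).mulVec v = w
    change k.mulVec w = g.mulVec v at hgk
    rw [← Matrix.mulVec_mulVec, ← hgk, Matrix.mulVec_mulVec, Matrix.nonsing_inv_mul _ hdet,
      Matrix.one_mulVec]
  obtain ⟨f, hf0, hf1, -⟩ := exists_continuous_zero_one_of_isClosed (hcomp v).isClosed
    (hcomp w).isClosed hdisj
  let ev : MvPolynomial (Fin n) ℝ →ₐ[ℝ] C(Fin n → ℝ, ℝ) :=
    MvPolynomial.aeval fun i => ⟨fun u => u i, continuous_apply i⟩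
  have hev : ∀ p u, ev p u = eval u p := by
    intro p u
    induction p using MvPolynomial.induction_on with
    | C a => simp [ev]
    | add p q hp hq => simp [hp, hq]
    | mul_X p i hp =>
      rw [map_mul, map_mul, ContinuousMap.mul_apply, hp]
      simp [ev]
  have hsep : ev.range.SeparatesPoints := by
    intro a b hab
    obtain ⟨i, hi⟩ := Function.ne_iff.1 hab
    exact ⟨_, ⟨ev (X i), ⟨X i, rfl⟩, rfl⟩, by simpa [hev] using hi⟩
  obtain ⟨_, ⟨p, rfl⟩, hp⟩ :=
    ContinuousMap.exists_mem_subalgebra_near_continuous_of_isCompact_of_separatesPoints hsep f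
      ((hcomp v).union (hcomp w)) (ε := 1 / 3) (by norm_num)
  obtain ⟨q, hq⟩ := exists_average E p 1
  have hcont : ∀ u, Continuous fun k : K => eval (k.1.mulVec u) p := fun u =>
    p.continuous_eval.comp (continuous_subtype_val.matrix_mulVec continuous_const)
  have hqE : ∀ u, eval u q = E ⟨_, hcont u⟩ := fun u => hq u _ (by simp)
  have hqinv : Invariant ℝ n K q := by
    intro g hg u
    rw [hqE, hqE]
    refine hEinv _ _ ⟨g, hg⟩ fun k k' hk => ?_
    simp [hk]
  have hmono : ∀ f f' : C(K, ℝ), (∀ k, f k ≤ f' k) → E f ≤ E f' := by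
    intro f f' hff
    have := hE0 (f' - f) fun k => by simpa using hff k
    rw [map_sub] at this
    linarith
  have hconst : ∀ c : ℝ, E (c • 1) = c := fun c => by rw [map_smul, hE1]; simp
  have h1 : eval v q ≤ 1 / 3 := by
    rw [hqE, ← hconst (1 / 3)]
    refine hmono _ _ fun k => ?_
    have hk : k.1.mulVec v ∈ orbit ℝ n K v := ⟨k.1, k.2, rfl⟩
    have := hp _ (Or.inl hk)
    rw [AlgHom.toRingHom_eq_coe, AlgHom.coe_toRingHom, hev, hf0 hk, Real.norm_eq_abs] at this
    simpa using (abs_lt.1 this).2.le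
  have h2 : 2 / 3 ≤ eval w q := by
    rw [hqE, ← hconst (2 / 3)]
    refine hmono _ _ fun k => ?_
    have hk : k.1.mulVec w ∈ orbit ℝ n K w := ⟨k.1, k.2, rfl⟩
    have := hp _ (Or.inr hk)
    rw [AlgHom.toRingHom_eq_coe, AlgHom.coe_toRingHom, hev, hf1 hk, Real.norm_eq_abs] at this
    have := (abs_lt.1 this).1
    simp at this ⊢
    linarith
  linarith [h q hqinv]

theorem hasClosedOrbit_of_isCompact {K : Set (Matrix (Fin n) (Fin n) ℝ)}
    (hK : IsMatSubgroup ℝ n K) (hc : IsCompact K) (v : Fin n → ℝ) : HasClosedOrbit ℝ n K v := by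
  intro w hw
  refine mem_orbit_of_invariants_eq hK hc fun q hq => ?_
  have := hw (q - C (eval v q)) (by
    rintro _ ⟨g, hg, rfl⟩
    simp [hq g hg v])
  simpa [sub_eq_zero] using this

/-- A compact matrix group preserves a positive definite symmetric form. -/
theorem exists_invariant_form {K : Set (Matrix (Fin n) (Fin n) ℝ)}
    (hK : IsMatSubgroup ℝ n K) (hc : IsCompact K) :
    ∃ S : Matrix (Fin n) (Fin n) ℝ, (∀ u v, u ⬝ᵥ S.mulVec v = v ⬝ᵥ S.mulVec u) ∧
      (∀ u, u ⬝ᵥ S.mulVec u = 0 → u = 0) ∧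
      ∀ g ∈ K, ∀ u v, g.mulVec u ⬝ᵥ S.mulVec (g.mulVec v) = u ⬝ᵥ S.mulVec v := by
  obtain ⟨E, -, -, hEpos, hEinv⟩ := exists_invariant_mean hK hc
  have hcont : ∀ u v : Fin n → ℝ, Continuous fun k : K => k.1.mulVec u ⬝ᵥ k.1.mulVec v :=
    fun u v => (continuous_subtype_val.matrix_mulVec continuous_const).dotProduct
      (continuous_subtype_val.matrix_mulVec continuous_const)
  let B : (Fin n → ℝ) → (Fin n → ℝ) → ℝ := fun u v => E ⟨_, hcont u v⟩
  let S : Matrix (Fin n) (Fin n) ℝ := fun i j => B (Pi.single i 1) (Pi.single j 1)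
  have hS : ∀ u v, u ⬝ᵥ S.mulVec v = B u v := by
    intro u v
    have : (⟨_, hcont u v⟩ : C(K, ℝ)) = ∑ i, ∑ j, (u i * v j) •
        (⟨_, hcont (Pi.single i 1) (Pi.single j 1)⟩ : C(K, ℝ)) := by
      ext k
      have hu : ∀ u : Fin n → ℝ, u = ∑ i, u i • (Pi.single i 1 : Fin n → ℝ) := by
        intro u
        ext j
        simp [Finset.sum_apply, Pi.single_apply]
      conv_lhs => rw [hu u, hu v]
      simp only [Matrix.mulVec_sum, Matrix.mulVec_smul, sum_dotProduct, dotProduct_sum,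
        smul_dotProduct, dotProduct_smul, ContinuousMap.sum_apply, ContinuousMap.smul_apply,
        ContinuousMap.coe_mk, smul_eq_mul, Finset.mul_sum]
      rw [Finset.sum_comm]
      exact Finset.sum_congr rfl fun i _ => Finset.sum_congr rfl fun j _ => by ring
    simp only [B]
    rw [this]
    simp only [map_sum, map_smul, dotProduct, Matrix.mulVec, Finset.mul_sum, S, B, smul_eq_mul]
    exact Finset.sum_congr rfl fun i _ => Finset.sum_congr rfl fun j _ => by ring
  refine ⟨S, fun u v => ?_, fun u hu => ?_, fun g hg u v => ?_⟩
  · rw [hS, hS]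
    exact congrArg E (ContinuousMap.ext fun k => dotProduct_comm (k.1.mulVec u) (k.1.mulVec v))
  · by_contra hne
    rw [hS] at hu
    refine (hEpos ⟨_, hcont u u⟩ fun k => ?_).ne' hu
    change 0 < k.1.mulVec u ⬝ᵥ k.1.mulVec u
    refine lt_of_le_of_ne (Finset.sum_nonneg fun i _ => mul_self_nonneg _) fun h0 => hne ?_
    have h1 : k.1.mulVec u = 0 := dotProduct_self_eq_zero.1 h0.symm
    have hdet := (Matrix.isUnit_iff_isUnit_det _).1 (hK.2.2 k.1 k.2).1
    rw [← Matrix.one_mulVec u, ← Matrix.nonsing_inv_mul _ hdet, ← Matrix.mulVec_mulVec, h1,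
      Matrix.mulVec_zero]
  · rw [hS, hS]
    refine hEinv _ _ ⟨g, hg⟩ fun k k' hk => ?_
    simp [hk]

end Average

section OneParameter

variable {n : ℕ}

open Filter Topology
open scoped Matrix.Norms.Operator

theorem mexp_eq_exp (A : Matrix (Fin n) (Fin n) ℝ) : mexp ℝ n A = NormedSpace.exp A :=
  (congrFun (NormedSpace.exp_eq_tsum ℝ) A).symm

theorem mexp_zero : mexp ℝ n 0 = 1 := by
  rw [mexp_eq_exp, NormedSpace.exp_zero]

theorem mexp_neg (A : Matrix (Fin n) (Fin n) ℝ) : mexp ℝ n (-A) = (mexp ℝ n A)⁻¹ := by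
  rw [mexp_eq_exp, mexp_eq_exp, Matrix.exp_neg]

theorem hasDerivAt_mexp (A : Matrix (Fin n) (Fin n) ℝ) (i j : Fin n) :
    HasDerivAt (fun t : ℝ => mexp ℝ n (t • A) i j) (A i j) 0 := by
  have h := hasDerivAt_exp_smul_const (𝕂 := ℝ) A 0
  simp only [zero_smul, NormedSpace.exp_zero, one_mul] at h
  simp only [mexp_eq_exp]
  exact (Matrix.entryLinearMap ℝ ℝ i j).toContinuousLinearMap.hasFDerivAt.comp_hasDerivAt 0 h

theorem mem_lieAlgebra_of_tendsto {L : Set (Matrix (Fin n) (Fin n) ℝ)}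
    (hL : IsMatSubgroup ℝ n L) (hc : IsClosed L) {a : ℕ → Matrix (Fin n) (Fin n) ℝ}
    (ha : ∀ j, a j ∈ L) (ha1 : Tendsto a atTop (𝓝 1)) {r : ℕ → ℝ} (hr : ∀ j, 0 < r j)
    (hr0 : Tendsto r atTop (𝓝 0)) {A : Matrix (Fin n) (Fin n) ℝ}
    (hA : Tendsto (fun j => (r j)⁻¹ • (a j - 1)) atTop (𝓝 A)) : A ∈ lieAlgebra ℝ n L := by
  have hnonneg : ∀ t : ℝ, 0 ≤ t → mexp ℝ n (t • A) ∈ L := by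
    intro t ht
    have hexp : HasStrictFDerivAt (NormedSpace.exp : Matrix (Fin n) (Fin n) ℝ → _)
        ((ContinuousLinearEquiv.refl ℝ (Matrix (Fin n) (Fin n) ℝ) : _ →L[ℝ] _)) 0 :=
      hasStrictFDerivAt_exp_zero
    have hlog := hexp.to_localInverse
    have hright := hexp.eventually_right_inverse
    have hleft := hexp.localInverse_apply_image
    rw [NormedSpace.exp_zero] at hlog hright hleft
    set ψ := hexp.localInverse _ _ _
    have hsub : Tendsto (fun j => a j - 1) atTop (𝓝 0) := by
      simpa using ha1.sub_const 1
    have hY : Tendsto (fun j => (r j)⁻¹ • ψ (a j)) atTop (𝓝 A) := by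
      have : Tendsto (fun j => (r j)⁻¹ • (ψ (1 + (a j - 1)) - ψ 1)) atTop (𝓝 A) :=
        hlog.hasFDerivAt.hasFDerivWithinAt.lim (s := Set.univ) hsub (by simp) hA
      rw [hleft] at this
      simpa only [add_sub_cancel, sub_zero] using this
    have hm : Tendsto (fun j => (⌊t * (r j)⁻¹⌋₊ : ℝ) * r j) atTop (𝓝 t) := by
      have h1 : Tendsto (fun j => (r j)⁻¹) atTop atTop :=
        (tendsto_nhdsWithin_iff.2 ⟨hr0, .of_forall hr⟩).inv_tendsto_nhdsGT_zero
      simpa [Function.comp_def] using (tendsto_nat_floor_mul_div_atTop ht).comp h1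
    have hlim : Tendsto (fun j => NormedSpace.exp (⌊t * (r j)⁻¹⌋₊ • ψ (a j))) atTop
        (𝓝 (NormedSpace.exp (t • A))) := by
      refine ((NormedSpace.exp_continuous (𝔸 := Matrix (Fin n) (Fin n) ℝ)).tendsto _).comp ?_
      refine (hm.smul hY).congr fun j => ?_
      rw [smul_smul, mul_assoc, mul_inv_cancel₀ (hr j).ne', mul_one, Nat.cast_smul_eq_nsmul]
    rw [mexp_eq_exp]
    refine hc.mem_of_tendsto hlim ?_
    filter_upwards [ha1.eventually hright] with j hj
    rw [Matrix.exp_nsmul, hj]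
    generalize ⌊t * (r j)⁻¹⌋₊ = m
    induction m with
    | zero => simpa using hL.1
    | succ m ih => rw [pow_succ]; exact hL.2.1 _ ih _ (ha j)
  intro t
  rcases le_total 0 t with ht | ht
  · exact hnonneg t ht
  · have := hnonneg (-t) (by linarith)
    rw [neg_smul, mexp_neg] at this
    have h2 := (hL.2.2 _ this).2
    rwa [← mexp_neg, ← mexp_neg, neg_neg] at h2

theorem mexp_mulVec_of_mulVec_eq_zero {A : Matrix (Fin n) (Fin n) ℝ} {u : Fin n → ℝ}
    (h : A.mulVec u = 0) : (mexp ℝ n A).mulVec u = u := by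
  have hsum : HasSum (fun k : ℕ => ((k.factorial : ℝ)⁻¹) • A ^ k) (mexp ℝ n A) :=
    (NormedSpace.expSeries_summable' (𝕂 := ℝ) A).hasSum
  have hcont : Continuous fun M : Matrix (Fin n) (Fin n) ℝ => M.mulVec u :=
    continuous_id.matrix_mulVec continuous_const
  let φ : Matrix (Fin n) (Fin n) ℝ →+ (Fin n → ℝ) :=
    { toFun := fun M => M.mulVec u
      map_zero' := Matrix.zero_mulVec u
      map_add' := fun M N => Matrix.add_mulVec M N u }
  have h1 := hsum.map φ hcont
  have h2 := hasSum_single (f := φ ∘ fun k => ((k.factorial : ℝ)⁻¹) • A ^ k) 0 (by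
    intro k hk
    obtain ⟨m, rfl⟩ := Nat.exists_eq_succ_of_ne_zero hk
    simp [φ, pow_succ, ← Matrix.mulVec_mulVec, Matrix.smul_mulVec, h])
  refine (h1.unique h2).trans ?_
  simp [φ]

theorem conj_mem_lieAlgebra {L : Set (Matrix (Fin n) (Fin n) ℝ)} (hL : IsMatSubgroup ℝ n L)
    {g A : Matrix (Fin n) (Fin n) ℝ} (hg : g ∈ L) (hA : A ∈ lieAlgebra ℝ n L) :
    g * A * g⁻¹ ∈ lieAlgebra ℝ n L := by
  intro t
  have := hL.2.1 _ (hL.2.1 _ hg _ (hA t)) _ (hL.2.2 g hg).2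
  rw [mexp_eq_exp, ← Matrix.exp_conj _ _ (hL.2.2 g hg).1, ← mexp_eq_exp] at this
  simpa using this

theorem isMatSubgroup_isotropy {L : Set (Matrix (Fin n) (Fin n) ℝ)} (hL : IsMatSubgroup ℝ n L)
    (x : Fin n → ℝ) : IsMatSubgroup ℝ n (isotropy ℝ n L x) := by
  refine ⟨⟨hL.1, Matrix.one_mulVec x⟩, fun a ha b hb => ⟨hL.2.1 a ha.1 b hb.1, ?_⟩,
    fun a ha => ⟨(hL.2.2 a ha.1).1, (hL.2.2 a ha.1).2, ?_⟩⟩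
  · rw [← Matrix.mulVec_mulVec, hb.2, ha.2]
  · have hdet := (Matrix.isUnit_iff_isUnit_det _).1 (hL.2.2 a ha.1).1
    nth_rewrite 1 [← ha.2]
    rw [Matrix.mulVec_mulVec, Matrix.nonsing_inv_mul _ hdet, Matrix.one_mulVec]

theorem isCompact_isotropy {L : Set (Matrix (Fin n) (Fin n) ℝ)} (hc : IsCompact L)
    (x : Fin n → ℝ) : IsCompact (isotropy ℝ n L x) :=
  hc.inter_right (isClosed_eq (continuous_id.matrix_mulVec continuous_const) continuous_const)

/-- The sum of the squares of the entries. -/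
def sqNorm (A : Matrix (Fin n) (Fin n) ℝ) : ℝ := ∑ i, ∑ j, A i j ^ 2

theorem continuous_sqNorm : Continuous (sqNorm (n := n)) :=
  continuous_finsetSum _ fun i _ => continuous_finsetSum _ fun j _ =>
    (continuous_id.matrix_elem i j).pow 2

theorem tendsto_of_sqNorm_sub {a : ℕ → Matrix (Fin n) (Fin n) ℝ} {b : Matrix (Fin n) (Fin n) ℝ}
    (h : Tendsto (fun k => sqNorm (a k - b)) atTop (𝓝 0)) : Tendsto a atTop (𝓝 b) := by
  refine tendsto_pi_nhds.2 fun i => tendsto_pi_nhds.2 fun j => ?_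
  have h1 : Tendsto (fun k => (a k i j - b i j) ^ 2) atTop (𝓝 0) := by
    refine squeeze_zero (fun k => sq_nonneg _) (fun k => ?_) h
    refine le_trans ?_ (Finset.single_le_sum (f := fun i => ∑ j, (a k - b) i j ^ 2)
      (fun i _ => Finset.sum_nonneg fun j _ => sq_nonneg _) (Finset.mem_univ i))
    exact Finset.single_le_sum (f := fun j => (a k - b) i j ^ 2) (fun j _ => sq_nonneg _)
      (Finset.mem_univ j)
  have h2 : Tendsto (fun k => |a k i j - b i j|) atTop (𝓝 0) := by
    simpa [Real.sqrt_sq_eq_abs] using h1.sqrt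
  simpa using ((tendsto_zero_iff_abs_tendsto_zero _).2 h2).add_const (b i j)

/-- A sequence in a matrix group `L` that converges to `1` and avoids a compact subgroup `M` can
be corrected by elements of `M` so that it converges to `1` along a direction in the Lie algebra
of `L` that is not in the Lie algebra of `M`. -/
theorem exists_transverse_direction {L M : Set (Matrix (Fin n) (Fin n) ℝ)}
    (hL : IsMatSubgroup ℝ n L) (hLc : IsClosed L) (hM : IsMatSubgroup ℝ n M) (hMc : IsCompact M)
    (hML : M ⊆ L) {g : ℕ → Matrix (Fin n) (Fin n) ℝ} (hg : ∀ j, g j ∈ L) (hgM : ∀ j, g j ∉ M)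
    (hg1 : Tendsto g atTop (𝓝 1)) :
    ∃ A ∈ lieAlgebra ℝ n L, A ∉ lieAlgebra ℝ n M ∧
      ∃ φ : ℕ → ℕ, StrictMono φ ∧ ∃ m : ℕ → Matrix (Fin n) (Fin n) ℝ, (∀ j, m j ∈ M) ∧
        ∃ r : ℕ → ℝ, (∀ j, 0 < r j) ∧
          Tendsto (fun j => (r j)⁻¹ • (g (φ j) * m j - 1)) atTop (𝓝 A) := by
  have hmin : ∀ j, ∃ m ∈ M, ∀ m' ∈ M, sqNorm (g j * m - 1) ≤ sqNorm (g j * m' - 1) := by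
    intro j
    have hcont : Continuous fun m => sqNorm (g j * m - 1) :=
      continuous_sqNorm.comp ((continuous_const.matrix_mul continuous_id).sub continuous_const)
    obtain ⟨m, hm, hm'⟩ := hMc.exists_isMinOn ⟨1, hM.1⟩ hcont.continuousOn
    exact ⟨m, hm, fun m' h' => hm' h'⟩
  choose m hm hmin using hmin
  have haL : ∀ j, g j * m j ∈ L := fun j => hL.2.1 _ (hg j) _ (hML (hm j))
  have ha1 : Tendsto (fun j => g j * m j) atTop (𝓝 1) := by
    refine tendsto_of_sqNorm_sub (squeeze_zero (g := fun j => sqNorm (g j - 1))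
      (fun k => Finset.sum_nonneg fun i _ => Finset.sum_nonneg fun j _ => sq_nonneg _)
      (fun k => by simpa using hmin k 1 hM.1) ?_)
    have := (continuous_sqNorm.tendsto _).comp (hg1.sub_const 1)
    simpa [sqNorm, Function.comp_def] using this
  have hne : ∀ j, g j * m j - 1 ≠ 0 := by
    intro j h
    refine hgM j ?_
    have h1 := hM.2.2 _ (hm j)
    rw [← Matrix.inv_eq_left_inv (sub_eq_zero.1 h)]
    exact h1.2
  have hsphere : ∀ j, ‖g j * m j - 1‖⁻¹ • (g j * m j - 1) ∈
      Metric.sphere (0 : Matrix (Fin n) (Fin n) ℝ) 1 := by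
    intro j
    rw [mem_sphere_zero_iff_norm, norm_smul, norm_inv, norm_norm,
      inv_mul_cancel₀ (norm_ne_zero_iff.2 (hne j))]
  have : ProperSpace (Matrix (Fin n) (Fin n) ℝ) := FiniteDimensional.proper ℝ _
  obtain ⟨A, hA, φ, hφ, hlim⟩ := (isCompact_sphere _ _).tendsto_subseq hsphere
  have hsub : Tendsto (fun j => g (φ j) * m (φ j)) atTop (𝓝 1) := ha1.comp hφ.tendsto_atTop
  have hr0 : Tendsto (fun j => ‖g (φ j) * m (φ j) - 1‖) atTop (𝓝 0) := by
    simpa using (hsub.sub_const 1).norm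
  have hpos : ∀ j, 0 < ‖g (φ j) * m (φ j) - 1‖ := fun j => norm_pos_iff.2 (hne _)
  refine ⟨A, mem_lieAlgebra_of_tendsto hL hLc (fun j => haL (φ j)) hsub hpos hr0 hlim, ?_,
    φ, hφ, fun j => m (φ j), fun j => hm _, _, hpos, hlim⟩
  intro hAM
  have horth : ∀ j, ∑ i, ∑ k, (g j * m j - 1) i k * (g j * m j * A) i k = 0 := by
    intro j
    have hd : HasDerivAt (fun t : ℝ => sqNorm (g j * m j * mexp ℝ n (t • A) - 1))
        (∑ i, ∑ k, 2 * ((g j * m j - 1) i k * (g j * m j * A) i k)) 0 := by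
      refine HasDerivAt.fun_sum fun i _ => HasDerivAt.fun_sum fun k _ => ?_
      have h1 : HasDerivAt (fun t : ℝ => (g j * m j * mexp ℝ n (t • A) - 1) i k)
          ((g j * m j * A) i k) 0 := by
        have h0 : HasDerivAt (fun t : ℝ => ∑ l, (g j * m j) i l * mexp ℝ n (t • A) l k -
            (1 : Matrix (Fin n) (Fin n) ℝ) i k) (∑ l, (g j * m j) i l * A l k) 0 :=
          (HasDerivAt.fun_sum fun l _ => (hasDerivAt_mexp A l k).const_mul _).sub_const _
        simpa only [Matrix.sub_apply, Matrix.mul_apply (M := g j * m j)] using h0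
      refine (h1.fun_pow 2).congr_deriv ?_
      simp [mexp_zero, mul_assoc]
    have hloc : IsLocalMin (fun t : ℝ => sqNorm (g j * m j * mexp ℝ n (t • A) - 1)) 0 := by
      refine .of_forall fun t => ?_
      have := hmin j (m j * mexp ℝ n (t • A)) (hM.2.1 _ (hm j) _ (hAM t))
      simpa [mexp_zero, mul_assoc] using this
    have := hloc.hasDerivAt_eq_zero hd
    simp only [← Finset.mul_sum] at this
    linarith
  have hlim0 : Tendsto (fun j => ∑ i, ∑ k,
      (‖g (φ j) * m (φ j) - 1‖⁻¹ • (g (φ j) * m (φ j) - 1)) i k * (g (φ j) * m (φ j) * A) i k)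
      atTop (𝓝 (∑ i, ∑ k, A i k * ((1 : Matrix (Fin n) (Fin n) ℝ) * A) i k)) := by
    refine tendsto_finsetSum _ fun i _ => tendsto_finsetSum _ fun k _ => ?_
    have hent : ∀ i k, Continuous fun B : Matrix (Fin n) (Fin n) ℝ => B i k := fun i k =>
      continuous_id.matrix_elem i k
    exact (((hent i k).tendsto A).comp hlim).mul
      (((hent i k).tendsto _).comp (hsub.mul_const A))
  have hzero : ∑ i, ∑ k, A i k * ((1 : Matrix (Fin n) (Fin n) ℝ) * A) i k = 0 := by
    refine tendsto_nhds_unique hlim0 (tendsto_const_nhds.congr fun j => ?_)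
    have := horth (φ j)
    simp only [Matrix.smul_apply, smul_eq_mul, mul_assoc, ← Finset.mul_sum] at this ⊢
    rw [this, mul_zero]
  have hA0 : A = 0 := by
    rw [one_mul] at hzero
    have h1 := fun i => (Finset.sum_eq_zero_iff_of_nonneg fun i _ =>
      Finset.sum_nonneg fun k _ => mul_self_nonneg (A i k)).1 hzero i (Finset.mem_univ i)
    have h2 := fun i k => (Finset.sum_eq_zero_iff_of_nonneg fun k _ =>
      mul_self_nonneg (A i k)).1 (h1 i) k (Finset.mem_univ k)
    exact Matrix.ext fun i k => mul_self_eq_zero.1 (h2 i k)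
  rw [hA0] at hA
  simp at hA

end OneParameter

section Tangent

variable {n : ℕ}

open Filter Topology
open scoped Matrix.Norms.Operator

theorem mem_lieAlgebra_isotropy {K : Set (Matrix (Fin n) (Fin n) ℝ)} {A : Matrix (Fin n) (Fin n) ℝ}
    (hA : A ∈ lieAlgebra ℝ n K) {x : Fin n → ℝ} (hx : A.mulVec x = 0) :
    A ∈ lieAlgebra ℝ n (isotropy ℝ n K x) := fun t =>
  ⟨hA t, mexp_mulVec_of_mulVec_eq_zero (by rw [Matrix.smul_mulVec, hx, smul_zero])⟩

/-- If a sequence of nonzero vectors, rescaled in two ways, converges to two nonzero limits, the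
limits are proportional. -/
theorem exists_smul_eq_of_tendsto {E : Type*} [NormedAddCommGroup E] [NormedSpace ℝ E]
    {z : ℕ → E} {r t : ℕ → ℝ} (hr : ∀ j, 0 < r j) (ht : ∀ j, 0 < t j) {u v : E} (hu : u ≠ 0)
    (h1 : Tendsto (fun j => (r j)⁻¹ • z j) atTop (𝓝 u))
    (h2 : Tendsto (fun j => (t j)⁻¹ • z j) atTop (𝓝 v)) : ∃ c : ℝ, v = c • u := by
  refine ⟨‖v‖ * ‖u‖⁻¹, ?_⟩
  have h3 : Tendsto (fun j => ‖(t j)⁻¹ • z j‖ * ‖(r j)⁻¹ • z j‖⁻¹) atTop (𝓝 (‖v‖ * ‖u‖⁻¹)) :=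
    h2.norm.mul (h1.norm.inv₀ (norm_ne_zero_iff.2 hu))
  refine tendsto_nhds_unique h2 ((h3.smul h1).congr' ?_)
  filter_upwards [h1.eventually_ne hu] with j hj
  have hz : ‖z j‖ ≠ 0 := by
    intro h
    rw [norm_eq_zero.1 h, smul_zero] at hj
    exact hj rfl
  have := (hr j).ne'
  rw [smul_smul, norm_smul, norm_smul, norm_inv, norm_inv, Real.norm_of_nonneg (hr j).le,
    Real.norm_of_nonneg (ht j).le]
  congr 1
  field_simp

/-- Limits of secant directions of the orbit of `x` at `x` lie in the tangent space. -/
theorem mem_orbitTangent_of_tendsto {K : Set (Matrix (Fin n) (Fin n) ℝ)}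
    (hK : IsMatSubgroup ℝ n K) (hc : IsCompact K) {x : Fin n → ℝ} {y : ℕ → Fin n → ℝ}
    (hy : ∀ j, y j ∈ orbit ℝ n K x) {t : ℕ → ℝ} (ht : ∀ j, 0 < t j)
    (ht0 : Tendsto t atTop (𝓝 0)) {v : Fin n → ℝ}
    (hv : Tendsto (fun j => (t j)⁻¹ • (y j - x)) atTop (𝓝 v)) : v ∈ orbitTangent ℝ n K x := by
  rcases eq_or_ne v 0 with rfl | hv0
  · exact zero_mem _
  obtain ⟨J, hJ⟩ := eventually_atTop.1 (hv.eventually_ne hv0)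
  have hyx : Tendsto y atTop (𝓝 x) := by
    have := (ht0.smul hv).add_const x
    simp only [zero_smul, zero_add] at this
    refine this.congr fun j => ?_
    rw [smul_smul, mul_inv_cancel₀ (ht j).ne', one_smul, sub_add_cancel]
  choose k hk hky using hy
  have : FirstCountableTopology (Matrix (Fin n) (Fin n) ℝ) :=
    inferInstanceAs (FirstCountableTopology (Fin n → Fin n → ℝ))
  obtain ⟨k₀, hk₀, ψ, hψ, hlim⟩ := hc.tendsto_subseq hk
  have hact : Continuous fun g : Matrix (Fin n) (Fin n) ℝ => g.mulVec x :=
    continuous_id.matrix_mulVec continuous_const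
  have hk₀x : k₀.mulVec x = x := by
    refine tendsto_nhds_unique ((hact.tendsto _).comp hlim) ?_
    refine (hyx.comp hψ.tendsto_atTop).congr fun j => ?_
    simp [← hky]
  have hMs := isMatSubgroup_isotropy hK x
  have hk₀inv := hMs.2.2 k₀ ⟨hk₀, hk₀x⟩
  have hdet := (Matrix.isUnit_iff_isUnit_det _).1 hk₀inv.1
  have hgx : ∀ j, (k (ψ (j + J)) * k₀⁻¹).mulVec x = y (ψ (j + J)) := by
    intro j
    rw [← Matrix.mulVec_mulVec, hk₀inv.2.2]
    exact hky _
  have hg1 : Tendsto (fun j => k (ψ (j + J)) * k₀⁻¹) atTop (𝓝 1) := by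
    rw [← Matrix.mul_nonsing_inv _ hdet]
    exact (hlim.comp (tendsto_add_atTop_nat J)).mul_const _
  obtain ⟨A, hA, hAM, φ, hφ, m, hm, r, hr, hrlim⟩ := exists_transverse_direction hK hc.isClosed
    hMs (isCompact_isotropy hc x) (fun g hg => hg.1)
    (fun j => hK.2.1 _ (hk _) _ hk₀inv.2.1) (fun j hj => by
      have h1 := hgx j
      rw [hj.2] at h1
      refine hJ (ψ (j + J)) (le_trans (Nat.le_add_left _ _) hψ.le_apply) ?_
      rw [← h1, sub_self, smul_zero]) hg1
  have hAx : A.mulVec x ≠ 0 := fun h => hAM (mem_lieAlgebra_isotropy hA h)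
  have h1 : Tendsto (fun j => (r j)⁻¹ • (y (ψ (φ j + J)) - x)) atTop (𝓝 (A.mulVec x)) := by
    refine ((hact.tendsto A).comp hrlim).congr fun j => ?_
    simp only [Function.comp_def]
    rw [Matrix.smul_mulVec, Matrix.sub_mulVec, ← Matrix.mulVec_mulVec, (hm j).2, hgx,
      Matrix.one_mulVec]
  have h2 := hv.comp (hψ.tendsto_atTop.comp ((tendsto_add_atTop_nat J).comp hφ.tendsto_atTop))
  obtain ⟨c, rfl⟩ := exists_smul_eq_of_tendsto hr (fun j => ht _) hAx h1 h2
  exact Submodule.smul_mem _ _ (Submodule.subset_span ⟨A, hA, rfl⟩)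

end Tangent

section Flow

variable {n : ℕ}

open Filter Topology

theorem contDiff_eval (q : MvPolynomial (Fin n) ℝ) :
    ContDiff ℝ 1 fun x : Fin n → ℝ => eval x q := by
  induction q using MvPolynomial.induction_on with
  | C a => simpa using contDiff_const
  | add p q hp hq => simpa using hp.add hq
  | mul_X p i hp => simpa using hp.mul (contDiff_apply ℝ ℝ i)

/-- The value at `y` of the polynomial vector field `V`. -/
def evalField (V : Fin n → MvPolynomial (Fin n) ℝ) (y : Fin n → ℝ) : Fin n → ℝ :=
  fun i => eval y (V i)

theorem eval_sum_mul_pderiv (V : Fin n → MvPolynomial (Fin n) ℝ) (q : MvPolynomial (Fin n) ℝ)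
    (y : Fin n → ℝ) : eval y (∑ i, V i * pderiv i q) = grad q y ⬝ᵥ evalField V y := by
  simp [grad, evalField, dotProduct, mul_comm]

/-- Integral curves of a vector field preserving the vanishing ideal of an algebraic set stay in
this set. -/
theorem mem_of_integralCurve {X : Set (Fin n → ℝ)} (hX : IsAlgebraicSet ℝ n X)
    {V : Fin n → MvPolynomial (Fin n) ℝ}
    (hV : ∀ q ∈ vanishingIdeal ℝ n X, ∀ y ∈ X, grad q y ⬝ᵥ evalField V y = 0)
    {c : ℝ → Fin n → ℝ} {δ : ℝ}
    (hd : ∀ t ∈ Set.Icc 0 δ, HasDerivAt c (evalField V (c t)) t) (h0 : c 0 ∈ X) :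
    ∀ t ∈ Set.Icc 0 δ, c t ∈ X := by
  obtain ⟨s, hs⟩ := (isNoetherianRing_iff_ideal_fg _).1
    (inferInstance : IsNoetherianRing (MvPolynomial (Fin n) ℝ)) (vanishingIdeal ℝ n X)
  have hsI : ∀ f : s, (f : MvPolynomial (Fin n) ℝ) ∈ vanishingIdeal ℝ n X := fun f => by
    rw [← hs]
    exact Ideal.subset_span f.2
  have hcoef : ∀ f : s, ∃ a : s → MvPolynomial (Fin n) ℝ,
      ∑ i, V i * pderiv i (f : MvPolynomial (Fin n) ℝ) =
        ∑ l, a l * (l : MvPolynomial (Fin n) ℝ) := by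
    intro f
    have hmem : ∑ i, V i * pderiv i (f : MvPolynomial (Fin n) ℝ) ∈ vanishingIdeal ℝ n X := by
      intro y hy
      rw [eval_sum_mul_pderiv]
      exact hV _ (hsI f) y hy
    rw [← hs, Ideal.span, ← Subtype.range_coe (s := (s : Set (MvPolynomial (Fin n) ℝ))),
      Submodule.mem_span_range_iff_exists_fun] at hmem
    obtain ⟨a, ha⟩ := hmem
    exact ⟨a, ha.symm⟩
  choose a ha using hcoef
  have hcont : ContinuousOn c (Set.Icc 0 δ) := fun t ht => (hd t ht).continuousAt.continuousWithinAt
  have hF : ∀ t ∈ Set.Icc 0 δ, HasDerivAt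
      (fun t => fun f : s => eval (c t) (f : MvPolynomial (Fin n) ℝ))
      (fun f => ∑ l, eval (c t) (a f l) * eval (c t) (l : MvPolynomial (Fin n) ℝ)) t := by
    intro t ht
    refine hasDerivAt_pi.2 fun f => (hasDerivAt_eval_comp (hd t ht) _).congr_deriv ?_
    rw [← eval_sum_mul_pderiv, ha, map_sum]
    simp
  have hb : ContinuousOn (fun t => ∑ f, ∑ l, |eval (c t) (a f l)|) (Set.Icc 0 δ) :=
    continuousOn_finsetSum _ fun f _ => continuousOn_finsetSum _ fun l _ =>
      ((contDiff_eval (a f l)).continuous.comp_continuousOn hcont).abs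
  obtain ⟨C, hC⟩ := isCompact_Icc.bddAbove_image hb
  have hzero := eq_zero_of_abs_deriv_le_mul_abs_self_of_eq_zero_right (K := C)
    (fun t ht => (hF t ht).continuousAt.continuousWithinAt)
    (fun t ht => (hF t (Set.Ico_subset_Icc_self ht)).hasDerivWithinAt)
    (funext fun f => hsI f _ h0) (by
      intro t ht
      have hCt := hC ⟨t, Set.Ico_subset_Icc_self ht, rfl⟩
      have hC0 : 0 ≤ C := le_trans (Finset.sum_nonneg fun f _ => Finset.sum_nonneg fun l _ =>
        abs_nonneg _) hCt
      refine (pi_norm_le_iff_of_nonneg (mul_nonneg hC0 (norm_nonneg _))).2 fun f => ?_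
      refine (norm_sum_le _ _).trans (le_trans ?_ (mul_le_mul_of_nonneg_right
        ((Finset.single_le_sum (f := fun f => ∑ l, |eval (c t) (a f l)|)
          (fun f _ => Finset.sum_nonneg fun l _ => abs_nonneg _) (Finset.mem_univ f)).trans hCt)
        (norm_nonneg _)))
      rw [Finset.sum_mul]
      refine Finset.sum_le_sum fun l _ => ?_
      rw [norm_mul]
      exact mul_le_mul_of_nonneg_left (norm_le_pi_norm
        (fun f : s => eval (c t) (f : MvPolynomial (Fin n) ℝ)) l) (abs_nonneg _))
  intro t ht
  obtain ⟨S, rfl⟩ := hX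
  intro q hq
  have hqI : q ∈ vanishingIdeal ℝ n (zeroSet ℝ n S) := fun y hy => hy q hq
  rw [← hs] at hqI
  have hle : Ideal.span (s : Set (MvPolynomial (Fin n) ℝ)) ≤ RingHom.ker (eval (c t)) :=
    Ideal.span_le.2 fun f hf => congrFun (hzero t ht) ⟨f, hf⟩
  exact hle hqI

/-- A polynomial vector field that preserves the vanishing ideal of `X` and kills the invariants
along `X` is tangent to the orbits at the points of `X`. -/
theorem evalField_mem_orbitTangent {K : Set (Matrix (Fin n) (Fin n) ℝ)}
    (hK : IsMatSubgroup ℝ n K) (hc : IsCompact K) {X : Set (Fin n → ℝ)}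
    (hX : IsAlgebraicSet ℝ n X) {V : Fin n → MvPolynomial (Fin n) ℝ}
    (hV : ∀ q, (Invariant ℝ n K q ∨ q ∈ vanishingIdeal ℝ n X) →
      ∀ y ∈ X, grad q y ⬝ᵥ evalField V y = 0) {x : Fin n → ℝ} (hx : x ∈ X) :
    evalField V x ∈ orbitTangent ℝ n K x := by
  have hsmooth : ContDiff ℝ 1 (evalField V) := contDiff_pi.2 fun i => contDiff_eval (V i)
  obtain ⟨c, hc0, ε, hε, hcd⟩ :=
    hsmooth.contDiffAt.exists_forall_mem_closedBall_exists_eq_forall_mem_Ioo_hasDerivAt₀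
      (x₀ := x) 0
  simp only [zero_sub, zero_add] at hcd
  have hd : ∀ t ∈ Set.Icc 0 (ε / 2), HasDerivAt c (evalField V (c t)) t := fun t ht =>
    hcd t ⟨by linarith [ht.1], by linarith [ht.2]⟩
  have hcX := mem_of_integralCurve hX (fun q hq => hV q (Or.inr hq)) hd (hc0 ▸ hx)
  have horb : ∀ t ∈ Set.Icc 0 (ε / 2), c t ∈ orbit ℝ n K x := by
    intro t ht
    refine mem_orbit_of_invariants_eq hK hc fun q hq => ?_
    have := constant_of_has_deriv_right_zero (f := fun t => eval (c t) q)
      (fun t ht => (hasDerivAt_eval_comp (hd t ht) q).continuousAt.continuousWithinAt)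
      (fun t ht => by
        have h := hasDerivAt_eval_comp (hd t (Set.Ico_subset_Icc_self ht)) q
        rw [hV q (Or.inl hq) _ (hcX t (Set.Ico_subset_Icc_self ht))] at h
        exact h.hasDerivWithinAt) t ht
    rwa [hc0] at this
  have hpos : ∀ j : ℕ, 0 < ε / 2 * (1 / ((j : ℝ) + 1)) := fun j => by positivity
  have hlim : Tendsto (fun j : ℕ => ε / 2 * (1 / ((j : ℝ) + 1))) atTop (𝓝 0) := by
    simpa using (tendsto_one_div_add_atTop_nhds_zero_nat (𝕜 := ℝ)).const_mul (ε / 2)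
  refine mem_orbitTangent_of_tendsto hK hc (y := fun j : ℕ => c (ε / 2 * (1 / ((j : ℝ) + 1))))
    (fun j => horb _ ⟨(hpos j).le, ?_⟩) hpos hlim ?_
  · refine mul_le_of_le_one_right (by positivity) ?_
    rw [div_le_one (by positivity)]
    linarith [Nat.cast_nonneg (α := ℝ) j]
  · have h := (hd 0 ⟨le_rfl, by positivity⟩).tendsto_slope_zero
    have h' := h.comp (tendsto_nhdsWithin_iff.2 ⟨hlim, .of_forall fun j => (hpos j).ne'⟩)
    simpa [hc0, Function.comp_def] using h'

end Flow

section GenericPoint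

variable {n : ℕ}

theorem linearIndependent_iff_det_gram_ne_zero {r : ℕ} (B : Matrix (Fin r) (Fin n) ℝ) :
    LinearIndependent ℝ B.row ↔ (B * B.transpose).det ≠ 0 := by
  rw [Fintype.linearIndependent_iff, ne_eq, ← Matrix.exists_mulVec_eq_zero_iff]
  have hrow : ∀ u : Fin r → ℝ, ∑ i, u i • B.row i = B.transpose.mulVec u := by
    intro u
    ext k
    simp [Matrix.mulVec, dotProduct, mul_comm]
  have hker : ∀ u : Fin r → ℝ, (B * B.transpose).mulVec u = 0 ↔ B.transpose.mulVec u = 0 := by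
    intro u
    constructor
    · intro h
      rw [← Matrix.mulVec_mulVec] at h
      have h2 : u ⬝ᵥ B.mulVec (B.transpose.mulVec u) = 0 := by rw [h, dotProduct_zero]
      rw [Matrix.dotProduct_mulVec, ← Matrix.mulVec_transpose] at h2
      exact dotProduct_self_eq_zero.1 h2
    · intro h
      rw [← Matrix.mulVec_mulVec, h, Matrix.mulVec_zero]
  simp only [hrow, hker]
  constructor
  · rintro h ⟨u, hu, hu0⟩
    exact hu (funext (h u hu0))
  · intro h u hu i
    by_contra hi
    exact h ⟨u, fun h0 => hi (congrFun h0 i), hu⟩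

/-- A nonempty relatively Zariski open subset of `X` contains a point `x` at which every vector
killed by the differentials of the members of `Q` extends, up to a scalar, to a polynomial vector
field that is killed along `X` by all these differentials. -/
theorem exists_generic_point (Q : Set (MvPolynomial (Fin n) ℝ)) {X : Set (Fin n → ℝ)}
    {p : MvPolynomial (Fin n) ℝ} (hp : ∃ x ∈ X, eval x p ≠ 0) :
    ∃ x ∈ X, eval x p ≠ 0 ∧ ∀ v : Fin n → ℝ, (∀ q ∈ Q, grad q x ⬝ᵥ v = 0) →
      ∃ V : Fin n → MvPolynomial (Fin n) ℝ,
        (∀ q ∈ Q, ∀ y ∈ X, grad q y ⬝ᵥ evalField V y = 0) ∧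
          ∃ c : ℝ, c ≠ 0 ∧ evalField V x = c • v := by
  let rk : (Fin n → ℝ) → ℕ := fun x =>
    Module.finrank ℝ (Submodule.span ℝ ((fun q => grad q x) '' Q))
  obtain ⟨x, ⟨hxX, hxp⟩, hmax⟩ : ∃ x, (x ∈ X ∧ eval x p ≠ 0) ∧
      ∀ y, y ∈ X ∧ eval y p ≠ 0 → rk y ≤ rk x := by
    have hbdd : BddAbove (rk '' {x | x ∈ X ∧ eval x p ≠ 0}) :=
      ⟨n, by
        rintro _ ⟨y, -, rfl⟩
        exact (Submodule.finrank_le _).trans (by simp)⟩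
    obtain ⟨x, hx, hx'⟩ := Nat.sSup_mem (Set.Nonempty.image rk hp) hbdd
    exact ⟨x, hx, fun y hy => hx' ▸ le_csSup hbdd ⟨y, hy, rfl⟩⟩
  refine ⟨x, hxX, hxp, fun v hv => ?_⟩
  obtain ⟨f, hfQ, -, hfli⟩ :=
    Submodule.exists_fun_fin_finrank_span_eq ℝ ((fun q => grad q x) '' Q)
  choose q hqQ hqf using hfQ
  change Fin (rk x) → _ at q
  let J : Matrix (Fin (rk x)) (Fin n) (MvPolynomial (Fin n) ℝ) :=
    Matrix.of fun i k => pderiv k (q i)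
  let B : (Fin n → ℝ) → Matrix (Fin (rk x)) (Fin n) ℝ := fun y => Matrix.of fun i => grad (q i) y
  have hJ : ∀ y, J.map (eval y) = B y := fun y => rfl
  have hJt : ∀ y, J.transpose.map (eval y) = (B y).transpose := fun y => rfl
  let G := J * J.transpose
  have hG : ∀ y, G.map (eval y) = B y * (B y).transpose := by
    intro y
    rw [Matrix.map_mul, hJt, hJ]
  let d : (Fin n → ℝ) → ℝ := fun y => (B y * (B y).transpose).det
  have hd : ∀ y, eval y G.det = d y := by
    intro y
    rw [RingHom.map_det, RingHom.mapMatrix_apply, hG]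
  let V : Fin n → MvPolynomial (Fin n) ℝ := fun k => p * G.det * (G.det * C (v k) -
    (J.transpose * (G.adjugate * J)).mulVec (fun l => C (v l)) k)
  have hVy : ∀ y, evalField V y = (eval y p * d y) • (d y • v -
      (B y).transpose.mulVec ((B y * (B y).transpose).adjugate.mulVec ((B y).mulVec v))) := by
    intro y
    have h1 : (J.transpose * (G.adjugate * J)).map (eval y) =
        (B y).transpose * ((B y * (B y).transpose).adjugate * B y) := by
      rw [Matrix.map_mul, Matrix.map_mul, hJt, hJ, ← hG,
        ← RingHom.mapMatrix_apply, RingHom.map_adjugate, RingHom.mapMatrix_apply]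
    ext k
    simp only [evalField, V, map_mul, map_sub, hd, eval_C, Pi.smul_apply, Pi.sub_apply,
      smul_eq_mul, Matrix.mulVec_mulVec]
    rw [← h1, RingHom.map_mulVec]
    simp [Function.comp_def]
  have hBV : ∀ y, (B y).mulVec (evalField V y) = 0 := by
    intro y
    rw [hVy, Matrix.mulVec_smul, Matrix.mulVec_sub, Matrix.mulVec_mulVec, Matrix.mulVec_mulVec,
      Matrix.mul_adjugate, Matrix.smul_mulVec, Matrix.one_mulVec, Matrix.mulVec_smul, sub_self,
      smul_zero]
  have hdx : d x ≠ 0 := by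
    refine (linearIndependent_iff_det_gram_ne_zero (B x)).1 ?_
    have hrow : (B x).row = f := funext hqf
    rw [hrow]
    exact hfli
  have hBx : (B x).mulVec v = 0 := funext fun i => hv _ (hqQ i)
  refine ⟨V, fun g hg y hy => ?_, eval x p * d x * d x, by positivity, ?_⟩
  · by_cases hz : eval y p * d y = 0
    · rw [hVy, hz, zero_smul, dotProduct_zero]
    · have hli := (linearIndependent_iff_det_gram_ne_zero (B y)).2 (right_ne_zero_of_mul hz)
      have hspan : Submodule.span ℝ (Set.range (B y).row) =
          Submodule.span ℝ ((fun q => grad q y) '' Q) := by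
        refine Submodule.eq_of_le_of_finrank_le (Submodule.span_mono ?_) ?_
        · rintro _ ⟨i, rfl⟩
          exact ⟨q i, hqQ i, rfl⟩
        · rw [finrank_span_eq_card hli, Fintype.card_fin]
          exact hmax y ⟨hy, left_ne_zero_of_mul hz⟩
      have hmem : grad g y ∈ Submodule.span ℝ (Set.range (B y).row) :=
        hspan ▸ Submodule.subset_span ⟨g, hg, rfl⟩
      generalize grad g y = w at hmem
      induction hmem using Submodule.span_induction with
      | mem w hw =>
        obtain ⟨i, rfl⟩ := hw
        exact congrFun (hBV y) i
      | zero => exact zero_dotProduct _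
      | add a b _ _ ha hb => rw [add_dotProduct, ha, hb, add_zero]
      | smul a b _ hb => rw [smul_dotProduct, hb, smul_zero]
  · rw [hVy, hBx, Matrix.mulVec_zero, Matrix.mulVec_zero, sub_zero, smul_smul]

/-- At a generic point of `X`, the common kernel of the differentials of the invariants and of
the elements of the vanishing ideal of `X` is contained in the tangent space to the orbit. -/
theorem exists_tangent_generic_point {K : Set (Matrix (Fin n) (Fin n) ℝ)}
    (hK : IsMatSubgroup ℝ n K) (hc : IsCompact K) {X : Set (Fin n → ℝ)}
    (hX : IsAlgebraicSet ℝ n X) {p : MvPolynomial (Fin n) ℝ} (hp : ∃ x ∈ X, eval x p ≠ 0) :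
    ∃ x ∈ X, eval x p ≠ 0 ∧ ∀ v : Fin n → ℝ, (∀ q, Invariant ℝ n K q → grad q x ⬝ᵥ v = 0) →
      (∀ q ∈ vanishingIdeal ℝ n X, grad q x ⬝ᵥ v = 0) → v ∈ orbitTangent ℝ n K x := by
  obtain ⟨x, hxX, hxp, hx⟩ :=
    exists_generic_point {q | Invariant ℝ n K q ∨ q ∈ vanishingIdeal ℝ n X} hp
  refine ⟨x, hxX, hxp, fun v h1 h2 => ?_⟩
  obtain ⟨V, hV, c, hc0, hVx⟩ := hx v fun q hq => hq.elim (h1 q) (h2 q)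
  have := evalField_mem_orbitTangent hK hc hX hV hxX
  rw [hVx] at this
  exact (Submodule.smul_mem_iff _ hc0).1 this

end GenericPoint

section Semisimple

variable {n : ℕ}

/-- The orthogonal complement of `T` with respect to the bilinear form with matrix `S`. -/
def formOrthogonal (S : Matrix (Fin n) (Fin n) ℝ) (T : Submodule ℝ (Fin n → ℝ)) :
    Submodule ℝ (Fin n → ℝ) :=
  (Matrix.toBilin' S).orthogonal T

theorem mem_formOrthogonal {S : Matrix (Fin n) (Fin n) ℝ} {T : Submodule ℝ (Fin n → ℝ)}
    {u : Fin n → ℝ} : u ∈ formOrthogonal S T ↔ ∀ t ∈ T, t ⬝ᵥ S.mulVec u = 0 := by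
  simp only [formOrthogonal, LinearMap.BilinForm.mem_orthogonal_iff, Matrix.toBilin'_apply']

theorem isCompl_formOrthogonal {S : Matrix (Fin n) (Fin n) ℝ}
    (hsymm : ∀ u v, u ⬝ᵥ S.mulVec v = v ⬝ᵥ S.mulVec u)
    (hdef : ∀ u, u ⬝ᵥ S.mulVec u = 0 → u = 0) (T : Submodule ℝ (Fin n → ℝ)) :
    IsCompl T (formOrthogonal S T) := by
  refine (LinearMap.BilinForm.isCompl_orthogonal_iff_disjoint ?_).2 ?_
  · intro u v h
    rw [Matrix.toBilin'_apply'] at h ⊢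
    rw [hsymm, h]
  · exact Submodule.disjoint_def.2 fun u hu hu' => hdef u (mem_formOrthogonal.1 hu' u hu)

theorem form_skew_of_mem_lieAlgebra {K : Set (Matrix (Fin n) (Fin n) ℝ)}
    {S : Matrix (Fin n) (Fin n) ℝ}
    (hinv : ∀ g ∈ K, ∀ u v, g.mulVec u ⬝ᵥ S.mulVec (g.mulVec v) = u ⬝ᵥ S.mulVec v)
    {A : Matrix (Fin n) (Fin n) ℝ} (hA : A ∈ lieAlgebra ℝ n K) (u v : Fin n → ℝ) :
    A.mulVec u ⬝ᵥ S.mulVec v + u ⬝ᵥ S.mulVec (A.mulVec v) = 0 := by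
  have h1 : ∀ w : Fin n → ℝ, HasDerivAt (fun t : ℝ => (mexp ℝ n (t • A)).mulVec w)
      (A.mulVec w) 0 := hasDerivAt_mulVec (hasDerivAt_mexp A)
  have h2 : HasDerivAt (fun t : ℝ => S.mulVec ((mexp ℝ n (t • A)).mulVec v))
      (S.mulVec (A.mulVec v)) 0 := by
    rw [Matrix.mulVec_mulVec]
    simp only [Matrix.mulVec_mulVec]
    refine hasDerivAt_mulVec (fun i j => ?_) v
    simp only [Matrix.mul_apply]
    exact HasDerivAt.fun_sum fun k _ => (hasDerivAt_mexp A k j).const_mul _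
  have h3 : HasDerivAt (fun t : ℝ => (mexp ℝ n (t • A)).mulVec u ⬝ᵥ
      S.mulVec ((mexp ℝ n (t • A)).mulVec v))
      (∑ i, (A.mulVec u i * S.mulVec v i + u i * S.mulVec (A.mulVec v) i)) 0 := by
    refine HasDerivAt.fun_sum fun i _ => ?_
    have := (hasDerivAt_pi.1 (h1 u) i).fun_mul (hasDerivAt_pi.1 h2 i)
    simpa only [zero_smul, mexp_zero, Matrix.one_mulVec] using this
  simp only [hinv _ (hA _)] at h3
  rw [Finset.sum_add_distrib] at h3
  exact h3.unique (hasDerivAt_const _ _)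

theorem isSemisimple_of_mem_lieAlgebra {K : Set (Matrix (Fin n) (Fin n) ℝ)}
    (hK : IsMatSubgroup ℝ n K) (hc : IsCompact K) {A : Matrix (Fin n) (Fin n) ℝ}
    (hA : A ∈ lieAlgebra ℝ n K) : Module.End.IsSemisimple (Matrix.toLin' A) := by
  obtain ⟨S, hsymm, hdef, hinv⟩ := exists_invariant_form hK hc
  refine Module.End.isSemisimple_iff.2 fun T hT =>
    ⟨formOrthogonal S T, ?_, isCompl_formOrthogonal hsymm hdef T⟩
  rw [Module.End.mem_invtSubmodule_iff_forall_mem_of_mem] at hT ⊢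
  intro u hu
  rw [mem_formOrthogonal] at hu ⊢
  intro t ht
  have h1 := form_skew_of_mem_lieAlgebra hinv hA t u
  have h2 := hu _ (hT t ht)
  rw [Matrix.toLin'_apply] at h2 ⊢
  linarith

/-- The complexification of a real matrix. -/
def cMat (A : Matrix (Fin n) (Fin n) ℝ) : Matrix (Fin n) (Fin n) ℂ :=
  (Algebra.ofId ℝ ℂ).mapMatrix A

theorem iSup_eigenspace_cMat_eq_top {A : Matrix (Fin n) (Fin n) ℝ}
    (hA : Module.End.IsSemisimple (Matrix.toLin' A)) :
    ⨆ μ, Module.End.eigenspace (Matrix.toLin' (cMat A)) μ = ⊤ := by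
  refine Module.End.IsSemisimple.iSup_eigenspace_eq_top ?_
  have hsep : ((minpoly ℝ A).map (algebraMap ℝ ℂ)).Separable := by
    refine Polynomial.Separable.map (PerfectField.separable_iff_squarefree.2 ?_)
    rw [← Matrix.minpoly_toLin']
    exact hA.minpoly_squarefree
  refine Module.End.isSemisimple_of_squarefree_aeval_eq_zero hsep.squarefree ?_
  have h : Polynomial.aeval (cMat A) ((minpoly ℝ A).map (algebraMap ℝ ℂ)) = 0 := by
    rw [Polynomial.aeval_map_algebraMap, cMat, Polynomial.aeval_algHom_apply, minpoly.aeval,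
      map_zero]
  have h2 := Polynomial.aeval_algHom_apply (Matrix.toLinAlgEquiv' (R := ℂ) (n := Fin n)).toAlgHom
    (cMat A) ((minpoly ℝ A).map (algebraMap ℝ ℂ))
  rw [h, map_zero] at h2
  exact h2

/-- Restriction of a real polynomial to the complex line through `x` in the direction `y`. -/
def restrictLine (x : Fin n → ℝ) (y : Fin n → ℂ) :
    MvPolynomial (Fin n) ℝ →ₐ[ℝ] Polynomial ℂ :=
  aeval fun i => Polynomial.C (x i : ℂ) + Polynomial.X * Polynomial.C (y i)

theorem eval_zero_restrictLine (x : Fin n → ℝ) (y : Fin n → ℂ) (q : MvPolynomial (Fin n) ℝ) :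
    (restrictLine x y q).eval 0 = (eval x q : ℝ) := by
  induction q using MvPolynomial.induction_on with
  | C a => simp [restrictLine, Polynomial.algebraMap_apply]
  | add p q hp hq => simp [hp, hq]
  | mul_X p i hp =>
    rw [map_mul, Polynomial.eval_mul, hp]
    simp [restrictLine]

theorem derivative_restrictLine (x : Fin n → ℝ) (y : Fin n → ℂ) (q : MvPolynomial (Fin n) ℝ) :
    Polynomial.derivative (restrictLine x y q) =
      ∑ i, Polynomial.C (y i) * restrictLine x y (pderiv i q) := by
  induction q using MvPolynomial.induction_on with
  | C a => simp [restrictLine, Polynomial.algebraMap_apply]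
  | add p q hp hq => simp [hp, hq, mul_add, Finset.sum_add_distrib]
  | mul_X p i hp =>
    have hX : Polynomial.derivative (restrictLine x y (X i)) = Polynomial.C (y i) := by
      simp [restrictLine]
    rw [map_mul, Polynomial.derivative_mul, hp, hX]
    simp only [Derivation.leibniz, pderiv_X, smul_eq_mul, map_add, map_mul, mul_add,
      Finset.sum_add_distrib, Finset.sum_mul]
    rw [add_comm]
    congr 1
    · simp [Pi.single_apply, mul_comm]
    · exact Finset.sum_congr rfl fun j _ => by ring

theorem sum_mul_pderiv_eq_zero {K : Set (Matrix (Fin n) (Fin n) ℝ)}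
    {A : Matrix (Fin n) (Fin n) ℝ} (hA : A ∈ lieAlgebra ℝ n K) {q : MvPolynomial (Fin n) ℝ}
    (hq : Invariant ℝ n K q) : ∑ i, (∑ j, C (A i j) * X j) * pderiv i q = 0 := by
  refine MvPolynomial.funext fun w => ?_
  have h := hasDerivAt_eval_comp (hasDerivAt_mulVec (hasDerivAt_mexp A) w) q
  simp only [hq _ (hA _), zero_smul, mexp_zero, Matrix.one_mulVec] at h
  have h2 := h.unique (hasDerivAt_const _ _)
  simpa [dotProduct, grad, Matrix.mulVec, mul_comm] using h2

theorem restrictLine_eigenvector {K : Set (Matrix (Fin n) (Fin n) ℝ)} {x : Fin n → ℝ}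
    {A : Matrix (Fin n) (Fin n) ℝ} (hA : A ∈ lieAlgebra ℝ n K) (hAx : A.mulVec x = 0)
    {y : Fin n → ℂ} {μ : ℂ} (hμ : μ ≠ 0) (hy : (cMat A).mulVec y = μ • y)
    {q : MvPolynomial (Fin n) ℝ} (hq : Invariant ℝ n K q) (hqx : eval x q = 0) :
    restrictLine x y q = 0 := by
  have h := congrArg (restrictLine x y) (sum_mul_pderiv_eq_zero hA hq)
  have hlin : ∀ i, restrictLine x y (∑ j, C (A i j) * X j) =
      Polynomial.X * Polynomial.C (μ * y i) := by
    intro i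
    have h1 : ∑ j, (A i j : ℂ) * (x j : ℂ) = 0 := by
      have := congrFun hAx i
      simp only [Matrix.mulVec, dotProduct, Pi.zero_apply] at this
      exact_mod_cast congrArg (Complex.ofReal) this
    have h2 : ∑ j, (A i j : ℂ) * y j = μ * y i := congrFun hy i
    rw [← h2, map_sum, map_sum, Finset.mul_sum]
    have h3 : ∑ j, Polynomial.C ((A i j : ℂ) * (x j : ℂ)) = 0 := by
      rw [← map_sum, h1, map_zero]
    rw [← zero_add (∑ j, Polynomial.X * _), ← h3, ← Finset.sum_add_distrib]
    refine Finset.sum_congr rfl fun j _ => ?_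
    simp [restrictLine, Polynomial.algebraMap_apply]
    ring
  simp only [map_sum, map_mul, map_zero] at h
  have hder : Polynomial.X * Polynomial.C μ * Polynomial.derivative (restrictLine x y q) = 0 := by
    rw [derivative_restrictLine, Finset.mul_sum, ← h]
    refine Finset.sum_congr rfl fun i _ => ?_
    have := hlin i
    simp only [map_sum, map_mul] at this
    rw [this]
    ring
  have hne : (Polynomial.X * Polynomial.C μ : Polynomial ℂ) ≠ 0 :=
    mul_ne_zero Polynomial.X_ne_zero (Polynomial.C_ne_zero.2 hμ)
  have hdeg := Polynomial.derivative_eq_zero.1 ((mul_eq_zero.1 hder).resolve_left hne)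
  rw [Polynomial.eq_C_of_natDegree_eq_zero hdeg, Polynomial.coeff_zero_eq_eval_zero,
    eval_zero_restrictLine, hqx]
  simp

/-- If `X` is almost `K`-reduced, the differentials at `x` of the elements of the vanishing ideal
of `X` vanish on the image of the Lie algebra of the isotropy group of `x`. -/
theorem grad_dotProduct_lieAlgebra_isotropy {K : Set (Matrix (Fin n) (Fin n) ℝ)}
    (hK : IsMatSubgroup ℝ n K) (hc : IsCompact K) {Z : Set (Fin n → ℝ)}
    (hZ : IsAlmostGReduced ℝ n K Z) {x : Fin n → ℝ} (hx : x ∈ Z)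
    {A : Matrix (Fin n) (Fin n) ℝ} (hA : A ∈ lieAlgebra ℝ n K) (hAx : A.mulVec x = 0)
    {f : MvPolynomial (Fin n) ℝ} (hf : f ∈ vanishingIdeal ℝ n Z) (u : Fin n → ℝ) :
    grad f x ⬝ᵥ A.mulVec u = 0 := by
  let ℓ : (Fin n → ℂ) →ₗ[ℂ] ℂ :=
    (Fintype.linearCombination ℂ fun i => (grad f x i : ℂ)) ∘ₗ Matrix.toLin' (cMat A)
  have hℓ : ∀ y, ℓ y = ∑ i, (cMat A).mulVec y i * (grad f x i : ℂ) := fun y => by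
    simp [ℓ, Fintype.linearCombination_apply]
  have htop : (⊤ : Submodule ℂ (Fin n → ℂ)) ≤ LinearMap.ker ℓ := by
    rw [← iSup_eigenspace_cMat_eq_top (isSemisimple_of_mem_lieAlgebra hK hc hA)]
    refine iSup_le fun μ y hy => ?_
    rw [Module.End.mem_eigenspace_iff, Matrix.toLin'_apply] at hy
    rw [LinearMap.mem_ker, hℓ, hy]
    rcases eq_or_ne μ 0 with rfl | hμ
    · simp
    have hle : invariantIdeal ℝ n K Z ≤ RingHom.ker (restrictLine x y) :=
      Ideal.span_le.2 fun q hq => restrictLine_eigenvector hA hAx hμ hy hq.1 (hq.2 x hx)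
    have hprime : (RingHom.ker (restrictLine x y)).IsPrime := RingHom.ker_isPrime _
    rw [← hZ] at hf
    have hf0 : restrictLine x y f = 0 := (hprime.radical_le_iff.2 hle) hf
    have hd := derivative_restrictLine x y f
    rw [hf0, Polynomial.derivative_zero] at hd
    have hd0 := congrArg (Polynomial.eval 0) hd
    simp only [Polynomial.eval_zero, Polynomial.eval_finsetSum, Polynomial.eval_mul,
      Polynomial.eval_C, eval_zero_restrictLine] at hd0
    simp only [Pi.smul_apply, smul_eq_mul, mul_assoc, ← Finset.mul_sum, grad]
    rw [← hd0, mul_zero]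
  have hu : ℓ (fun i => (u i : ℂ)) = 0 := htop (Submodule.mem_top)
  rw [hℓ] at hu
  have hreal : ∀ i, (cMat A).mulVec (fun i => (u i : ℂ)) i = ((A.mulVec u i : ℝ) : ℂ) := by
    intro i
    simp [Matrix.mulVec, dotProduct, cMat, Algebra.ofId_apply]
  simp only [hreal] at hu
  rw [dotProduct_comm]
  simp only [dotProduct]
  exact_mod_cast hu

end Semisimple

section Slice

variable {n : ℕ}

open Filter Topology
open scoped Matrix.Norms.Operator

theorem dotProduct_mulVec_eq_zero_of_const {A : Matrix (Fin n) (Fin n) ℝ} {w u : Fin n → ℝ}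
    (h : ∀ s : ℝ, w ⬝ᵥ (mexp ℝ n (s • A)).mulVec u = w ⬝ᵥ u) : w ⬝ᵥ A.mulVec u = 0 := by
  have h1 : HasDerivAt (fun s : ℝ => w ⬝ᵥ (mexp ℝ n (s • A)).mulVec u) (w ⬝ᵥ A.mulVec u) 0 :=
    HasDerivAt.fun_sum fun i _ =>
      (hasDerivAt_pi.1 (hasDerivAt_mulVec (hasDerivAt_mexp A) u) i).const_mul (w i)
  simp only [h] at h1
  exact h1.unique (hasDerivAt_const _ _)

theorem mulVec_mem_orbitTangent {K : Set (Matrix (Fin n) (Fin n) ℝ)} (hK : IsMatSubgroup ℝ n K)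
    {x : Fin n → ℝ} {g : Matrix (Fin n) (Fin n) ℝ} (hg : g ∈ isotropy ℝ n K x) {t : Fin n → ℝ}
    (ht : t ∈ orbitTangent ℝ n K x) : g.mulVec t ∈ orbitTangent ℝ n K x := by
  induction ht using Submodule.span_induction with
  | mem t ht =>
    obtain ⟨A, hA, rfl⟩ := ht
    refine Submodule.subset_span ⟨g * A * g⁻¹, conj_mem_lieAlgebra hK hg.1 hA, ?_⟩
    simp only [← Matrix.mulVec_mulVec]
    rw [((isMatSubgroup_isotropy hK x).2.2 g hg).2.2]
  | zero => simp
  | add s t _ _ hs ht => rw [Matrix.mulVec_add]; exact add_mem hs ht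
  | smul a t _ ht => rw [Matrix.mulVec_smul]; exact Submodule.smul_mem _ a ht

/-- The orthogonal complement of the tangent space to the orbit, with respect to an invariant
form, is a slice. -/
theorem isSliceComplement_formOrthogonal {K : Set (Matrix (Fin n) (Fin n) ℝ)}
    (hK : IsMatSubgroup ℝ n K) {S : Matrix (Fin n) (Fin n) ℝ}
    (hsymm : ∀ u v, u ⬝ᵥ S.mulVec v = v ⬝ᵥ S.mulVec u)
    (hdef : ∀ u, u ⬝ᵥ S.mulVec u = 0 → u = 0)
    (hinv : ∀ g ∈ K, ∀ u v, g.mulVec u ⬝ᵥ S.mulVec (g.mulVec v) = u ⬝ᵥ S.mulVec v)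
    (x : Fin n → ℝ) :
    IsSliceComplement ℝ n K x (formOrthogonal S (orbitTangent ℝ n K x)) := by
  refine ⟨isCompl_formOrthogonal hsymm hdef _, fun g hg u hu => mem_formOrthogonal.2 fun t ht => ?_⟩
  have hginv := (isMatSubgroup_isotropy hK x).2.2 g hg
  have hdet := (Matrix.isUnit_iff_isUnit_det _).1 hginv.1
  have := hinv g hg.1 (g⁻¹.mulVec t) u
  rw [Matrix.mulVec_mulVec, Matrix.mul_nonsing_inv _ hdet, Matrix.one_mulVec] at this
  rw [this]
  exact mem_formOrthogonal.1 hu _ (mulVec_mem_orbitTangent hK hginv.2 ht)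

/-- The elements of `H` that fix `N` pointwise. -/
def pointwiseFixer (H : Set (Matrix (Fin n) (Fin n) ℝ)) (N : Submodule ℝ (Fin n → ℝ)) :
    Set (Matrix (Fin n) (Fin n) ℝ) :=
  {g ∈ H | ∀ u ∈ N, g.mulVec u = u}

theorem isMatSubgroup_pointwiseFixer {H : Set (Matrix (Fin n) (Fin n) ℝ)}
    (hH : IsMatSubgroup ℝ n H) (N : Submodule ℝ (Fin n → ℝ)) :
    IsMatSubgroup ℝ n (pointwiseFixer H N) := by
  refine ⟨⟨hH.1, fun u _ => Matrix.one_mulVec u⟩,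
    fun a ha b hb => ⟨hH.2.1 a ha.1 b hb.1, fun u hu => ?_⟩,
    fun a ha => ⟨(hH.2.2 a ha.1).1, (hH.2.2 a ha.1).2, fun u hu => ?_⟩⟩
  · rw [← Matrix.mulVec_mulVec, hb.2 u hu, ha.2 u hu]
  · have hdet := (Matrix.isUnit_iff_isUnit_det _).1 (hH.2.2 a ha.1).1
    nth_rewrite 1 [← ha.2 u hu]
    rw [Matrix.mulVec_mulVec, Matrix.nonsing_inv_mul _ hdet, Matrix.one_mulVec]

theorem isCompact_pointwiseFixer {H : Set (Matrix (Fin n) (Fin n) ℝ)} (hc : IsCompact H)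
    (N : Submodule ℝ (Fin n → ℝ)) : IsCompact (pointwiseFixer H N) := by
  have heq : pointwiseFixer H N = H ∩ ⋂ u ∈ N, {g | g.mulVec u = u} := by
    ext g
    simp [pointwiseFixer]
  rw [heq]
  exact hc.inter_right <| isClosed_iInter fun u => isClosed_iInter fun _ =>
    isClosed_eq (continuous_id.matrix_mulVec continuous_const) continuous_const

/-- A compact group whose Lie algebra acts trivially on `N` has finite image on `N`. -/
theorem hasFiniteImageOn_of_lieAlgebra {H : Set (Matrix (Fin n) (Fin n) ℝ)}
    (hH : IsMatSubgroup ℝ n H) (hc : IsCompact H) {N : Submodule ℝ (Fin n → ℝ)}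
    (hLie : ∀ A ∈ lieAlgebra ℝ n H, ∀ u ∈ N, A.mulVec u = 0) : HasFiniteImageOn ℝ n H N := by
  by_contra hinf
  let e := Set.Infinite.natEmbedding _ hinf
  choose g hgH hge using fun j => (e j).2
  have : FirstCountableTopology (Matrix (Fin n) (Fin n) ℝ) :=
    inferInstanceAs (FirstCountableTopology (Fin n → Fin n → ℝ))
  obtain ⟨g₀, hg₀, φ, hφ, hlim⟩ := hc.tendsto_subseq hgH
  have hunit : ∀ a ∈ H, IsUnit a.det := fun a ha =>
    (Matrix.isUnit_iff_isUnit_det _).1 (hH.2.2 a ha).1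
  have hinv : Tendsto (fun j => (g (φ (j + 1)))⁻¹) atTop (𝓝 g₀⁻¹) := by
    obtain ⟨a, ha⟩ := (hH.2.2 g₀ hg₀).1
    have h1 := NormedRing.inverse_continuousAt a
    rw [ha] at h1
    have h2 := h1.tendsto.comp (hlim.comp (tendsto_add_atTop_nat 1))
    simp only [Function.comp_def, ← Matrix.nonsing_inv_eq_ringInverse] at h2
    exact h2
  have hh1 : Tendsto (fun j => (g (φ (j + 1)))⁻¹ * g (φ j)) atTop (𝓝 1) := by
    rw [← Matrix.nonsing_inv_mul g₀ (hunit g₀ hg₀)]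
    exact hinv.mul hlim
  obtain ⟨A, hA, hAM, -⟩ := exists_transverse_direction hH hc.isClosed
    (isMatSubgroup_pointwiseFixer hH N) (isCompact_pointwiseFixer hc N) (fun a ha => ha.1)
    (fun j => hH.2.1 _ (hH.2.2 _ (hgH (φ (j + 1)))).2 _ (hgH (φ j))) (fun j hj => by
      have heq : e (φ j) = e (φ (j + 1)) := by
        refine Subtype.ext ?_
        rw [← hge, ← hge]
        funext u
        have h1 := congrArg (g (φ (j + 1))).mulVec (hj.2 u u.2)
        rwa [Matrix.mulVec_mulVec, ← mul_assoc, Matrix.mul_nonsing_inv _ (hunit _ (hgH _)),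
          one_mul] at h1
      exact (hφ (Nat.lt_succ_self j)).ne (e.injective heq)) hh1
  exact hAM fun t => ⟨hA t, fun u hu => mexp_mulVec_of_mulVec_eq_zero
    (by rw [Matrix.smul_mulVec, hLie A hA u hu, smul_zero])⟩

theorem mulVec_eq_zero_of_mem_lieAlgebra_isotropy {L : Set (Matrix (Fin n) (Fin n) ℝ)}
    {x : Fin n → ℝ} {A : Matrix (Fin n) (Fin n) ℝ} (hA : A ∈ lieAlgebra ℝ n (isotropy ℝ n L x)) :
    A.mulVec x = 0 := by
  refine dotProduct_self_eq_zero.1 (dotProduct_mulVec_eq_zero_of_const fun s => ?_)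
  rw [(hA s).2]

end Slice

theorem isPrincipalPt_of_isGReduced {n : ℕ} {K : Set (Matrix (Fin n) (Fin n) ℝ)}
    (hK : IsMatSubgroup ℝ n K) (hc : IsCompact K) {Z : Set (Fin n → ℝ)}
    (hZ : IsGReduced ℝ n K Z) {x : Fin n → ℝ} (hx : x ∈ Z)
    (hT : ∀ v : Fin n → ℝ, (∀ q, Invariant ℝ n K q → grad q x ⬝ᵥ v = 0) →
      (∀ q ∈ vanishingIdeal ℝ n Z, grad q x ⬝ᵥ v = 0) → v ∈ orbitTangent ℝ n K x) :
    IsPrincipalPt ℝ n K x := by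
  obtain ⟨S, hsymm, hdef, hinv⟩ := exists_invariant_form hK hc
  have hN := isSliceComplement_formOrthogonal hK hsymm hdef hinv x
  refine ⟨hasClosedOrbit_of_isCompact hK hc x, _, hN, fun g hg u hu => ?_⟩
  have hq : ∀ q, Invariant ℝ n K q → grad q x ⬝ᵥ (g.mulVec u - u) = 0 := fun q hq => by
    rw [dotProduct_sub, grad_dotProduct_mulVec_of_isotropy hq hg, sub_self]
  refine sub_eq_zero.1 (Submodule.disjoint_def.1 hN.1.disjoint _ (hT _ hq fun q hqZ => ?_)
    (sub_mem (hN.2 g hg u hu) hu))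
  rw [← hZ] at hqZ
  exact (grad_dotProduct_eq_zero_of_mem_span (fun q hq => hq.2 x hx)
    (fun q hq' => hq q hq'.1) hqZ).2

theorem isAlmostPrincipalPt_of_isAlmostGReduced {n : ℕ} {K : Set (Matrix (Fin n) (Fin n) ℝ)}
    (hK : IsMatSubgroup ℝ n K) (hc : IsCompact K) {Z : Set (Fin n → ℝ)}
    (hZ : IsAlmostGReduced ℝ n K Z) {x : Fin n → ℝ} (hx : x ∈ Z)
    (hT : ∀ v : Fin n → ℝ, (∀ q, Invariant ℝ n K q → grad q x ⬝ᵥ v = 0) →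
      (∀ q ∈ vanishingIdeal ℝ n Z, grad q x ⬝ᵥ v = 0) → v ∈ orbitTangent ℝ n K x) :
    IsAlmostPrincipalPt ℝ n K x := by
  obtain ⟨S, hsymm, hdef, hinv⟩ := exists_invariant_form hK hc
  have hN := isSliceComplement_formOrthogonal hK hsymm hdef hinv x
  refine ⟨hasClosedOrbit_of_isCompact hK hc x, _, hN,
    hasFiniteImageOn_of_lieAlgebra (isMatSubgroup_isotropy hK x) (isCompact_isotropy hc x)
      fun A hA u hu => ?_⟩
  have hAN : A.mulVec u ∈ formOrthogonal S (orbitTangent ℝ n K x) := by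
    refine mem_formOrthogonal.2 fun t ht => ?_
    rw [Matrix.dotProduct_mulVec]
    refine dotProduct_mulVec_eq_zero_of_const fun s => ?_
    rw [← Matrix.dotProduct_mulVec, ← Matrix.dotProduct_mulVec, mem_formOrthogonal.1 hu t ht,
      mem_formOrthogonal.1 (hN.2 _ (hA s) u hu) t ht]
  refine Submodule.disjoint_def.1 hN.1.disjoint _ (hT _ (fun q hq => ?_) fun q hqZ => ?_) hAN
  · exact dotProduct_mulVec_eq_zero_of_const fun s => grad_dotProduct_mulVec_of_isotropy hq (hA s) u
  · exact grad_dotProduct_lieAlgebra_isotropy hK hc hZ hx (fun s => (hA s).1)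
      (mulVec_eq_zero_of_mem_lieAlgebra_isotropy hA) hqZ u

/-- **Theorem 1.1 (necessity).** Let `K` be a compact Lie group (realized as a compact
subgroup of `GL_n(ℝ)`) and `X ⊆ ℝⁿ` a `K`-stable real algebraic set.  If `X` is `K`-reduced
then `X_pr` is Zariski dense in `X`, and if `X` is almost `K`-reduced then `X_apr` is Zariski
dense in `X`. -/
theorem K_reduced_implies_principal_dense
    (n : ℕ) (K : Set (Matrix (Fin n) (Fin n) ℝ))
    (hKgrp : IsMatSubgroup ℝ n K) (hKcpt : IsCompact K)
    (X : Set (Fin n → ℝ)) (hXalg : IsAlgebraicSet ℝ n X) (hXstab : Stabilizes ℝ n K X) :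
    (IsGReduced ℝ n K X → ZDenseIn ℝ n (X ∩ prPoints ℝ n K) X) ∧
    (IsAlmostGReduced ℝ n K X → ZDenseIn ℝ n (X ∩ aprPoints ℝ n K) X) := by
  constructor
  · intro hZ p hp x₀ hx₀
    by_contra hpx
    obtain ⟨x, hx, hpx, hT⟩ := exists_tangent_generic_point hKgrp hKcpt hXalg ⟨x₀, hx₀, hpx⟩
    exact hpx (hp x ⟨hx, isPrincipalPt_of_isGReduced hKgrp hKcpt hZ hx hT⟩)
  · intro hZ p hp x₀ hx₀
    by_contra hpx
    obtain ⟨x, hx, hpx, hT⟩ := exists_tangent_generic_point hKgrp hKcpt hXalg ⟨x₀, hx₀, hpx⟩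
    exact hpx (hp x ⟨hx, isAlmostPrincipalPt_of_isAlmostGReduced hKgrp hKcpt hZ hx hT⟩)

end ZPaper
end
end

section
/- If W is a cofree K-module and X_pr (resp. X_apr) is Zariski dense in X, then X is K-reduced (resp. almost K-reduced). -/
/-!
Common framework: a "compact Lie group / complex reductive group acting on a
finite-dimensional module" is modelled as a subgroup of invertible `n × n`
matrices over `𝕜 = ℝ` or `ℂ` acting on `Fin n → 𝕜` by `Matrix.mulVec`.
Polynomial functions on the module are `MvPolynomial (Fin n) 𝕜`.
-/

set_option synthInstance.maxHeartbeats 1000000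
set_option maxHeartbeats 1000000

noncomputable section

open MvPolynomial

namespace ZPaper

variable (𝕜 : Type) [RCLike 𝕜] (n : ℕ)

section SliceTheory

variable {n}

/-- Pullback of polynomials along the linear map given by a matrix. -/
def linSubst (m : Matrix (Fin n) (Fin n) ℝ) :
    MvPolynomial (Fin n) ℝ →ₐ[ℝ] MvPolynomial (Fin n) ℝ :=
  aeval (fun i => ∑ j, C (m i j) * X j)

theorem linSubst_X (m : Matrix (Fin n) (Fin n) ℝ) (i : Fin n) :
    linSubst m (X i) = ∑ j, C (m i j) * X j := by
  simp [linSubst]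

theorem eval_linSubst (m : Matrix (Fin n) (Fin n) ℝ) (y : Fin n → ℝ)
    (p : MvPolynomial (Fin n) ℝ) :
    eval y (linSubst m p) = eval (m.mulVec y) p := by
  induction p using MvPolynomial.induction_on with
  | C a => simp [linSubst]
  | add p q hp hq => simp [hp, hq]
  | mul_X p i hp => simp [hp, linSubst_X, Matrix.mulVec, dotProduct]

theorem exists_linSubst_eq_sum (f : MvPolynomial (Fin n) ℝ) :
    ∃ (ι : Type) (_ : Fintype ι) (p : ι → MvPolynomial (Fin n) ℝ)
      (c : ι → Matrix (Fin n) (Fin n) ℝ → ℝ), (∀ i, Continuous (c i)) ∧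
        ∀ m, linSubst m f = ∑ i, c i m • p i := by
  induction f using MvPolynomial.induction_on with
  | C a =>
    refine ⟨Unit, inferInstance, fun _ => C a, fun _ _ => 1, fun _ => continuous_const, ?_⟩
    intro m
    simp [linSubst]
  | add f g hf hg =>
    obtain ⟨ι, _, p, c, hc, h⟩ := hf
    obtain ⟨κ, _, q, d, hd, h'⟩ := hg
    refine ⟨ι ⊕ κ, inferInstance, Sum.elim p q, Sum.elim c d, ?_, ?_⟩
    · rintro (i | i)
      exacts [hc i, hd i]
    · intro m
      simp [h, h']
  | mul_X f i hf =>
    obtain ⟨ι, _, p, c, hc, h⟩ := hf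
    refine ⟨ι × Fin n, inferInstance, fun a => p a.1 * X a.2, fun a m => c a.1 m * m i a.2,
      fun a => (hc a.1).mul (by fun_prop), ?_⟩
    intro m
    rw [map_mul, h, Fintype.sum_prod_type, Finset.sum_mul]
    simp only [linSubst_X, Finset.mul_sum, MvPolynomial.smul_eq_C_mul, C_mul]
    refine Finset.sum_congr rfl fun a _ => Finset.sum_congr rfl fun b _ => ?_
    ring

theorem continuous_apply_linSubst (l : MvPolynomial (Fin n) ℝ →ₗ[ℝ] ℝ)
    (f : MvPolynomial (Fin n) ℝ) : Continuous fun m => l (linSubst m f) := by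
  obtain ⟨ι, _, p, c, hc, h⟩ := exists_linSubst_eq_sum f
  simp only [h, map_sum, map_smul, smul_eq_mul]
  exact continuous_finsetSum _ fun i _ => (hc i).mul continuous_const

theorem linSubst_mul (a b : Matrix (Fin n) (Fin n) ℝ) (f : MvPolynomial (Fin n) ℝ) :
    linSubst (a * b) f = linSubst b (linSubst a f) := by
  refine MvPolynomial.funext fun y => ?_
  simp [eval_linSubst, Matrix.mulVec_mulVec]

theorem linSubst_one (f : MvPolynomial (Fin n) ℝ) : linSubst 1 f = f := by
  refine MvPolynomial.funext fun y => ?_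
  simp [eval_linSubst]

section Group

variable {G : Type} [Group G] [TopologicalSpace G] [IsTopologicalGroup G] [CompactSpace G]
  [MeasurableSpace G] [BorelSpace G]

open MeasureTheory

theorem exists_average_s1 (μ : Measure G) [μ.IsHaarMeasure]
    (ρ : G →* Matrix (Fin n) (Fin n) ℝ) (hρ : Continuous ρ) (f : MvPolynomial (Fin n) ℝ) :
    ∃ a : MvPolynomial (Fin n) ℝ,
      (∀ l : MvPolynomial (Fin n) ℝ →ₗ[ℝ] ℝ, l a = ∫ k, l (linSubst (ρ k⁻¹) f) ∂μ) ∧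
        ∀ k y, eval ((ρ k).mulVec y) a = eval y a := by
  obtain ⟨ι, _, p, c, hc, h⟩ := exists_linSubst_eq_sum f
  have key : ∀ l : MvPolynomial (Fin n) ℝ →ₗ[ℝ] ℝ,
      l (∑ i, (∫ k, c i (ρ k⁻¹) ∂μ) • p i) = ∫ k, l (linSubst (ρ k⁻¹) f) ∂μ := by
    intro l
    simp only [h, map_sum, map_smul, smul_eq_mul]
    rw [integral_finsetSum]
    · simp only [integral_mul_const]
    · intro i _
      have : Continuous fun k : G => c i (ρ k⁻¹) * l (p i) :=
        ((hc i).comp (hρ.comp continuous_inv)).mul continuous_const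
      exact this.integrable_of_hasCompactSupport (HasCompactSupport.of_compactSpace _)
  refine ⟨_, key, fun k y => ?_⟩
  have e : ∀ z, eval z (∑ i, (∫ k, c i (ρ k⁻¹) ∂μ) • p i) =
      ∫ k, eval z (linSubst (ρ k⁻¹) f) ∂μ := fun z => key (aeval z).toLinearMap
  rw [e, e, ← integral_mul_left_eq_self _ k]
  refine integral_congr_ae (Filter.Eventually.of_forall fun l => ?_)
  simp only [eval_linSubst, Matrix.mulVec_mulVec, ← map_mul]
  simp

end Group

/-- The differential of a polynomial at a point. -/
def differential (y : Fin n → ℝ) :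
    MvPolynomial (Fin n) ℝ →ₗ[ℝ] Module.Dual ℝ (Fin n → ℝ) where
  toFun p := ∑ i, eval y (pderiv i p) • LinearMap.proj i
  map_add' p q := by simp [add_smul, Finset.sum_add_distrib]
  map_smul' a p := by simp [Finset.smul_sum, mul_smul, MvPolynomial.smul_eval]

theorem differential_apply (y : Fin n → ℝ) (p : MvPolynomial (Fin n) ℝ) (v : Fin n → ℝ) :
    differential y p v = ∑ i, eval y (pderiv i p) * v i := by
  simp [differential]

theorem differential_C (y : Fin n → ℝ) (a : ℝ) : differential y (C a) = 0 := by
  ext v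
  simp [differential_apply]

theorem differential_X (y v : Fin n → ℝ) (i : Fin n) : differential y (X i) v = v i := by
  simp [differential_apply, pderiv_X, Pi.single_apply]

theorem differential_mul (y : Fin n → ℝ) (p q : MvPolynomial (Fin n) ℝ) :
    differential y (p * q) = eval y p • differential y q + eval y q • differential y p := by
  refine LinearMap.ext fun v => ?_
  simp only [differential_apply, pderiv_mul, map_add, map_mul, LinearMap.add_apply,
    LinearMap.smul_apply, smul_eq_mul, Finset.mul_sum, ← Finset.sum_add_distrib]
  exact Finset.sum_congr rfl fun i _ => by ring

theorem differential_linSubst (y : Fin n → ℝ) (m : Matrix (Fin n) (Fin n) ℝ)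
    (p : MvPolynomial (Fin n) ℝ) (v : Fin n → ℝ) :
    differential y (linSubst m p) v = differential (m.mulVec y) p (m.mulVec v) := by
  induction p using MvPolynomial.induction_on with
  | C a => simp [linSubst, differential_C]
  | add p q hp hq => simp [hp, hq]
  | mul_X p i hp =>
    have hX : differential y (linSubst m (X i)) v = m.mulVec v i := by
      rw [linSubst_X, map_sum, LinearMap.sum_apply]
      refine Finset.sum_congr rfl fun j _ => ?_
      simp [differential_mul, differential_X, differential_C]
    simp [differential_mul, eval_linSubst, hp, hX, differential_X]

theorem hasDerivAt_eval_comp_s1 {γ : ℝ → Fin n → ℝ} {γ' : Fin n → ℝ} {t : ℝ}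
    (hγ : HasDerivAt γ γ' t) (p : MvPolynomial (Fin n) ℝ) :
    HasDerivAt (fun s => eval (γ s) p) (differential (γ t) p γ') t := by
  induction p using MvPolynomial.induction_on with
  | C a => simpa [differential_C] using hasDerivAt_const t a
  | add p q hp hq =>
    simp only [map_add, LinearMap.add_apply]
    exact hp.add hq
  | mul_X p i hp =>
    have := hp.mul (hasDerivAt_pi.1 hγ i)
    simp only [map_mul, eval_X, differential_mul, LinearMap.add_apply, LinearMap.smul_apply,
      smul_eq_mul, differential_X]
    rwa [add_comm, mul_comm (γ t i)]

/-- Derivative of a polynomial in a fixed direction. -/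
def dirDeriv (v : Fin n → ℝ) :
    Derivation ℝ (MvPolynomial (Fin n) ℝ) (MvPolynomial (Fin n) ℝ) :=
  mkDerivation ℝ fun i => C (v i)

theorem eval_dirDeriv (y v : Fin n → ℝ) (p : MvPolynomial (Fin n) ℝ) :
    eval y (dirDeriv v p) = differential y p v := by
  induction p using MvPolynomial.induction_on with
  | C a => simp [differential_C, dirDeriv]
  | add p q hp hq => simp [hp, hq]
  | mul_X p i hp =>
    have hX : dirDeriv v (X i) = C (v i) := by simp [dirDeriv]
    rw [Derivation.leibniz, differential_mul, hX]
    simp [hp, differential_X]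

/-- The maximal ideal of a point. -/
def pointIdeal (x : Fin n → ℝ) : Ideal (MvPolynomial (Fin n) ℝ) :=
  RingHom.ker (eval x)

theorem mem_pointIdeal {x : Fin n → ℝ} {p : MvPolynomial (Fin n) ℝ} :
    p ∈ pointIdeal x ↔ eval x p = 0 := Iff.rfl

/-- First-order Taylor expansion. -/
theorem sub_taylor_mem_pointIdeal_sq (x : Fin n → ℝ) (p : MvPolynomial (Fin n) ℝ) :
    p - C (eval x p) - ∑ i, C (eval x (pderiv i p)) * (X i - C (x i)) ∈ pointIdeal x ^ 2 := by
  have hτ : ∀ i, X i - C (x i) ∈ pointIdeal x := fun i => by simp [mem_pointIdeal]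
  induction p using MvPolynomial.induction_on with
  | C a => simp
  | add p q hp hq =>
    convert add_mem hp hq using 1
    simp only [map_add, add_mul, Finset.sum_add_distrib]
    ring
  | mul_X p i hp =>
    have h1 : (p - C (eval x p)) * (X i - C (x i)) ∈ pointIdeal x ^ 2 := by
      rw [pow_two]
      exact Ideal.mul_mem_mul (by simp [mem_pointIdeal]) (hτ i)
    have h2 := Ideal.mul_mem_left _ (C (x i)) hp
    convert add_mem h1 h2 using 1
    have : ∑ j, C (eval x (pderiv j (p * X i))) * (X j - C (x j)) =
        C (eval x p) * (X i - C (x i)) +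
          C (x i) * ∑ j, C (eval x (pderiv j p)) * (X j - C (x j)) := by
      have e : ∀ j, C (eval x (pderiv j (p * X i))) * (X j - C (x j)) =
          (if j = i then C (eval x p) * (X j - C (x j)) else 0) +
            C (x i) * (C (eval x (pderiv j p)) * (X j - C (x j))) := by
        intro j
        by_cases hj : j = i
        · subst hj
          simp
          ring
        · simp [hj, pderiv_X_of_ne (Ne.symm hj)]
          ring
      simp only [e, Finset.sum_add_distrib, Finset.mul_sum]
      simp
    rw [this]
    simp only [map_mul, eval_X]
    ring

theorem mem_of_succ_nsmul_mem {I : Ideal (MvPolynomial (Fin n) ℝ)} {k : ℕ}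
    {p : MvPolynomial (Fin n) ℝ} (h : (k + 1) • p ∈ I) : p ∈ I := by
  have h0 : ((k : ℝ) + 1) ≠ 0 := by positivity
  have := I.mul_mem_left (C ((k : ℝ) + 1)⁻¹) h
  rwa [← Nat.cast_smul_eq_nsmul ℝ, MvPolynomial.smul_eq_C_mul, ← mul_assoc, ← C_mul,
    Nat.cast_add, Nat.cast_one, inv_mul_cancel₀ h0, C_1, one_mul] at this

theorem nsmul_aeval_of_isHomogeneous {F : MvPolynomial (Fin n) ℝ} {N : ℕ} (hF : F.IsHomogeneous N)
    (a : Fin n → MvPolynomial (Fin n) ℝ) :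
    N • aeval a F = ∑ i, a i * aeval a (pderiv i F) := by
  have := congrArg (aeval a) hF.sum_X_mul_pderiv
  rw [map_nsmul] at this
  rw [← this, map_sum]
  simp only [map_mul, aeval_X]

theorem aeval_mem_pow_of_isHomogeneous {J : Ideal (MvPolynomial (Fin n) ℝ)}
    {a : Fin n → MvPolynomial (Fin n) ℝ} (ha : ∀ i, a i ∈ J) {N : ℕ}
    {F : MvPolynomial (Fin n) ℝ} (hF : F.IsHomogeneous N) : aeval a F ∈ J ^ N := by
  induction N generalizing F with
  | zero => simp
  | succ N ih =>
    refine mem_of_succ_nsmul_mem (k := N) ?_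
    rw [nsmul_aeval_of_isHomogeneous hF, pow_succ']
    exact sum_mem fun i _ => Ideal.mul_mem_mul (ha i) (ih (by simpa using hF.pderiv))

theorem aeval_sub_aeval_mem_of_isHomogeneous {J 𝔤 : Ideal (MvPolynomial (Fin n) ℝ)}
    {a b : Fin n → MvPolynomial (Fin n) ℝ} (ha : ∀ i, a i ∈ J) (hb : ∀ i, b i ∈ J)
    (hab : ∀ i, a i - b i ∈ 𝔤 ⊔ J ^ 2) {N : ℕ}
    {F : MvPolynomial (Fin n) ℝ} (hF : F.IsHomogeneous N) :
    aeval a F - aeval b F ∈ 𝔤 ⊔ J ^ (N + 1) := by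
  induction N generalizing F with
  | zero =>
    have := (totalDegree_zero_iff_isHomogeneous (p := F)).2 hF
    rw [totalDegree_eq_zero_iff_eq_C] at this
    rw [this]
    simp
  | succ N ih =>
    refine mem_of_succ_nsmul_mem (k := N) ?_
    rw [smul_sub, nsmul_aeval_of_isHomogeneous hF, nsmul_aeval_of_isHomogeneous hF,
      ← Finset.sum_sub_distrib]
    refine sum_mem fun i _ => ?_
    have hd : (pderiv i F).IsHomogeneous N := by simpa using hF.pderiv
    have e : a i * aeval a (pderiv i F) - b i * aeval b (pderiv i F) =
        (a i - b i) * aeval a (pderiv i F) +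
          b i * (aeval a (pderiv i F) - aeval b (pderiv i F)) := by ring
    rw [e]
    refine add_mem ?_ ?_
    · have h := Ideal.mul_mem_mul (hab i) (aeval_mem_pow_of_isHomogeneous ha hd)
      rw [Ideal.sup_mul, ← pow_add] at h
      rw [show 2 + N = N + 1 + 1 by omega] at h
      have hle : 𝔤 * J ^ N ⊔ J ^ (N + 1 + 1) ≤ 𝔤 ⊔ J ^ (N + 1 + 1) :=
        sup_le_sup_right Ideal.mul_le_left _
      exact hle h
    · have h := Ideal.mul_mem_mul (hb i) (ih hd)
      rw [Ideal.mul_sup, ← pow_succ'] at h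
      have hle : J * 𝔤 ⊔ J ^ (N + 1 + 1) ≤ 𝔤 ⊔ J ^ (N + 1 + 1) :=
        sup_le_sup_right Ideal.mul_le_right _
      exact hle h

theorem X_sub_C_mem_pointIdeal (x : Fin n → ℝ) (i : Fin n) : X i - C (x i) ∈ pointIdeal x := by
  simp [mem_pointIdeal]

/-- The leading homogeneous form of an element of a power of a maximal ideal. -/
theorem exists_isHomogeneous_sub_mem (x : Fin n → ℝ) {N : ℕ} {p : MvPolynomial (Fin n) ℝ}
    (hp : p ∈ pointIdeal x ^ N) :
    ∃ F : MvPolynomial (Fin n) ℝ, F.IsHomogeneous N ∧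
      p - aeval (fun i => X i - C (x i)) F ∈ pointIdeal x ^ (N + 1) := by
  induction N generalizing p with
  | zero =>
    refine ⟨C (eval x p), isHomogeneous_C _ _, ?_⟩
    simp [mem_pointIdeal, MvPolynomial.algebraMap_eq]
  | succ N ih =>
    rw [pow_succ'] at hp
    refine Submodule.mul_induction_on hp (fun m hm q hq => ?_) (fun p q hp hq => ?_)
    · obtain ⟨F, hF, hFq⟩ := ih hq
      have ht := sub_taylor_mem_pointIdeal_sq x m
      rw [mem_pointIdeal.1 hm, C_0, sub_zero] at ht
      refine ⟨(∑ i, C (eval x (pderiv i m)) * X i) * F, ?_, ?_⟩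
      · rw [add_comm N 1]
        refine IsHomogeneous.mul (IsHomogeneous.sum _ _ _ fun i _ => ?_) hF
        simpa using (isHomogeneous_C (Fin n) (eval x (pderiv i m))).mul (isHomogeneous_X ℝ i)
      · set L : MvPolynomial (Fin n) ℝ :=
          ∑ i, C (eval x (pderiv i m)) * (X i - C (x i)) with hL
        have e1 : aeval (fun i => X i - C (x i)) (∑ i, C (eval x (pderiv i m)) * X i) = L := by
          simp [hL, MvPolynomial.algebraMap_eq]
        rw [map_mul, e1]
        have e : m * q - L * aeval (fun i => X i - C (x i)) F =
            (m - L) * q + L * (q - aeval (fun i => X i - C (x i)) F) := by ring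
        rw [e]
        have hLm : L ∈ pointIdeal x :=
          sum_mem fun i _ => Ideal.mul_mem_left _ _ (X_sub_C_mem_pointIdeal x i)
        refine add_mem ?_ ?_
        · have h := Ideal.mul_mem_mul ht hq
          rwa [← pow_add, show 2 + N = N + 1 + 1 by omega] at h
        · have h := Ideal.mul_mem_mul hLm hFq
          rwa [← pow_succ'] at h
    · obtain ⟨F, hF, hFp⟩ := hp
      obtain ⟨G, hG, hGq⟩ := hq
      refine ⟨F + G, hF.add hG, ?_⟩
      convert add_mem hFp hGq using 1
      rw [map_add]
      ring

theorem derivation_mem_pow (D : Derivation ℝ (MvPolynomial (Fin n) ℝ) (MvPolynomial (Fin n) ℝ))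
    {J : Ideal (MvPolynomial (Fin n) ℝ)} {N : ℕ} {p : MvPolynomial (Fin n) ℝ}
    (hp : p ∈ J ^ (N + 1)) : D p ∈ J ^ N := by
  induction N generalizing p with
  | zero => simp
  | succ N ih =>
    rw [pow_succ'] at hp
    refine Submodule.mul_induction_on hp (fun m hm q hq => ?_) (fun p q hp hq => ?_)
    · rw [Derivation.leibniz, smul_eq_mul, smul_eq_mul]
      refine add_mem ?_ (Ideal.mul_mem_right _ _ hq)
      rw [pow_succ']
      exact Ideal.mul_mem_mul hm (ih hq)
    · rw [map_add]
      exact add_mem hp hq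

theorem derivation_iterate_mem
    (D : Derivation ℝ (MvPolynomial (Fin n) ℝ) (MvPolynomial (Fin n) ℝ))
    {J : Ideal (MvPolynomial (Fin n) ℝ)} {N : ℕ} {p : MvPolynomial (Fin n) ℝ}
    (hp : p ∈ J ^ (N + 1)) : D^[N] p ∈ J := by
  induction N generalizing p with
  | zero => simpa using hp
  | succ N ih => exact ih (derivation_mem_pow D hp)

theorem derivation_aeval (D : Derivation ℝ (MvPolynomial (Fin n) ℝ) (MvPolynomial (Fin n) ℝ))
    (a : Fin n → MvPolynomial (Fin n) ℝ) (F : MvPolynomial (Fin n) ℝ) :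
    D (aeval a F) = ∑ i, aeval a (pderiv i F) * D (a i) := by
  induction F using MvPolynomial.induction_on with
  | C c => simp [MvPolynomial.algebraMap_eq]
  | add p q hp hq => simp only [map_add, hp, hq, add_mul, Finset.sum_add_distrib]
  | mul_X p i hp =>
    have e : ∀ j, aeval a (pderiv j (p * X i)) * D (a j) =
        (if j = i then aeval a p * D (a j) else 0) +
          a i * (aeval a (pderiv j p) * D (a j)) := by
      intro j
      by_cases hj : j = i
      · subst hj
        simp
        ring
      · simp [hj, pderiv_X_of_ne (Ne.symm hj)]
        ring
    simp only [e, Finset.sum_add_distrib, ← Finset.mul_sum, ← hp]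
    simp

theorem eval_derivation_iterate_of_isHomogeneous
    (D : Derivation ℝ (MvPolynomial (Fin n) ℝ) (MvPolynomial (Fin n) ℝ)) (x : Fin n → ℝ)
    {N : ℕ} {F : MvPolynomial (Fin n) ℝ} (hF : F.IsHomogeneous N) :
    eval x (D^[N] (aeval (fun i => X i - C (x i)) F)) =
      N.factorial * eval (fun i => eval x (D (X i))) F := by
  induction N generalizing F with
  | zero =>
    have := (totalDegree_zero_iff_isHomogeneous (p := F)).2 hF
    rw [totalDegree_eq_zero_iff_eq_C] at this
    rw [this]
    simp [MvPolynomial.algebraMap_eq]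
  | succ N ih =>
    set w : Fin n → ℝ := fun i => eval x (D (X i)) with hw
    set τ : Fin n → MvPolynomial (Fin n) ℝ := fun i => X i - C (x i) with hτ
    have hτm : ∀ i, τ i ∈ pointIdeal x := X_sub_C_mem_pointIdeal x
    have hd : ∀ i, (pderiv i F).IsHomogeneous N := fun i => by simpa using hF.pderiv
    set F' : MvPolynomial (Fin n) ℝ := ∑ i, C (w i) * pderiv i F with hF'
    have hF'h : F'.IsHomogeneous N := by
      refine IsHomogeneous.sum _ _ _ fun i _ => ?_
      simpa using (isHomogeneous_C (Fin n) (w i)).mul (hd i)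
    have h1 : D (aeval τ F) - aeval τ F' ∈ pointIdeal x ^ (N + 1) := by
      rw [derivation_aeval, hF', map_sum, ← Finset.sum_sub_distrib]
      refine sum_mem fun i _ => ?_
      have e : aeval τ (pderiv i F) * D (τ i) - aeval τ (C (w i) * pderiv i F) =
          aeval τ (pderiv i F) * (D (X i) - C (w i)) := by
        simp [hτ, MvPolynomial.algebraMap_eq]
        ring
      rw [e, pow_succ]
      exact Ideal.mul_mem_mul (aeval_mem_pow_of_isHomogeneous hτm (hd i)) (by
        simp [mem_pointIdeal, hw])
    have h2 := mem_pointIdeal.1 (derivation_iterate_mem D h1)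
    rw [iterate_map_sub, map_sub, sub_eq_zero, ih hF'h] at h2
    rw [Function.iterate_succ_apply, h2]
    have h3 := congrArg (eval w) hF.sum_X_mul_pderiv
    have h4 : eval w F' = (N + 1 : ℕ) * eval w F := by
      rw [← nsmul_eq_mul, ← map_nsmul, ← h3, hF']
      simp
    rw [h4, Nat.factorial_succ]
    push_cast
    ring

/-- The span of the differentials at `y` of the elements of an ideal. -/
def conormal (I : Ideal (MvPolynomial (Fin n) ℝ)) (y : Fin n → ℝ) :
    Submodule ℝ (Module.Dual ℝ (Fin n → ℝ)) :=
  (I.restrictScalars ℝ).map (differential y)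

theorem differential_mem_conormal {I : Ideal (MvPolynomial (Fin n) ℝ)} {y : Fin n → ℝ}
    {f : MvPolynomial (Fin n) ℝ} (hf : f ∈ I) : differential y f ∈ conormal I y :=
  Submodule.mem_map_of_mem (p := I.restrictScalars ℝ) hf

theorem nonempty_basis_submodule {V : Type} [AddCommGroup V] [Module ℝ V] [FiniteDimensional ℝ V]
    (W : Submodule ℝ V) : Nonempty (Module.Basis (Fin (Module.finrank ℝ W)) ℝ W) :=
  ⟨Module.finBasis ℝ W⟩

theorem exists_dual_frame (I : Ideal (MvPolynomial (Fin n) ℝ)) (x : Fin n → ℝ) :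
    ∃ (g : Fin (Module.finrank ℝ (conormal I x)) → MvPolynomial (Fin n) ℝ)
      (e : Fin (Module.finrank ℝ (conormal I x)) → Fin n → ℝ),
      (∀ i, g i ∈ I) ∧ ∀ i j, differential x (g i) (e j) = if i = j then 1 else 0 := by
  obtain ⟨b⟩ := nonempty_basis_submodule (conormal I x)
  have hg : ∀ i, ∃ g ∈ I, differential x g = b i := fun i => (b i).2
  choose g hgI hg using hg
  have he : ∀ j, ∃ e : Fin n → ℝ, ∀ φ : conormal I x, (φ : Module.Dual ℝ _) e = b.coord j φ := by
    intro j
    obtain ⟨ψ, hψ⟩ := LinearMap.exists_extend (b.coord j)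
    obtain ⟨e, rfl⟩ := (Module.evalEquiv ℝ (Fin n → ℝ)).surjective ψ
    exact ⟨e, fun φ => LinearMap.congr_fun hψ φ⟩
  choose e he using he
  refine ⟨g, e, hgI, fun i j => ?_⟩
  rw [hg, he]
  simp [Finsupp.single_apply]

/-- Where the frame stays transverse, the differentials of its functions span the conormal space. -/
theorem differential_eq_zero_of_frame {I : Ideal (MvPolynomial (Fin n) ℝ)} {y : Fin n → ℝ} {c : ℕ}
    {g : Fin c → MvPolynomial (Fin n) ℝ} {e : Fin c → Fin n → ℝ} (hg : ∀ i, g i ∈ I)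
    (hdet : (Matrix.of fun i j => differential y (g i) (e j)).det ≠ 0)
    (hc : Module.finrank ℝ (conormal I y) ≤ c) {w : Fin n → ℝ}
    (hw : ∀ i, differential y (g i) w = 0) {f : MvPolynomial (Fin n) ℝ} (hf : f ∈ I) :
    differential y f w = 0 := by
  have hli : LinearIndependent ℝ fun i => differential y (g i) := by
    rw [Fintype.linearIndependent_iff]
    intro a ha
    have : a = 0 := by
      refine Matrix.eq_zero_of_vecMul_eq_zero hdet (funext fun j => ?_)
      have := LinearMap.congr_fun ha (e j)
      simpa [Matrix.vecMul, dotProduct] using this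
    exact congrFun this
  have hle : Submodule.span ℝ (Set.range fun i => differential y (g i)) ≤ conormal I y := by
    rw [Submodule.span_le]
    rintro _ ⟨i, rfl⟩
    exact differential_mem_conormal (hg i)
  have heq := Submodule.eq_of_le_of_finrank_le hle (by
    rw [finrank_span_eq_card hli]; simpa using hc)
  have hfm := differential_mem_conormal (y := y) hf
  rw [← heq] at hfm
  have hker : Submodule.span ℝ (Set.range fun i => differential y (g i)) ≤
      LinearMap.ker (Module.Dual.eval ℝ (Fin n → ℝ) w) := by
    rw [Submodule.span_le]
    rintro _ ⟨i, rfl⟩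
    exact hw i
  exact hker hfm

/-- A derivation tangent to the level sets of the frame, hence preserving the ideal. -/
theorem exists_tangent_derivation {I : Ideal (MvPolynomial (Fin n) ℝ)} {S : Set (Fin n → ℝ)}
    (hI : ∀ p, p ∈ I ↔ ∀ y ∈ S, eval y p = 0) {x : Fin n → ℝ} {c : ℕ}
    (hc : ∀ y ∈ S, Module.finrank ℝ (conormal I y) ≤ c)
    {g : Fin c → MvPolynomial (Fin n) ℝ} {e : Fin c → Fin n → ℝ} (hg : ∀ i, g i ∈ I)
    (hge : ∀ i j, differential x (g i) (e j) = if i = j then 1 else 0) (v : Fin n → ℝ) :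
    ∃ D : Derivation ℝ (MvPolynomial (Fin n) ℝ) (MvPolynomial (Fin n) ℝ),
      (∀ f ∈ I, D f ∈ I) ∧
        ∀ f, eval x (D f) = differential x f (v - ∑ i, differential x (g i) v • e i) := by
  set M : Matrix (Fin c) (Fin c) (MvPolynomial (Fin n) ℝ) :=
    Matrix.of fun i j => dirDeriv (e j) (g i) with hM
  set D : Derivation ℝ (MvPolynomial (Fin n) ℝ) (MvPolynomial (Fin n) ℝ) :=
    M.det • (M.det • dirDeriv v -
      ∑ i, (∑ j, M.adjugate i j * dirDeriv v (g j)) • dirDeriv (e i)) with hD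
  have hDf : ∀ f, D f = M.det * (M.det * dirDeriv v f -
      ∑ i, (∑ j, M.adjugate i j * dirDeriv v (g j)) * dirDeriv (e i) f) := by
    intro f
    have : ∀ (s : Finset (Fin c)) (a : Fin c → MvPolynomial (Fin n) ℝ),
        (∑ i ∈ s, a i • dirDeriv (e i)) f = ∑ i ∈ s, a i * dirDeriv (e i) f := by
      intro s a
      induction s using Finset.induction_on with
      | empty => simp
      | insert i s hi ih => simp [Finset.sum_insert hi, ih]
    simp [hD, this]
  have hMy : ∀ y, M.map (eval y) = Matrix.of fun i j => differential y (g i) (e j) := by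
    intro y
    ext i j
    simp [hM, eval_dirDeriv]
  have hdety : ∀ y, eval y M.det = (Matrix.of fun i j => differential y (g i) (e j)).det := by
    intro y
    rw [← hMy, RingHom.map_det]
    rfl
  set w : (Fin n → ℝ) → Fin n → ℝ := fun y => eval y M.det • v -
    ∑ i, (∑ j, eval y (M.adjugate i j) * differential y (g j) v) • e i with hw
  have hDy : ∀ y f, eval y (D f) = eval y M.det * differential y f (w y) := by
    intro y f
    rw [hDf, map_mul, hw]
    simp only [map_sub, map_mul, map_sum, eval_dirDeriv, LinearMap.map_smul, smul_eq_mul]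
  refine ⟨D, fun f hf => ?_, fun f => ?_⟩
  · rw [hI]
    intro y hy
    rw [hDy]
    by_cases h0 : eval y M.det = 0
    · rw [h0, zero_mul]
    · refine mul_eq_zero_of_right _
        (differential_eq_zero_of_frame hg (hdety y ▸ h0) (hc y hy) (fun l => ?_) hf)
      have hadj := congrArg (fun A => A.map (eval y)) (Matrix.mul_adjugate M)
      have hadj' : ∀ j, ∑ i, differential y (g l) (e i) * eval y (M.adjugate i j) =
          if l = j then eval y M.det else 0 := by
        intro j
        have := congrFun (congrFun hadj l) j
        simp only [Matrix.map_apply, Matrix.mul_apply, map_sum, map_mul, Matrix.smul_apply,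
          Matrix.one_apply, hM, Matrix.of_apply, eval_dirDeriv, smul_eq_mul] at this
        rw [this]
        split_ifs <;> simp [hM]
      have : ∑ i, (∑ j, eval y (M.adjugate i j) * differential y (g j) v) *
          differential y (g l) (e i) = eval y M.det * differential y (g l) v := by
        simp only [Finset.sum_mul]
        rw [Finset.sum_comm]
        calc _ = ∑ j, (∑ i, differential y (g l) (e i) * eval y (M.adjugate i j)) *
              differential y (g j) v := by
              refine Finset.sum_congr rfl fun j _ => ?_
              rw [Finset.sum_mul]
              exact Finset.sum_congr rfl fun i _ => by ring
          _ = _ := by simp [hadj']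
      simp [hw, this]
  · rw [hDy]
    have h1 : M.map (eval x) = 1 := by
      rw [hMy]
      ext i j
      simp [hge, Matrix.one_apply]
    have hdet : eval x M.det = 1 := by
      rw [RingHom.map_det, RingHom.mapMatrix_apply, h1, Matrix.det_one]
    have hadj : ∀ i j, eval x (M.adjugate i j) = if i = j then 1 else 0 := by
      intro i j
      have := congrFun (congrFun (RingHom.map_adjugate (eval x) M) i) j
      rw [RingHom.mapMatrix_apply, RingHom.mapMatrix_apply, h1, Matrix.adjugate_one] at this
      simpa [Matrix.one_apply] using this
    simp [hw, hdet, hadj]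

/-- An ideal with constant conormal rank along its zero set is generated, to every order at a
point, by functions whose differentials form a basis of the conormal space. -/
theorem le_span_sup_pow {I : Ideal (MvPolynomial (Fin n) ℝ)} {S : Set (Fin n → ℝ)}
    (hI : ∀ p, p ∈ I ↔ ∀ y ∈ S, eval y p = 0) {x : Fin n → ℝ} (hx : x ∈ S) {c : ℕ}
    (hc : ∀ y ∈ S, Module.finrank ℝ (conormal I y) ≤ c)
    {g : Fin c → MvPolynomial (Fin n) ℝ} {e : Fin c → Fin n → ℝ} (hg : ∀ i, g i ∈ I)
    (hge : ∀ i j, differential x (g i) (e j) = if i = j then 1 else 0) (N : ℕ) :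
    I ≤ Ideal.span (Set.range g) ⊔ pointIdeal x ^ N := by
  induction N with
  | zero => simp
  | succ N ih =>
    intro f hf
    have h𝔤I : Ideal.span (Set.range g) ≤ I := by
      rw [Ideal.span_le]
      rintro _ ⟨i, rfl⟩
      exact hg i
    obtain ⟨g', hg', h, hh, rfl⟩ := Submodule.mem_sup.1 (ih hf)
    have hhI : h ∈ I := (Submodule.add_mem_iff_right _ (h𝔤I hg')).1 hf
    obtain ⟨F, hF, hFh⟩ := exists_isHomogeneous_sub_mem x hh
    set τ : Fin n → MvPolynomial (Fin n) ℝ := fun i => X i - C (x i) with hτ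
    have hFv : ∀ v : Fin n → ℝ, eval (v - ∑ i, differential x (g i) v • e i) F = 0 := by
      intro v
      obtain ⟨D, hDI, hDx⟩ := exists_tangent_derivation hI hc hg hge v
      have hDN : D^[N] h ∈ I := by
        have : ∀ k, D^[k] h ∈ I := by
          intro k
          induction k with
          | zero => exact hhI
          | succ k ihk => rw [Function.iterate_succ_apply']; exact hDI _ ihk
        exact this N
      have h1 := mem_pointIdeal.1 (derivation_iterate_mem D hFh)
      rw [iterate_map_sub, map_sub, (hI _).1 hDN x hx, zero_sub, neg_eq_zero,
        eval_derivation_iterate_of_isHomogeneous D x hF] at h1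
      have h2 := (mul_eq_zero.1 h1).resolve_left (by positivity)
      convert h2 using 3
      funext i
      rw [hDx, differential_X]
    set L : Fin c → MvPolynomial (Fin n) ℝ :=
      fun j => ∑ k, C (eval x (pderiv k (g j))) * τ k with hL
    set b : Fin n → MvPolynomial (Fin n) ℝ := fun i => τ i - ∑ j, C (e j i) * L j with hb
    have hτm : ∀ i, τ i ∈ pointIdeal x := X_sub_C_mem_pointIdeal x
    have hLm : ∀ j, L j ∈ pointIdeal x := fun j =>
      sum_mem fun k _ => Ideal.mul_mem_left _ _ (hτm k)
    have hbm : ∀ i, b i ∈ pointIdeal x := fun i =>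
      sub_mem (hτm i) (sum_mem fun j _ => Ideal.mul_mem_left _ _ (hLm j))
    have hL𝔤 : ∀ j, L j ∈ Ideal.span (Set.range g) ⊔ pointIdeal x ^ 2 := by
      intro j
      have ht := sub_taylor_mem_pointIdeal_sq x (g j)
      rw [(hI _).1 (hg j) x hx, C_0, sub_zero] at ht
      have : L j = g j - (g j - L j) := by ring
      rw [this]
      exact sub_mem (Ideal.mem_sup_left (Ideal.subset_span ⟨j, rfl⟩)) (Ideal.mem_sup_right ht)
    have hab : ∀ i, τ i - b i ∈ Ideal.span (Set.range g) ⊔ pointIdeal x ^ 2 := by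
      intro i
      rw [hb, sub_sub_cancel]
      exact sum_mem fun j _ => Ideal.mul_mem_left _ _ (hL𝔤 j)
    have hbF : aeval b F = 0 := by
      refine MvPolynomial.funext fun y => ?_
      have e1 : eval y (aeval b F) = eval (fun i => eval y (b i)) F := by
        have : (eval y).comp (aeval b : _ →ₐ[ℝ] MvPolynomial (Fin n) ℝ).toRingHom =
            eval fun i => eval y (b i) := by
          ext i <;> simp
        exact RingHom.congr_fun this F
      rw [e1, map_zero, ← hFv (y - x)]
      congr 2
      funext i
      simp [hb, hL, hτ, differential_apply, mul_comm]
    have h1 := aeval_sub_aeval_mem_of_isHomogeneous hτm hbm hab hF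
    rw [hbF, sub_zero] at h1
    have h2 : h = (h - aeval τ F) + aeval τ F := by ring
    rw [h2]
    exact add_mem (Ideal.mem_sup_left hg') (add_mem (Ideal.mem_sup_right hFh) h1)

theorem mem_mul_of_differential_eq_zero {I : Ideal (MvPolynomial (Fin n) ℝ)}
    {S : Set (Fin n → ℝ)} (hI : ∀ p, p ∈ I ↔ ∀ y ∈ S, eval y p = 0) {x : Fin n → ℝ} (hx : x ∈ S)
    (hc : ∀ y ∈ S, Module.finrank ℝ (conormal I y) ≤ Module.finrank ℝ (conormal I x))
    {f : MvPolynomial (Fin n) ℝ} (hf : f ∈ I) (hdf : differential x f = 0) :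
    f ∈ pointIdeal x * I := by
  obtain ⟨g, e, hg, hge⟩ := exists_dual_frame I x
  set 𝔤 := Ideal.span (Set.range g) with h𝔤
  have hmem : (Ideal.Quotient.mk 𝔤 f) ∈
      (⨅ i : ℕ, pointIdeal x ^ i • ⊤ : Submodule (MvPolynomial (Fin n) ℝ) (_ ⧸ 𝔤)) := by
    rw [Submodule.mem_iInf]
    intro i
    obtain ⟨g', hg', h, hh, rfl⟩ :=
      Submodule.mem_sup.1 (le_span_sup_pow hI hx hc hg hge i hf)
    rw [map_add, Ideal.Quotient.eq_zero_iff_mem.2 hg', zero_add]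
    have : Ideal.Quotient.mk 𝔤 h = h • (1 : _ ⧸ 𝔤) := by
      conv_lhs => rw [← mul_one h]
      rfl
    rw [this]
    exact Submodule.smul_mem_smul hh trivial
  obtain ⟨⟨r, hr⟩, hrf⟩ := (Ideal.mem_iInf_smul_pow_eq_bot_iff _ _).1 hmem
  have hrf' : f - r * f ∈ 𝔤 := by
    rw [← Ideal.Quotient.eq_zero_iff_mem, map_sub, sub_eq_zero]
    exact hrf.symm
  obtain ⟨u, hu⟩ := Ideal.mem_span_range_iff_exists_fun.1 hrf'
  have hgx : ∀ i, eval x (g i) = 0 := fun i => (hI _).1 (hg i) x hx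
  have hux : ∀ j, u j ∈ pointIdeal x := by
    intro j
    have h1 : differential x (f - r * f) (e j) = 0 := by
      simp [differential_mul, hdf, (hI f).1 hf x hx]
    rw [← hu, map_sum, LinearMap.sum_apply] at h1
    simpa [differential_mul, hgx, hge, mem_pointIdeal] using h1
  have h2 : f = ∑ i, u i * g i + r * f := by rw [hu]; ring
  rw [h2]
  exact add_mem (sum_mem fun i _ => Ideal.mul_mem_mul (hux i) (hg i)) (Ideal.mul_mem_mul hr hf)

theorem differential_mulVec_eq_zero {K : Set (Matrix (Fin n) (Fin n) ℝ)} {x : Fin n → ℝ}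
    {A : Matrix (Fin n) (Fin n) ℝ} (hA : A ∈ lieAlgebra ℝ n K) {u : MvPolynomial (Fin n) ℝ}
    (hu : u ∈ vanishingIdeal ℝ n (orbit ℝ n K x)) : differential x u (A.mulVec x) = 0 := by
  let _ : NormedRing (Matrix (Fin n) (Fin n) ℝ) := Matrix.linftyOpNormedRing
  let _ : NormedAlgebra ℝ (Matrix (Fin n) (Fin n) ℝ) := Matrix.linftyOpNormedAlgebra
  have hexp : ∀ t : ℝ, NormedSpace.exp (t • A) = mexp ℝ n (t • A) := fun t => by
    rw [NormedSpace.exp_eq_tsum ℝ]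
    rfl
  have h1 : HasDerivAt (fun t : ℝ => NormedSpace.exp (t • A)) A 0 := by
    have h := hasDerivAt_exp_smul_const A (0 : ℝ)
    simp only [zero_smul, NormedSpace.exp_zero, one_mul] at h
    exact h
  let φ : Matrix (Fin n) (Fin n) ℝ →L[ℝ] Fin n → ℝ :=
    LinearMap.toContinuousLinearMap
      { toFun := fun M => M.mulVec x
        map_add' := fun M N => Matrix.add_mulVec M N x
        map_smul' := fun c M => Matrix.smul_mulVec c M x }
  have h2 : HasDerivAt (fun t : ℝ => (NormedSpace.exp (t • A)).mulVec x) (A.mulVec x) 0 :=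
    φ.hasFDerivAt.comp_hasDerivAt 0 h1
  have h3 := hasDerivAt_eval_comp_s1 h2 u
  have h4 : (fun t : ℝ => eval ((NormedSpace.exp (t • A)).mulVec x) u) = fun _ => 0 := by
    funext t
    exact hu _ ⟨_, hexp t ▸ hA t, rfl⟩
  rw [h4] at h3
  simpa using h3.unique (hasDerivAt_const (0 : ℝ) (0 : ℝ))

theorem differential_eq_zero_of_mem_orbitTangent {K : Set (Matrix (Fin n) (Fin n) ℝ)}
    {x : Fin n → ℝ} {u : MvPolynomial (Fin n) ℝ} (hu : u ∈ vanishingIdeal ℝ n (orbit ℝ n K x))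
    {v : Fin n → ℝ} (hv : v ∈ orbitTangent ℝ n K x) : differential x u v = 0 := by
  have hle : orbitTangent ℝ n K x ≤ LinearMap.ker (differential x u) := by
    refine Submodule.span_le.2 ?_
    rintro _ ⟨A, hA, rfl⟩
    exact differential_mulVec_eq_zero hA hu
  exact hle hv

theorem finrank_le_of_map_le {V : Type} [AddCommGroup V] [Module ℝ V] [FiniteDimensional ℝ V]
    {W W' : Submodule ℝ V} {φ : V →ₗ[ℝ] V} (hφ : Function.Injective φ) (h : W.map φ ≤ W') :
    Module.finrank ℝ W ≤ Module.finrank ℝ W' := by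
  rw [(Submodule.equivMapOfInjective φ hφ W).finrank_eq]
  exact Submodule.finrank_mono h

section Orbit

variable {G : Type} [Group G] (ρ : G →* Matrix (Fin n) (Fin n) ℝ) (x : Fin n → ℝ)

theorem mem_orbit_range (k : G) : (ρ k).mulVec x ∈ orbit ℝ n (Set.range ρ) x :=
  ⟨ρ k, ⟨k, rfl⟩, rfl⟩

theorem self_mem_orbit_range : x ∈ orbit ℝ n (Set.range ρ) x := by
  simpa using mem_orbit_range ρ x 1

variable {x}

theorem linSubst_mem_vanishingIdeal {f : MvPolynomial (Fin n) ℝ}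
    (hf : f ∈ vanishingIdeal ℝ n (orbit ℝ n (Set.range ρ) x)) (k : G) :
    linSubst (ρ k) f ∈ vanishingIdeal ℝ n (orbit ℝ n (Set.range ρ) x) := by
  rintro _ ⟨_, ⟨l, rfl⟩, rfl⟩
  rw [eval_linSubst, Matrix.mulVec_mulVec, ← map_mul]
  exact hf _ (mem_orbit_range ρ x _)

theorem finrank_conormal_le {y : Fin n → ℝ} (hy : y ∈ orbit ℝ n (Set.range ρ) x) :
    Module.finrank ℝ (conormal (vanishingIdeal ℝ n (orbit ℝ n (Set.range ρ) x)) y) ≤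
      Module.finrank ℝ (conormal (vanishingIdeal ℝ n (orbit ℝ n (Set.range ρ) x)) x) := by
  obtain ⟨_, ⟨k, rfl⟩, rfl⟩ := hy
  refine finrank_le_of_map_le (φ := (Matrix.mulVecLin (ρ k)).dualMap) ?_ ?_
  · intro φ ψ h
    refine LinearMap.ext fun v => ?_
    have := LinearMap.congr_fun h ((ρ k⁻¹).mulVec v)
    simpa [LinearMap.dualMap_apply, Matrix.mulVec_mulVec, ← map_mul] using this
  · rintro _ ⟨_, ⟨f, hf, rfl⟩, rfl⟩
    have : (Matrix.mulVecLin (ρ k)).dualMap (differential ((ρ k).mulVec x) f) =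
        differential x (linSubst (ρ k) f) :=
      LinearMap.ext fun v => (differential_linSubst x (ρ k) f v).symm
    rw [show (fun g : Matrix (Fin n) (Fin n) ℝ => g.mulVec x) (ρ k) = (ρ k).mulVec x from rfl,
      this]
    exact differential_mem_conormal (linSubst_mem_vanishingIdeal ρ hf k)

theorem linSubst_sub_mem {N : Submodule ℝ (Fin n → ℝ)}
    (hN : IsCompl (orbitTangent ℝ n (Set.range ρ) x) N) {h h' : G} (hx : (ρ h).mulVec x = x)
    (hx' : (ρ h').mulVec x = x) (heq : ∀ v ∈ N, (ρ h).mulVec v = (ρ h').mulVec v)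
    {u : MvPolynomial (Fin n) ℝ} (hu : u ∈ vanishingIdeal ℝ n (orbit ℝ n (Set.range ρ) x)) :
    linSubst (ρ h) u - linSubst (ρ h') u ∈
      pointIdeal x * vanishingIdeal ℝ n (orbit ℝ n (Set.range ρ) x) := by
  have h1 := linSubst_mem_vanishingIdeal ρ hu h
  have h2 := linSubst_mem_vanishingIdeal ρ hu h'
  refine mem_mul_of_differential_eq_zero (S := orbit ℝ n (Set.range ρ) x) (fun p => Iff.rfl)
    (self_mem_orbit_range ρ x) (fun y hy => finrank_conormal_le ρ hy) (sub_mem h1 h2)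
    (LinearMap.ext fun v => ?_)
  obtain ⟨t, ht, w, hw, rfl⟩ :=
    Submodule.mem_sup.1 (hN.sup_eq_top ▸ Submodule.mem_top : v ∈ _ ⊔ N)
  have h3 : differential x (linSubst (ρ h) u) w = differential x (linSubst (ρ h') u) w := by
    rw [differential_linSubst, differential_linSubst, hx, hx', heq w hw]
  simp [differential_eq_zero_of_mem_orbitTangent h1 ht,
    differential_eq_zero_of_mem_orbitTangent h2 ht, h3]

theorem linSubst_mem_vanishingIdeal_pow {j : ℕ} {f : MvPolynomial (Fin n) ℝ}
    (hf : f ∈ vanishingIdeal ℝ n (orbit ℝ n (Set.range ρ) x) ^ j) (k : G) :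
    linSubst (ρ k) f ∈ vanishingIdeal ℝ n (orbit ℝ n (Set.range ρ) x) ^ j := by
  have h : vanishingIdeal ℝ n (orbit ℝ n (Set.range ρ) x) ≤
      (vanishingIdeal ℝ n (orbit ℝ n (Set.range ρ) x)).comap (linSubst (ρ k)) :=
    fun f hf => linSubst_mem_vanishingIdeal ρ hf k
  exact Ideal.le_comap_pow _ j (Ideal.pow_right_mono h j hf)

theorem linSubst_pow_sub_mem {N : Submodule ℝ (Fin n → ℝ)}
    (hN : IsCompl (orbitTangent ℝ n (Set.range ρ) x) N) {h h' : G} (hx : (ρ h).mulVec x = x)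
    (hx' : (ρ h').mulVec x = x) (heq : ∀ v ∈ N, (ρ h).mulVec v = (ρ h').mulVec v) (j : ℕ)
    {g : MvPolynomial (Fin n) ℝ}
    (hg : g ∈ vanishingIdeal ℝ n (orbit ℝ n (Set.range ρ) x) ^ (j + 1)) :
    linSubst (ρ h) g - linSubst (ρ h') g ∈
      pointIdeal x * vanishingIdeal ℝ n (orbit ℝ n (Set.range ρ) x) ^ (j + 1) := by
  induction j generalizing g with
  | zero =>
    rw [zero_add, pow_one] at hg ⊢
    exact linSubst_sub_mem ρ hN hx hx' heq hg
  | succ j ih =>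
    rw [pow_succ'] at hg
    refine Submodule.mul_induction_on hg (fun a ha b hb => ?_) (fun p q hp hq => ?_)
    · have e : linSubst (ρ h) (a * b) - linSubst (ρ h') (a * b) =
          (linSubst (ρ h) a - linSubst (ρ h') a) * linSubst (ρ h) b +
            linSubst (ρ h') a * (linSubst (ρ h) b - linSubst (ρ h') b) := by
        simp only [map_mul]
        ring
      rw [e, pow_succ']
      refine add_mem ?_ ?_
      · rw [← mul_assoc]
        exact Ideal.mul_mem_mul (linSubst_sub_mem ρ hN hx hx' heq ha)
          (linSubst_mem_vanishingIdeal_pow ρ hb h)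
      · rw [mul_left_comm]
        exact Ideal.mul_mem_mul (linSubst_mem_vanishingIdeal ρ ha h') (ih hb)
    · simp only [map_add]
      convert add_mem hp hq using 1
      ring

end Orbit

open MeasureTheory in
/-- Polynomials in a continuous vector-valued function on a compact space are dense among the
continuous functions factoring through it. -/
theorem eq_zero_of_integral_eval_mul_eq_zero {G : Type} [TopologicalSpace G] [CompactSpace G]
    [MeasurableSpace G] [BorelSpace G] (μ : Measure G) [IsFiniteMeasure μ] [μ.IsOpenPosMeasure]
    {q : G → Fin n → ℝ} (hq : Continuous q) {θ : G → ℝ} (hθ : Continuous θ)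
    (hfac : ∀ k l, q k = q l → θ k = θ l)
    (h0 : ∀ p : MvPolynomial (Fin n) ℝ, ∫ k, eval (q k) p * θ k ∂μ = 0) (k₀ : G) :
    θ k₀ = 0 := by
  by_contra hne
  have hint : ∀ f : G → ℝ, Continuous f → Integrable f μ := fun f hf =>
    hf.integrable_of_hasCompactSupport (HasCompactSupport.of_compactSpace _)
  have hcpos : 0 < ∫ k, θ k * θ k ∂μ :=
    Continuous.integral_pos_of_hasCompactSupport_nonneg_nonzero (hθ.mul hθ)
      (HasCompactSupport.of_compactSpace _) (fun k => mul_self_nonneg _)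
      (mul_self_ne_zero.2 hne)
  have hθ2 : Continuous fun k => θ k * θ k := hθ.mul hθ
  set c := ∫ k, θ k * θ k ∂μ with hc
  have hd : 0 ≤ ∫ k, |θ k| ∂μ := integral_nonneg fun k => abs_nonneg _
  set d := ∫ k, |θ k| ∂μ with hd'
  let O := Set.range q
  have : CompactSpace O := isCompact_iff_compactSpace.1 (isCompact_range hq)
  let q' : C(G, O) := ⟨Set.rangeFactorization q, hq.subtype_mk _⟩
  have hquot : Topology.IsQuotientMap q' :=
    q'.continuous.isClosedMap.isQuotientMap q'.continuous Set.rangeFactorization_surjective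
  have hfac' : Function.FactorsThrough (⟨θ, hθ⟩ : C(G, ℝ)) q' :=
    fun k l h => hfac k l (congrArg Subtype.val h)
  let φ : C(O, ℝ) := hquot.lift ⟨θ, hθ⟩ hfac'
  have hφ : ∀ k, φ (q' k) = θ k := fun k =>
    DFunLike.congr_fun (hquot.lift_comp ⟨θ, hθ⟩ hfac') k
  let Φ : MvPolynomial (Fin n) ℝ →ₐ[ℝ] C(O, ℝ) :=
    aeval fun i => ⟨fun y => (y : Fin n → ℝ) i, (continuous_apply i).comp continuous_subtype_val⟩
  have hΦ : ∀ p (y : O), Φ p y = eval (y : Fin n → ℝ) p := by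
    intro p y
    induction p using MvPolynomial.induction_on with
    | C a => simp [Φ]
    | add p q hp hq => simp [hp, hq]
    | mul_X p i hp => rw [map_mul, ContinuousMap.mul_apply, hp]; simp [Φ]
  have hsep : Φ.range.SeparatesPoints := by
    intro y z hyz
    obtain ⟨i, hi⟩ : ∃ i, (y : Fin n → ℝ) i ≠ (z : Fin n → ℝ) i := by
      by_contra! h
      exact hyz (Subtype.ext (funext h))
    exact ⟨_, ⟨Φ (X i), ⟨X i, rfl⟩, rfl⟩, by simpa [hΦ] using hi⟩
  obtain ⟨⟨_, p, rfl⟩, hp⟩ :=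
    ContinuousMap.exists_mem_subalgebra_near_continuousMap_of_separatesPoints _ hsep φ
      (c / (d + 1)) (by positivity)
  have hclose : ∀ k, |eval (q k) p - θ k| ≤ c / (d + 1) := by
    intro k
    have h1 := (Φ p - φ).norm_coe_le_norm (q' k)
    rw [ContinuousMap.sub_apply, hφ, hΦ] at h1
    exact h1.trans hp.le
  have hpc : Continuous fun k => eval (q k) p * θ k := by
    refine Continuous.mul ?_ hθ
    have := (Φ p).continuous.comp q'.continuous
    convert this using 1
    funext k
    exact (hΦ p (q' k)).symm
  have h1 : c ≤ c / (d + 1) * d := by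
    calc c = ∫ k, (θ k * θ k - eval (q k) p * θ k) ∂μ := by
          rw [integral_sub (hint _ hθ2) (hint _ hpc), h0 p, sub_zero]
      _ ≤ ∫ k, c / (d + 1) * |θ k| ∂μ := by
          refine integral_mono (hint _ (hθ2.sub hpc))
            (hint _ (continuous_const.mul hθ.abs)) fun k => ?_
          calc θ k * θ k - eval (q k) p * θ k = -((eval (q k) p - θ k) * θ k) := by ring
            _ ≤ |(eval (q k) p - θ k) * θ k| := neg_le_abs _
            _ = |eval (q k) p - θ k| * |θ k| := abs_mul _ _
            _ ≤ _ := mul_le_mul_of_nonneg_right (hclose k) (abs_nonneg _)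
      _ = c / (d + 1) * d := integral_const_mul _ _
  have h2 : c / (d + 1) * d < c := by
    rw [div_mul_eq_mul_div, div_lt_iff₀ (by positivity)]
    nlinarith
  linarith

section Averaging

variable {G : Type} [Group G] (ρ : G →* Matrix (Fin n) (Fin n) ℝ) {x : Fin n → ℝ}

/-- Translates of `f` averaged over finite coset representatives of the isotropy group. -/
theorem sum_linSubst_mem [TopologicalSpace G] [IsTopologicalGroup G] [CompactSpace G]
    (hρ : Continuous ρ) {N : Submodule ℝ (Fin n → ℝ)}
    (hN : IsCompl (orbitTangent ℝ n (Set.range ρ) x) N) {ι : Type} [Fintype ι] {s : ι → G}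
    (hs : ∀ i, (ρ (s i)).mulVec x = x)
    (hperm : ∀ h, (ρ h).mulVec x = x → ∃ σ : Equiv.Perm ι,
      ∀ i, ∀ v ∈ N, (ρ (s i * h)⁻¹).mulVec v = (ρ (s (σ i))⁻¹).mulVec v)
    {j : ℕ} {g : MvPolynomial (Fin n) ℝ}
    (hg : g ∈ vanishingIdeal ℝ n (orbit ℝ n (Set.range ρ) x) ^ (j + 1)) :
    ∑ i, linSubst (ρ (s i)⁻¹) g ∈
      invariantIdeal ℝ n (Set.range ρ) (orbit ℝ n (Set.range ρ) x) ⊔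
        pointIdeal x * vanishingIdeal ℝ n (orbit ℝ n (Set.range ρ) x) ^ (j + 1) := by
  let _ : MeasurableSpace G := borel G
  have : BorelSpace G := ⟨rfl⟩
  let μ : MeasureTheory.Measure G := MeasureTheory.Measure.haar
  set I := vanishingIdeal ℝ n (orbit ℝ n (Set.range ρ) x) with hI
  set T := invariantIdeal ℝ n (Set.range ρ) (orbit ℝ n (Set.range ρ) x) ⊔
    pointIdeal x * I ^ (j + 1) with hT
  have hinv : ∀ h, (ρ h).mulVec x = x → (ρ h⁻¹).mulVec x = x := by
    intro h hh
    conv_lhs => rw [← hh]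
    rw [Matrix.mulVec_mulVec, ← map_mul]
    simp
  by_contra hcon
  obtain ⟨l, hl, hlT⟩ := Submodule.exists_le_ker_of_notMem
    (p := T.restrictScalars ℝ) hcon
  have hl0 : ∀ p ∈ T, l p = 0 := fun p hp => hlT hp
  have hcont : ∀ a : G, Continuous fun k => l (linSubst (ρ (a * k)⁻¹) g) := fun a =>
    (continuous_apply_linSubst l g).comp (hρ.comp ((continuous_const_mul a).inv))
  have horth : ∀ p : MvPolynomial (Fin n) ℝ,
      ∫ k, eval ((ρ k⁻¹).mulVec x) p * l (linSubst (ρ k⁻¹) g) ∂μ = 0 := by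
    intro p
    obtain ⟨a, ha, hainv⟩ := exists_average_s1 μ ρ hρ (p * g)
    have hgx : ∀ k, eval ((ρ k).mulVec x) g = 0 := fun k =>
      Ideal.pow_le_self (Nat.succ_ne_zero j) hg _ (mem_orbit_range ρ x k)
    have hax : eval x a = 0 := by
      have := ha (aeval x).toLinearMap
      simpa [eval_linSubst, hgx, aeval_eq_eval] using this
    have haT : a ∈ T := by
      refine Ideal.mem_sup_left (Ideal.subset_span ⟨?_, ?_⟩)
      · rintro _ ⟨k, rfl⟩ v
        exact hainv k v
      · rintro _ ⟨_, ⟨k, rfl⟩, rfl⟩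
        exact (hainv k x).trans hax
    rw [← hl0 a haT, ha l]
    refine MeasureTheory.integral_congr_ae (Filter.Eventually.of_forall fun k => ?_)
    have h1 : linSubst (ρ k⁻¹) (p * g) - eval ((ρ k⁻¹).mulVec x) p • linSubst (ρ k⁻¹) g ∈ T := by
      refine Ideal.mem_sup_right ?_
      have : linSubst (ρ k⁻¹) (p * g) - eval ((ρ k⁻¹).mulVec x) p • linSubst (ρ k⁻¹) g =
          (linSubst (ρ k⁻¹) p - C (eval ((ρ k⁻¹).mulVec x) p)) * linSubst (ρ k⁻¹) g := by
        rw [map_mul, MvPolynomial.smul_eq_C_mul]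
        ring
      rw [this]
      exact Ideal.mul_mem_mul (by simp [mem_pointIdeal, eval_linSubst])
        (linSubst_mem_vanishingIdeal_pow ρ hg _)
    have h2 := hl0 _ h1
    rw [map_sub, map_smul, sub_eq_zero] at h2
    exact h2.symm
  let θ : G → ℝ := fun k => ∑ i, l (linSubst (ρ (s i * k)⁻¹) g)
  have hθP : ∀ h k, (ρ h).mulVec x = x → θ (h * k) = θ k := by
    intro h k hh
    obtain ⟨σ, hσ⟩ := hperm h hh
    have : ∀ i, l (linSubst (ρ (s i * (h * k))⁻¹) g) = l (linSubst (ρ (s (σ i) * k)⁻¹) g) := by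
      intro i
      rw [← sub_eq_zero, ← map_sub]
      refine hl0 _ (Ideal.mem_sup_right ?_)
      have e : ∀ a : G, linSubst (ρ (a * k)⁻¹) g = linSubst (ρ a⁻¹) (linSubst (ρ k⁻¹) g) := by
        intro a
        rw [← linSubst_mul, ← map_mul, mul_inv_rev]
      rw [← mul_assoc, e, e]
      refine linSubst_pow_sub_mem ρ hN ?_ ?_ (hσ i) j (linSubst_mem_vanishingIdeal_pow ρ hg _)
      · refine hinv _ ?_
        rw [map_mul, ← Matrix.mulVec_mulVec, hh, hs]
      · exact hinv _ (hs _)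
    simp only [θ, this]
    exact Equiv.sum_comp σ fun i => l (linSubst (ρ (s i * k)⁻¹) g)
  have hθ : θ 1 = 0 := by
    refine eq_zero_of_integral_eval_mul_eq_zero μ (q := fun k => (ρ k⁻¹).mulVec x)
      (Continuous.matrix_mulVec (hρ.comp continuous_inv) continuous_const)
      (continuous_finsetSum _ fun i _ => hcont (s i)) ?_ ?_ 1
    · intro k k' hkk
      have : (ρ (k * k'⁻¹)).mulVec x = x := by
        rw [map_mul, ← Matrix.mulVec_mulVec]
        rw [show (ρ k'⁻¹).mulVec x = (ρ k⁻¹).mulVec x from hkk.symm, Matrix.mulVec_mulVec, ← map_mul]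
        simp
      have h := hθP (k * k'⁻¹) k' this
      rwa [inv_mul_cancel_right] at h
    · intro p
      have hterm : ∀ i, ∫ k, eval ((ρ k⁻¹).mulVec x) p * l (linSubst (ρ (s i * k)⁻¹) g) ∂μ = 0 := by
        intro i
        rw [← horth p]
        conv_rhs => rw [← MeasureTheory.integral_mul_left_eq_self _ (s i)]
        refine MeasureTheory.integral_congr_ae (Filter.Eventually.of_forall fun k => ?_)
        have : (ρ (s i * k)⁻¹).mulVec x = (ρ k⁻¹).mulVec x := by
          rw [mul_inv_rev, map_mul, ← Matrix.mulVec_mulVec, hinv _ (hs i)]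
        simp only [this]
      simp only [Finset.mul_sum]
      rw [MeasureTheory.integral_finsetSum]
      · exact Finset.sum_eq_zero fun i _ => hterm i
      · intro i _
        refine Continuous.integrable_of_hasCompactSupport (Continuous.mul ?_ (hcont (s i)))
          (HasCompactSupport.of_compactSpace _)
        have := (continuous_apply_linSubst (aeval x).toLinearMap p).comp (hρ.comp continuous_inv)
        simpa [Function.comp_def, aeval_eq_eval, eval_linSubst] using this
  apply hl
  simpa [θ, map_sum] using hθ

/-- A finite-group trick: products of `r` elements of the vanishing ideal of an orbit with slice
group of order `r` are generated by invariants modulo higher-order terms. -/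
theorem prod_mem [TopologicalSpace G] [IsTopologicalGroup G] [CompactSpace G]
    (hρ : Continuous ρ) {N : Submodule ℝ (Fin n → ℝ)}
    (hN : IsCompl (orbitTangent ℝ n (Set.range ρ) x) N) {ι : Type} [Fintype ι] [Nonempty ι]
    {s : ι → G}
    (hs : ∀ i, (ρ (s i)).mulVec x = x)
    (hperm : ∀ h, (ρ h).mulVec x = x → ∃ σ : Equiv.Perm ι,
      ∀ i, ∀ v ∈ N, (ρ (s i * h)⁻¹).mulVec v = (ρ (s (σ i))⁻¹).mulVec v)
    (hinv : ∀ i, ∃ j, ∀ v ∈ N, (ρ (s i * s j)⁻¹).mulVec v = v)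
    {f : ι → MvPolynomial (Fin n) ℝ}
    (hf : ∀ i, f i ∈ vanishingIdeal ℝ n (orbit ℝ n (Set.range ρ) x)) :
    ∏ i, f i ∈
      invariantIdeal ℝ n (Set.range ρ) (orbit ℝ n (Set.range ρ) x) ⊔
        pointIdeal x * vanishingIdeal ℝ n (orbit ℝ n (Set.range ρ) x) ^ Fintype.card ι := by
  classical
  set I := vanishingIdeal ℝ n (orbit ℝ n (Set.range ρ) x) with hI
  set T := invariantIdeal ℝ n (Set.range ρ) (orbit ℝ n (Set.range ρ) x) ⊔
    pointIdeal x * I ^ Fintype.card ι with hT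
  have hprodI : ∀ (U : Finset ι) (u : ι → MvPolynomial (Fin n) ℝ), (∀ i ∈ U, u i ∈ I) →
      ∏ i ∈ U, u i ∈ I ^ U.card := by
    intro U u hu
    have := Ideal.prod_mem_prod (I := fun _ => I) hu
    simpa using this
  have hleft : ∑ j, ∏ i, (linSubst (ρ (s j * s i)⁻¹) (f i) + -f i) ∈ T := by
    refine sum_mem fun j _ => Ideal.mem_sup_right ?_
    obtain ⟨i, hi⟩ := hinv j
    rw [← Finset.mul_prod_erase _ _ (Finset.mem_univ i)]
    have h1 : linSubst (ρ (s j * s i)⁻¹) (f i) + -f i ∈ pointIdeal x * I := by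
      have hx : (ρ (s j * s i)⁻¹).mulVec x = x := by
        have : (ρ (s j * s i)).mulVec x = x := by
          rw [map_mul, ← Matrix.mulVec_mulVec, hs, hs]
        conv_lhs => rw [← this]
        rw [Matrix.mulVec_mulVec, ← map_mul]
        simp
      have := linSubst_sub_mem ρ hN (h := (s j * s i)⁻¹) (h' := 1) hx (by simp)
        (fun v hv => by simpa using hi v hv) (hf i)
      rwa [map_one, linSubst_one, sub_eq_add_neg] at this
    have h2 := hprodI (Finset.univ.erase i) (fun i => linSubst (ρ (s j * s i)⁻¹) (f i) + -f i)
      fun i _ => add_mem (linSubst_mem_vanishingIdeal ρ (hf i) _) (neg_mem (hf i))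
    have h3 := Ideal.mul_mem_mul h1 h2
    rw [mul_assoc, ← pow_succ', Finset.card_erase_add_one (Finset.mem_univ i)] at h3
    exact h3
  have hexp : ∑ j, ∏ i, (linSubst (ρ (s j * s i)⁻¹) (f i) + -f i) =
      ∑ U : Finset ι, (∑ j, linSubst (ρ (s j)⁻¹) (∏ i ∈ U, linSubst (ρ (s i)⁻¹) (f i))) *
        ∏ i ∈ Finset.univ \ U, -f i := by
    simp only [Finset.prod_add, Finset.sum_mul]
    rw [Finset.sum_comm, Finset.powerset_univ]
    refine Finset.sum_congr rfl fun U _ => Finset.sum_congr rfl fun j _ => ?_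
    rw [map_prod]
    congr 1
    refine Finset.prod_congr rfl fun i _ => ?_
    rw [← linSubst_mul, ← map_mul, mul_inv_rev]
  rw [hexp, ← Finset.add_sum_erase _ _ (Finset.mem_univ (∅ : Finset ι))] at hleft
  have hrest : ∀ U ∈ Finset.univ.erase (∅ : Finset ι),
      (∑ j, linSubst (ρ (s j)⁻¹) (∏ i ∈ U, linSubst (ρ (s i)⁻¹) (f i))) *
        ∏ i ∈ Finset.univ \ U, -f i ∈ T := by
    intro U hU
    have hU0 : U.card ≠ 0 := by
      simpa using Finset.ne_of_mem_erase hU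
    obtain ⟨m, hm⟩ := Nat.exists_eq_succ_of_ne_zero hU0
    have h1 := hprodI U (fun i => linSubst (ρ (s i)⁻¹) (f i))
      fun i _ => linSubst_mem_vanishingIdeal ρ (hf i) _
    rw [hm] at h1
    have h2 := sum_linSubst_mem ρ hρ hN hs hperm h1
    have h3 := hprodI (Finset.univ \ U) (fun i => -f i) fun i _ => neg_mem (hf i)
    have h4 := Ideal.mul_mem_mul h2 h3
    rw [Ideal.sup_mul, mul_assoc, ← pow_add, ← Nat.succ_eq_add_one, ← hm, add_comm,
      Finset.card_sdiff_add_card_eq_card (Finset.subset_univ U), Finset.card_univ] at h4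
    have hle : invariantIdeal ℝ n (Set.range ρ) (orbit ℝ n (Set.range ρ) x) *
        I ^ (Finset.univ \ U).card ⊔ pointIdeal x * I ^ Fintype.card ι ≤ T :=
      sup_le_sup_right Ideal.mul_le_left _
    exact hle h4
  have h5 := (Submodule.add_mem_iff_left T (sum_mem hrest)).1 hleft
  simp only [Finset.prod_empty, map_one, Finset.sum_const, Finset.card_univ,
    Finset.sdiff_empty, Finset.prod_neg, nsmul_one] at h5
  obtain ⟨m, hm⟩ := Nat.exists_eq_succ_of_ne_zero (Fintype.card_ne_zero (α := ι))
  refine mem_of_succ_nsmul_mem (k := m) ?_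
  rw [← Nat.succ_eq_add_one, ← hm, nsmul_eq_mul]
  have h6 := T.mul_mem_left ((-1) ^ Fintype.card ι) h5
  convert h6 using 1
  have : ((-1 : MvPolynomial (Fin n) ℝ) ^ Fintype.card ι) * (-1) ^ Fintype.card ι = 1 := by
    rw [← mul_pow]
    simp
  linear_combination (-(Fintype.card ι : MvPolynomial (Fin n) ℝ) * ∏ i, f i) * this

end Averaging

section Descent

variable {G : Type} [Group G] (ρ : G →* Matrix (Fin n) (Fin n) ℝ) {x : Fin n → ℝ}

theorem linSubst_mem_invariantIdeal {f : MvPolynomial (Fin n) ℝ} {X : Set (Fin n → ℝ)}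
    (hf : f ∈ invariantIdeal ℝ n (Set.range ρ) X) (k : G) :
    linSubst (ρ k) f ∈ invariantIdeal ℝ n (Set.range ρ) X := by
  suffices h : invariantIdeal ℝ n (Set.range ρ) X ≤
      (invariantIdeal ℝ n (Set.range ρ) X).comap (linSubst (ρ k)) by exact h hf
  refine Ideal.span_le.2 ?_
  rintro p ⟨hp, hpX⟩
  have : linSubst (ρ k) p = p :=
    MvPolynomial.funext fun y => by rw [eval_linSubst, hp _ ⟨k, rfl⟩]
  change linSubst (ρ k) p ∈ invariantIdeal ℝ n (Set.range ρ) X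
  rw [this]
  exact Ideal.subset_span ⟨hp, hpX⟩

theorem linSubst_linSubst_inv (k : G) (f : MvPolynomial (Fin n) ℝ) :
    linSubst (ρ k) (linSubst (ρ k⁻¹) f) = f := by
  rw [← linSubst_mul, ← map_mul, inv_mul_cancel, map_one, linSubst_one]

/-- If a power of the vanishing ideal of an orbit is generated by invariants locally at one point
of the orbit, then it is so globally. -/
theorem pow_le_invariantIdeal_of_local [TopologicalSpace G] [IsTopologicalGroup G] [CompactSpace G]
    (hρ : Continuous ρ) {r : ℕ}
    (h : vanishingIdeal ℝ n (orbit ℝ n (Set.range ρ) x) ^ r ≤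
      invariantIdeal ℝ n (Set.range ρ) (orbit ℝ n (Set.range ρ) x) ⊔
        pointIdeal x * vanishingIdeal ℝ n (orbit ℝ n (Set.range ρ) x) ^ r) :
    vanishingIdeal ℝ n (orbit ℝ n (Set.range ρ) x) ^ r ≤
      invariantIdeal ℝ n (Set.range ρ) (orbit ℝ n (Set.range ρ) x) := by
  let _ : MeasurableSpace G := borel G
  have : BorelSpace G := ⟨rfl⟩
  let μ : MeasureTheory.Measure G := MeasureTheory.Measure.haar
  set I := vanishingIdeal ℝ n (orbit ℝ n (Set.range ρ) x) with hI
  set Q := invariantIdeal ℝ n (Set.range ρ) (orbit ℝ n (Set.range ρ) x) with hQ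
  obtain ⟨g, hgx, hg⟩ := Submodule.exists_sub_one_mem_and_smul_le_of_fg_of_le_sup
    (IsNoetherian.noetherian (I ^ r)) le_rfl h
  have hgx : eval x g = 1 := by
    rw [mem_pointIdeal, map_sub, map_one, sub_eq_zero] at hgx
    exact hgx
  have hmem : ∀ p, (∀ u ∈ I ^ r, p * u ∈ Q) ↔ p ∈ Q.colon ((I ^ r : Ideal _) : Set _) := by
    intro p
    rw [Submodule.mem_colon]
    rfl
  have hgJ : ∀ u ∈ I ^ r, g * u ∈ Q := fun u hu =>
    hg (Submodule.smul_mem_pointwise_smul u g _ hu)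
  obtain ⟨b, hb, hbinv⟩ := exists_average_s1 μ ρ hρ (g * g)
  have hbJ : b ∈ Q.colon ((I ^ r : Ideal _) : Set _) := by
    by_contra hcon
    obtain ⟨l, hl, hlT⟩ := Submodule.exists_le_ker_of_notMem
      (p := (Q.colon ((I ^ r : Ideal _) : Set _)).restrictScalars ℝ) hcon
    refine hl ((hb l).trans ?_)
    have : ∀ k, l (linSubst (ρ k⁻¹) (g * g)) = 0 := by
      intro k
      refine hlT ((hmem _).1 fun u hu => ?_)
      have h1 := linSubst_mem_invariantIdeal ρ
        (hgJ _ (linSubst_mem_vanishingIdeal_pow ρ hu k)) k⁻¹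
      have h2 := linSubst_linSubst_inv ρ k⁻¹ u
      rw [inv_inv] at h2
      rw [map_mul, h2] at h1
      rw [map_mul, mul_assoc]
      exact Ideal.mul_mem_left _ _ h1
    simp only [this, MeasureTheory.integral_zero]
  have hbx : 0 < eval x b := by
    have h1 : eval x b = ∫ k, eval ((ρ k⁻¹).mulVec x) g * eval ((ρ k⁻¹).mulVec x) g ∂μ := by
      simpa [eval_linSubst, aeval_eq_eval] using hb (aeval x).toLinearMap
    have hcont : Continuous fun k => eval ((ρ k⁻¹).mulVec x) g := by
      have := (continuous_apply_linSubst (aeval x).toLinearMap g).comp (hρ.comp continuous_inv)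
      simpa [Function.comp_def, aeval_eq_eval, eval_linSubst] using this
    rw [h1]
    exact Continuous.integral_pos_of_hasCompactSupport_nonneg_nonzero (x := 1) (hcont.mul hcont)
      (HasCompactSupport.of_compactSpace _) (fun k => mul_self_nonneg _) (by simp [hgx])
  have hbQ : b - C (eval x b) ∈ Q := by
    refine Ideal.subset_span ⟨?_, ?_⟩
    · rintro _ ⟨k, rfl⟩ v
      simp [hbinv]
    · rintro _ ⟨_, ⟨k, rfl⟩, rfl⟩
      simp [hbinv]
  intro u hu
  have h1 := (hmem b).2 hbJ u hu
  have h2 := Q.mul_mem_left (C (eval x b)⁻¹) (sub_mem h1 (Q.mul_mem_right u hbQ))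
  have h3 : C (eval x b)⁻¹ * (b * u - (b - C (eval x b)) * u) = u := by
    have : (C (eval x b)⁻¹ * C (eval x b) : MvPolynomial (Fin n) ℝ) = 1 := by
      rw [← C_mul, inv_mul_cancel₀ hbx.ne', C_1]
    linear_combination u * this
  rwa [h3] at h2

/-- The power of the vanishing ideal of an orbit given by the order of a finite slice group is
generated by invariants. -/
theorem pow_card_le_invariantIdeal [TopologicalSpace G] [IsTopologicalGroup G] [CompactSpace G]
    (hρ : Continuous ρ) {N : Submodule ℝ (Fin n → ℝ)}
    (hN : IsCompl (orbitTangent ℝ n (Set.range ρ) x) N) {ι : Type} [Fintype ι] [Nonempty ι]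
    {s : ι → G}
    (hs : ∀ i, (ρ (s i)).mulVec x = x)
    (hperm : ∀ h, (ρ h).mulVec x = x → ∃ σ : Equiv.Perm ι,
      ∀ i, ∀ v ∈ N, (ρ (s i * h)⁻¹).mulVec v = (ρ (s (σ i))⁻¹).mulVec v)
    (hinv : ∀ i, ∃ j, ∀ v ∈ N, (ρ (s i * s j)⁻¹).mulVec v = v) :
    vanishingIdeal ℝ n (orbit ℝ n (Set.range ρ) x) ^ Fintype.card ι ≤
      invariantIdeal ℝ n (Set.range ρ) (orbit ℝ n (Set.range ρ) x) := by
  refine pow_le_invariantIdeal_of_local ρ hρ ?_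
  conv_lhs => rw [Submodule.pow_eq_span_pow_set]
  refine Submodule.span_le.2 fun u hu => ?_
  obtain ⟨f, rfl⟩ := Set.mem_pow.1 hu
  rw [List.prod_ofFn, ← Equiv.prod_comp (Fintype.equivFin ι)]
  exact prod_mem ρ hρ hN hs hperm hinv fun i => (f _).2

end Descent

section SliceGroup

variable {G : Type} [Group G] (ρ : G →* Matrix (Fin n) (Fin n) ℝ)

theorem mulVec_map_mul (a b : G) (v : Fin n → ℝ) :
    (ρ (a * b)).mulVec v = (ρ a).mulVec ((ρ b).mulVec v) := by
  rw [map_mul, Matrix.mulVec_mulVec]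

theorem mulVec_map_inv_of_mulVec_eq {a : G} {v w : Fin n → ℝ} (h : (ρ a).mulVec v = w) :
    (ρ a⁻¹).mulVec w = v := by
  rw [← h, ← mulVec_map_mul, inv_mul_cancel, map_one, Matrix.one_mulVec]

theorem mulVec_map_mulVec_inv (a : G) (v : Fin n → ℝ) :
    (ρ a).mulVec ((ρ a⁻¹).mulVec v) = v := by
  rw [← mulVec_map_mul, mul_inv_cancel, map_one, Matrix.one_mulVec]

/-- If the slice group at `x` is finite of order `r`, then the `r`-th power of the vanishing ideal
of the orbit of `x` is generated by invariants vanishing on the orbit. -/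
theorem pow_ncard_le_invariantIdeal [TopologicalSpace G] [IsTopologicalGroup G] [CompactSpace G]
    (hρ : Continuous ρ) {x : Fin n → ℝ} {N : Submodule ℝ (Fin n → ℝ)}
    (hN : IsSliceComplement ℝ n (Set.range ρ) x N)
    (hfin : HasFiniteImageOn ℝ n (isotropy ℝ n (Set.range ρ) x) N) :
    vanishingIdeal ℝ n (orbit ℝ n (Set.range ρ) x) ^
        Set.ncard ((fun g => fun x : N => Matrix.mulVec g (x : Fin n → ℝ)) ''
          isotropy ℝ n (Set.range ρ) x) ≤
      invariantIdeal ℝ n (Set.range ρ) (orbit ℝ n (Set.range ρ) x) := by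
  classical
  set S := (fun g => fun x : N => Matrix.mulVec g (x : Fin n → ℝ)) ''
    isotropy ℝ n (Set.range ρ) x with hS
  have hSfin : S.Finite := hfin
  let F : G → N → Fin n → ℝ := fun g v => (ρ g).mulVec v
  have hP : ∀ g, (ρ g).mulVec x = x → F g ∈ S := fun g hg => ⟨ρ g, ⟨⟨g, rfl⟩, hg⟩, rfl⟩
  have hNst : ∀ g, (ρ g).mulVec x = x → ∀ v ∈ N, (ρ g).mulVec v ∈ N :=
    fun g hg => hN.2 _ ⟨⟨g, rfl⟩, hg⟩
  have hs : ∀ i : S, ∃ g, (ρ g).mulVec x = x ∧ F g = i := by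
    rintro ⟨_, _, ⟨⟨g, rfl⟩, hg⟩, rfl⟩
    exact ⟨g, hg, rfl⟩
  choose s hsx hsF using hs
  have hsv : ∀ i : S, ∀ g, F g = i → ∀ v ∈ N, (ρ (s i)).mulVec v = (ρ g).mulVec v :=
    fun i g hg v hv => congrFun ((hsF i).trans hg.symm) ⟨v, hv⟩
  let _ : Fintype S := hSfin.fintype
  have : Nonempty S := ⟨⟨F 1, hP 1 (by simp)⟩⟩
  rw [← Nat.card_coe_set_eq, Nat.card_eq_fintype_card]
  refine pow_card_le_invariantIdeal ρ hρ hN.1 hsx ?_ ?_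
  · intro h hh
    have hmul : ∀ i, (ρ (s i * h)).mulVec x = x := fun i => by rw [mulVec_map_mul, hh, hsx]
    let σ : S → S := fun i => ⟨F (s i * h), hP _ (hmul i)⟩
    have hσ : Function.Injective σ := by
      intro i j hij
      have hij' : F (s i * h) = F (s j * h) := congrArg Subtype.val hij
      refine Subtype.ext ?_
      rw [← hsF i, ← hsF j]
      funext v
      have h1 := congrFun hij' ⟨_, hNst _ (mulVec_map_inv_of_mulVec_eq ρ hh) v v.2⟩
      simpa only [F, mulVec_map_mul, mulVec_map_mulVec_inv] using h1
    refine ⟨Equiv.ofBijective σ (Finite.injective_iff_bijective.1 hσ), fun i v hv => ?_⟩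
    refine mulVec_map_inv_of_mulVec_eq ρ ?_
    have h1 := hNst _ (mulVec_map_inv_of_mulVec_eq ρ (hsx (σ i))) v hv
    change (ρ (s i * h)).mulVec ((ρ (s (σ i))⁻¹).mulVec v) = v
    rw [← hsv (σ i) (s i * h) rfl _ h1, mulVec_map_mulVec_inv]
  · intro i
    have hi := mulVec_map_inv_of_mulVec_eq ρ (hsx i)
    refine ⟨⟨F (s i)⁻¹, hP _ hi⟩, fun v hv => mulVec_map_inv_of_mulVec_eq ρ ?_⟩
    rw [mulVec_map_mul, hsv _ (s i)⁻¹ rfl v hv, mulVec_map_mulVec_inv]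

end SliceGroup

theorem exists_compact_group_range_eq {K : Set (Matrix (Fin n) (Fin n) ℝ)}
    (hK : IsMatSubgroup ℝ n K) (hKcpt : IsCompact K) :
    ∃ (G : Type) (_ : Group G) (_ : TopologicalSpace G) (_ : IsTopologicalGroup G)
      (_ : CompactSpace G) (ρ : G →* Matrix (Fin n) (Fin n) ℝ),
      Continuous ρ ∧ Set.range ρ = K := by
  let G : Subgroup (Matrix (Fin n) (Fin n) ℝ)ˣ :=
    { carrier := {u | (u : Matrix (Fin n) (Fin n) ℝ) ∈ K}
      one_mem' := hK.1
      mul_mem' := fun ha hb => hK.2.1 _ ha _ hb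
      inv_mem' := fun {u} hu => by
        have := (hK.2.2 _ hu).2
        rwa [← Matrix.coe_units_inv] at this }
  have hemb : Topology.IsInducing
      (Units.val : (Matrix (Fin n) (Fin n) ℝ)ˣ → Matrix (Fin n) (Fin n) ℝ) := by
    let _ : NormedRing (Matrix (Fin n) (Fin n) ℝ) := Matrix.linftyOpNormedRing
    let _ : NormedAlgebra ℝ (Matrix (Fin n) (Fin n) ℝ) := Matrix.linftyOpNormedAlgebra
    have : CompleteSpace (Matrix (Fin n) (Fin n) ℝ) := FiniteDimensional.complete ℝ _
    exact Units.isOpenEmbedding_val.isInducing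
  have hrange : K ⊆ Set.range
      (Units.val : (Matrix (Fin n) (Fin n) ℝ)ˣ → Matrix (Fin n) (Fin n) ℝ) :=
    fun k hk => (hK.2.2 k hk).1
  have hcpt : CompactSpace G :=
    isCompact_iff_compactSpace.1 ((hemb.isCompact_preimage_iff hrange).2 hKcpt)
  refine ⟨G, inferInstance, inferInstance, inferInstance, hcpt, (Units.coeHom _).comp G.subtype,
    Units.continuous_val.comp continuous_subtype_val, ?_⟩
  ext k
  constructor
  · rintro ⟨u, rfl⟩
    exact u.2
  · intro hk
    obtain ⟨u, rfl⟩ := hrange hk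
    exact ⟨⟨u, hk⟩, rfl⟩

theorem exists_pow_le_invariantIdeal {K : Set (Matrix (Fin n) (Fin n) ℝ)}
    (hK : IsMatSubgroup ℝ n K) (hKcpt : IsCompact K) {x : Fin n → ℝ}
    (hx : x ∈ aprPoints ℝ n K) :
    ∃ r : ℕ, vanishingIdeal ℝ n (orbit ℝ n K x) ^ r ≤ invariantIdeal ℝ n K (orbit ℝ n K x) := by
  obtain ⟨G, _, _, _, _, ρ, hρ, rfl⟩ := exists_compact_group_range_eq hK hKcpt
  obtain ⟨-, N, hN, hfin⟩ := hx
  exact ⟨_, pow_ncard_le_invariantIdeal ρ hρ hN hfin⟩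

theorem vanishingIdeal_le_invariantIdeal {K : Set (Matrix (Fin n) (Fin n) ℝ)}
    (hK : IsMatSubgroup ℝ n K) (hKcpt : IsCompact K) {x : Fin n → ℝ}
    (hx : x ∈ prPoints ℝ n K) :
    vanishingIdeal ℝ n (orbit ℝ n K x) ≤ invariantIdeal ℝ n K (orbit ℝ n K x) := by
  obtain ⟨G, _, _, _, _, ρ, hρ, rfl⟩ := exists_compact_group_range_eq hK hKcpt
  obtain ⟨-, N, hN, htriv⟩ := hx
  have himage : (fun g => fun x : N => Matrix.mulVec g (x : Fin n → ℝ)) ''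
      isotropy ℝ n (Set.range ρ) x = {Subtype.val} := by
    refine Set.eq_singleton_iff_unique_mem.2 ⟨⟨1, ⟨⟨1, map_one ρ⟩, Matrix.one_mulVec x⟩, ?_⟩, ?_⟩
    · funext v
      exact Matrix.one_mulVec _
    · rintro _ ⟨g, hg, rfl⟩
      funext v
      exact htriv g hg v v.2
  have hfin : HasFiniteImageOn ℝ n (isotropy ℝ n (Set.range ρ) x) N := by
    rw [HasFiniteImageOn, himage]
    exact Set.finite_singleton _
  have h := pow_ncard_le_invariantIdeal ρ hρ hN hfin
  rwa [himage, Set.ncard_singleton, pow_one] at h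

section Cofree

theorem invariantIdeal_eq_map (K : Set (Matrix (Fin n) (Fin n) ℝ)) (X : Set (Fin n → ℝ)) :
    invariantIdeal ℝ n K X = (quotVanishingIdeal ℝ n K X).map
      (algebraMap (invariantSubalgebra ℝ n K) (MvPolynomial (Fin n) ℝ)) := by
  refine le_antisymm (Ideal.span_le.2 ?_) (Ideal.map_le_iff_le_comap.2 ?_)
  · rintro p ⟨hp, hpX⟩
    have h : (⟨p, hp⟩ : invariantSubalgebra ℝ n K) ∈ quotVanishingIdeal ℝ n K X := hpX
    exact Ideal.mem_map_of_mem
      (algebraMap (invariantSubalgebra ℝ n K) (MvPolynomial (Fin n) ℝ)) h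
  · intro p hp
    exact Ideal.subset_span ⟨p.2, hp⟩

theorem invariantIdeal_le_vanishingIdeal (K : Set (Matrix (Fin n) (Fin n) ℝ))
    (X : Set (Fin n → ℝ)) : invariantIdeal ℝ n K X ≤ vanishingIdeal ℝ n X :=
  Ideal.span_le.2 fun _ hp => hp.2

theorem vanishingIdeal_isRadical (X : Set (Fin n → ℝ)) : (vanishingIdeal ℝ n X).IsRadical := by
  rintro p ⟨r, hr⟩ x hx
  have := hr x hx
  rw [map_pow] at this
  exact eq_zero_of_pow_eq_zero this

theorem vanishingIdeal_le_vanishingIdeal_orbit {K : Set (Matrix (Fin n) (Fin n) ℝ)}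
    {X : Set (Fin n → ℝ)} (hX : Stabilizes ℝ n K X) {x : Fin n → ℝ} (hx : x ∈ X) :
    vanishingIdeal ℝ n X ≤ vanishingIdeal ℝ n (orbit ℝ n K x) := by
  rintro f hf _ ⟨g, hg, rfl⟩
  exact hf _ (hX g hg x hx)

/-- Coordinates with respect to a basis of the extension of an ideal lie in the ideal. -/
theorem repr_mem_of_mem_map {A B ι : Type} [CommRing A] [CommRing B] [Algebra A B]
    (b : Module.Basis ι A B) {J : Ideal A} {f : B} (hf : f ∈ J.map (algebraMap A B)) (i : ι) :
    b.repr f i ∈ J := by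
  have hf' : f ∈ (J • ⊤ : Submodule A B) := by
    rw [Ideal.smul_top_eq_map]
    exact hf
  refine Submodule.smul_induction_on hf' (fun a ha m _ => ?_) fun p q hp hq => ?_
  · rw [map_smul, Finsupp.smul_apply, smul_eq_mul]
    exact J.mul_mem_right _ ha
  · rw [map_add, Finsupp.add_apply]
    exact add_mem hp hq

theorem mem_map_of_repr_mem {A B ι : Type} [CommRing A] [CommRing B] [Algebra A B]
    (b : Module.Basis ι A B) {J : Ideal A} {f : B} (hf : ∀ i, b.repr f i ∈ J) :
    f ∈ J.map (algebraMap A B) := by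
  rw [← b.linearCombination_repr f, Finsupp.linearCombination_apply]
  refine sum_mem fun i _ => ?_
  change b.repr f i • b i ∈ _
  rw [Algebra.smul_def]
  exact Ideal.mul_mem_right _ _ (Ideal.mem_map_of_mem _ (hf i))

theorem isGReduced_of_prPoints_dense {K : Set (Matrix (Fin n) (Fin n) ℝ)}
    (hK : IsMatSubgroup ℝ n K) (hKcpt : IsCompact K) (hcofree : IsCofree ℝ n K)
    {X : Set (Fin n → ℝ)} (hX : Stabilizes ℝ n K X)
    (hdense : ZDenseIn ℝ n (X ∩ prPoints ℝ n K) X) : IsGReduced ℝ n K X := by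
  have : Module.Free (invariantSubalgebra ℝ n K) (MvPolynomial (Fin n) ℝ) := hcofree
  let b := Module.Free.chooseBasis (invariantSubalgebra ℝ n K) (MvPolynomial (Fin n) ℝ)
  refine le_antisymm (invariantIdeal_le_vanishingIdeal K X) fun f hf => ?_
  rw [invariantIdeal_eq_map]
  refine mem_map_of_repr_mem b fun i => hdense _ ?_
  rintro x ⟨hxX, hx⟩
  have h := vanishingIdeal_le_invariantIdeal hK hKcpt hx
    (vanishingIdeal_le_vanishingIdeal_orbit hX hxX hf)
  rw [invariantIdeal_eq_map] at h
  exact repr_mem_of_mem_map b h i x ⟨1, hK.1, Matrix.one_mulVec x⟩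

/-- Noetherianity descends along faithfully flat extensions. -/
theorem isNoetherianRing_of_faithfullyFlat (A B : Type) [CommRing A] [CommRing B] [Algebra A B]
    [Module.FaithfullyFlat A B] [IsNoetherianRing B] : IsNoetherianRing A := by
  let e : Ideal A ↪o Ideal B := OrderEmbedding.ofMapLEIff (Ideal.map (algebraMap A B)) fun I J => by
    refine ⟨fun h => ?_, Ideal.map_mono⟩
    rw [← Ideal.comap_map_eq_self_of_faithfullyFlat (B := B) I,
      ← Ideal.comap_map_eq_self_of_faithfullyFlat (B := B) J]
    exact Ideal.comap_mono h
  have : WellFoundedGT (Ideal A) := e.wellFoundedGT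
  exact isNoetherian_iff'.2 this

theorem isOpenMap_comap_of_isCofree {K : Set (Matrix (Fin n) (Fin n) ℝ)}
    (hcofree : IsCofree ℝ n K) :
    IsOpenMap (PrimeSpectrum.comap
      (algebraMap (invariantSubalgebra ℝ n K) (MvPolynomial (Fin n) ℝ))) := by
  have : Module.Free (invariantSubalgebra ℝ n K) (MvPolynomial (Fin n) ℝ) := hcofree
  have : IsNoetherianRing (invariantSubalgebra ℝ n K) :=
    isNoetherianRing_of_faithfullyFlat _ (MvPolynomial (Fin n) ℝ)
  have : Algebra.FiniteType (invariantSubalgebra ℝ n K) (MvPolynomial (Fin n) ℝ) :=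
    Algebra.FiniteType.of_restrictScalars_finiteType ℝ _ _
  have : Algebra.FinitePresentation (invariantSubalgebra ℝ n K) (MvPolynomial (Fin n) ℝ) :=
    Algebra.FinitePresentation.of_finiteType.1 this
  exact PrimeSpectrum.isOpenMap_comap_of_hasGoingDown_of_finitePresentation

theorem isAlmostGReduced_of_aprPoints_dense {K : Set (Matrix (Fin n) (Fin n) ℝ)}
    (hK : IsMatSubgroup ℝ n K) (hKcpt : IsCompact K) (hcofree : IsCofree ℝ n K)
    {X : Set (Fin n → ℝ)} (hX : Stabilizes ℝ n K X)
    (hdense : ZDenseIn ℝ n (X ∩ aprPoints ℝ n K) X) : IsAlmostGReduced ℝ n K X := by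
  refine le_antisymm ((vanishingIdeal_isRadical X).radical_le_iff.2
    (invariantIdeal_le_vanishingIdeal K X)) fun f hf => ?_
  rw [Ideal.radical_eq_sInf, Submodule.mem_sInf]
  rintro P ⟨hP, hPprime⟩
  by_contra hfP
  have hopen := isOpenMap_comap_of_isCofree hcofree _
    (PrimeSpectrum.basicOpen f).isOpen
  obtain ⟨_, ⟨a, rfl⟩, haP, ha⟩ :=
    PrimeSpectrum.isTopologicalBasis_basic_opens.exists_subset_of_mem_open
      (Set.mem_image_of_mem _ (show (⟨P, hPprime⟩ : PrimeSpectrum _) ∈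
        (PrimeSpectrum.basicOpen f : Set _) from hfP)) hopen
  have haX : ∃ x ∈ X ∩ aprPoints ℝ n K, eval x (a : MvPolynomial (Fin n) ℝ) ≠ 0 := by
    by_contra! hcon
    exact haP (hP (Ideal.subset_span ⟨a.2, hdense _ hcon⟩))
  obtain ⟨x, ⟨hxX, hx⟩, hax⟩ := haX
  have hprime : (quotVanishingIdeal ℝ n K (orbit ℝ n K x)).IsPrime := by
    have hmem : ∀ p : invariantSubalgebra ℝ n K,
        p ∈ quotVanishingIdeal ℝ n K (orbit ℝ n K x) ↔
          eval x (p : MvPolynomial (Fin n) ℝ) = 0 := by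
      refine fun p => ⟨fun h => h x ⟨1, hK.1, Matrix.one_mulVec x⟩, ?_⟩
      rintro h _ ⟨g, hg, rfl⟩
      exact (p.2 g hg x).trans h
    refine ⟨fun h => ?_, fun {p q} hpq => ?_⟩
    · have := (hmem 1).1 (h ▸ Submodule.mem_top)
      simp at this
    · simpa [hmem] using hpq
  obtain ⟨P', hfP', hP'⟩ := ha (show (⟨_, hprime⟩ : PrimeSpectrum _) ∈
    (PrimeSpectrum.basicOpen a : Set _) from fun h =>
      hax (h x ⟨1, hK.1, Matrix.one_mulVec x⟩))
  obtain ⟨r, hr⟩ := exists_pow_le_invariantIdeal hK hKcpt hx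
  have hle : invariantIdeal ℝ n K (orbit ℝ n K x) ≤ P'.asIdeal := by
    rw [invariantIdeal_eq_map, Ideal.map_le_iff_le_comap]
    exact (congrArg PrimeSpectrum.asIdeal hP').ge
  exact hfP' (P'.isPrime.mem_of_pow_mem r
    (hle (hr (Ideal.pow_mem_pow (vanishingIdeal_le_vanishingIdeal_orbit hX hxX hf) r))))

end Cofree
end SliceTheory

/-- **Theorem 1.1 (sufficiency for cofree modules).** Let `K` be a compact Lie group
(realized as a compact subgroup of `GL_n(ℝ)`) acting cofreely on `W = ℝⁿ` and let `X ⊆ W`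
be a `K`-stable real algebraic set.  If `X_pr` (resp. `X_apr`) is Zariski dense in `X`, then
`X` is `K`-reduced (resp. almost `K`-reduced). -/
theorem cofree_principal_dense_implies_K_reduced
    (n : ℕ) (K : Set (Matrix (Fin n) (Fin n) ℝ))
    (hKgrp : IsMatSubgroup ℝ n K) (hKcpt : IsCompact K) (hcofree : IsCofree ℝ n K)
    (X : Set (Fin n → ℝ)) (hXalg : IsAlgebraicSet ℝ n X) (hXstab : Stabilizes ℝ n K X) :
    (ZDenseIn ℝ n (X ∩ prPoints ℝ n K) X → IsGReduced ℝ n K X) ∧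
    (ZDenseIn ℝ n (X ∩ aprPoints ℝ n K) X → IsAlmostGReduced ℝ n K X) := by
  exact ⟨isGReduced_of_prPoints_dense hKgrp hKcpt hcofree hXstab,
    isAlmostGReduced_of_aprPoints_dense hKgrp hKcpt hcofree hXstab⟩

end ZPaper
end
end
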